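/- Hölder continuity at the boundary: there exist constants α ∈ (0,1] and C > 0, depending only on n, d, C₀, and C₁, with the following property. Let B = B(x,r) be a ball centered at x ∈ Γ and let u ∈ W_r(B) be a solution of Lu = 0 in B ∖ Γ whose trace Tu is (equal σ-a.e. on Γ ∩ B to) a continuous bounded function on Γ ∩ B. Then for every 0 < s < r, osc_{B(x,s)} u ≤ C (s/r)^α osc_{B(x,r)} u + C osc_{Γ ∩ B(x,√(sr))} Tu, where osc_E u = ess sup_{E∖Γ} u − ess inf_{E∖Γ} u and the oscillation of Tu is taken over Γ ∩ B(x,√(sr)). In particular u has a continuous representative on B. If moreover Tu = 0 σ-a.e. on Γ ∩ B, then for every 0 < s < r/2, osc_{B(x,s)} u ≤ C (s/r)^α ( m(B)^{−1} ∫_B |u|² dm )^{1/2}. -/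

import Mathlib

open MeasureTheory Metric Set Filter
open scoped ENNReal NNReal Topology

noncomputable section

/-- Euclidean space `ℝⁿ`. -/
abbrev Euc (n : ℕ) := EuclideanSpace ℝ (Fin n)

/-- `Γ ⊆ ℝⁿ` is `d`-Ahlfors regular with constant `C₀`. -/
def AhlforsRegular (n : ℕ) (d C₀ : ℝ) (Γ : Set (Euc n)) : Prop :=
  ∀ x ∈ Γ, ∀ r : ℝ, 0 < r →
    ENNReal.ofReal (C₀⁻¹ * r ^ d) ≤ μH[d] (Γ ∩ ball x r) ∧
      μH[d] (Γ ∩ ball x r) ≤ ENNReal.ofReal (C₀ * r ^ d)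

/-- The weight `w(x) = dist(x, Γ) ^ (d + 1 - n)`. -/
def weightW (n : ℕ) (d : ℝ) (Γ : Set (Euc n)) (x : Euc n) : ℝ :=
  infDist x Γ ^ (d + 1 - (n : ℝ))

/-- The measure `m` with density `w` with respect to Lebesgue measure. -/
def measW (n : ℕ) (d : ℝ) (Γ : Set (Euc n)) : Measure (Euc n) :=
  volume.withDensity fun x => ENNReal.ofReal (weightW n d Γ x)

/-- `v` is a distributional gradient of `u` on the open set `E`: for every smooth
compactly supported test function `φ` with support in `E`, `∫_E u ∇φ = -∫_E φ v`. -/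
def IsDistribGradOn {n : ℕ} (u : Euc n → ℝ) (v : Euc n → Euc n) (E : Set (Euc n)) : Prop :=
  ∀ φ : Euc n → ℝ, ContDiff ℝ (⊤ : ℕ∞) φ → HasCompactSupport φ → tsupport φ ⊆ E →
    ∫ x in E, u x • gradient φ x = -∫ x in E, φ x • v x

/-- The averages of `u` over small balls centered at `x` converge to `t`. -/
def HasTraceAt {n : ℕ} (u : Euc n → ℝ) (x : Euc n) (t : ℝ) : Prop :=
  Tendsto (fun ρ : ℝ => ⨍ y in ball x ρ, u y) (𝓝[>] (0 : ℝ)) (𝓝 t)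

/-- `u` belongs to the weighted Sobolev space `W = Ẇ^{1,2}_w(Ω)`, `Ω = Γᶜ`, with
distributional gradient `v` on `Ω` lying in `L²(Ω, m)`. -/
structure MemW (n : ℕ) (d : ℝ) (Γ : Set (Euc n)) (u : Euc n → ℝ) (v : Euc n → Euc n) :
    Prop where
  locInt : LocallyIntegrableOn u Γᶜ volume
  gradLocInt : LocallyIntegrableOn v Γᶜ volume
  isGrad : IsDistribGradOn u v Γᶜ
  l2 : ∫⁻ x in Γᶜ, ENNReal.ofReal (‖v x‖ ^ 2) ∂(measW n d Γ) < ⊤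

/-- `u` belongs to the local space `W_r(E)`: `u ∈ L¹_loc(E)` and `φ u` (extended by `0`)
belongs to `W` for every smooth compactly supported `φ` with support in `E`. -/
def MemWrOn (n : ℕ) (d : ℝ) (Γ : Set (Euc n)) (E : Set (Euc n)) (u : Euc n → ℝ) : Prop :=
  LocallyIntegrableOn u E volume ∧
    ∀ φ : Euc n → ℝ, ContDiff ℝ (⊤ : ℕ∞) φ → HasCompactSupport φ → tsupport φ ⊆ E →
      ∃ vφ : Euc n → Euc n, MemW n d Γ (fun x => φ x * u x) vφ

/-- Degenerate ellipticity and boundedness conditions for the matrix `A`. -/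
def EllipticOn (n : ℕ) (d : ℝ) (Γ : Set (Euc n)) (A : Euc n → Euc n →L[ℝ] Euc n)
    (C₁ : ℝ) : Prop :=
  ∀ x, x ∉ Γ →
    (∀ ξ ζ : Euc n, |∑ i, A x ξ i * ζ i| ≤ C₁ * weightW n d Γ x * ‖ξ‖ * ‖ζ‖) ∧
      ∀ ξ : Euc n, C₁⁻¹ * weightW n d Γ x * ‖ξ‖ ^ 2 ≤ ∑ i, A x ξ i * ξ i

/-- `u`, with gradient `v`, is a weak subsolution of `- div A ∇u = 0` on `U ⊆ Ω = Γᶜ`. -/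
def SubsolOn {n : ℕ} (Γ : Set (Euc n)) (A : Euc n → Euc n →L[ℝ] Euc n)
    (v : Euc n → Euc n) (U : Set (Euc n)) : Prop :=
  ∀ φ : Euc n → ℝ, ContDiff ℝ (⊤ : ℕ∞) φ → HasCompactSupport φ → tsupport φ ⊆ U →
    (∀ x, 0 ≤ φ x) → ∫ x in Γᶜ, ∑ i, A x (v x) i * gradient φ x i ≤ 0

/-- `u`, with gradient `v`, is a weak supersolution of `- div A ∇u = 0` on `U ⊆ Ω = Γᶜ`. -/
def SupersolOn {n : ℕ} (Γ : Set (Euc n)) (A : Euc n → Euc n →L[ℝ] Euc n)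
    (v : Euc n → Euc n) (U : Set (Euc n)) : Prop :=
  ∀ φ : Euc n → ℝ, ContDiff ℝ (⊤ : ℕ∞) φ → HasCompactSupport φ → tsupport φ ⊆ U →
    (∀ x, 0 ≤ φ x) → 0 ≤ ∫ x in Γᶜ, ∑ i, A x (v x) i * gradient φ x i

/-- `u`, with gradient `v`, is a weak solution of `- div A ∇u = 0` on `U ⊆ Ω = Γᶜ`. -/
def SolOn {n : ℕ} (Γ : Set (Euc n)) (A : Euc n → Euc n →L[ℝ] Euc n)
    (v : Euc n → Euc n) (U : Set (Euc n)) : Prop :=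
  ∀ φ : Euc n → ℝ, ContDiff ℝ (⊤ : ℕ∞) φ → HasCompactSupport φ → tsupport φ ⊆ U →
    ∫ x in Γᶜ, ∑ i, A x (v x) i * gradient φ x i = 0

section
open ENNReal (ofReal ofReal_add ofReal_coe_nnreal ofReal_div_of_pos ofReal_eq_zero ofReal_inv_of_pos ofReal_le_ofReal ofReal_le_ofReal_iff ofReal_le_one ofReal_lt_one ofReal_lt_top ofReal_mul ofReal_mul' ofReal_ne_top ofReal_ofNat ofReal_one ofReal_pos ofReal_pow ofReal_rpow_of_nonneg ofReal_toReal ofReal_zero)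
local notation "pz" => (by positivity)
local notation "nz" => (by norm_num)
local notation "lz" => (by linarith)
local notation "nn(" x ")" => ‖x‖ₑ ^ 2
local notation "Sm" => ContDiff ℝ (⊤ : ℕ∞)


theorem sqn {α F : Type*} [MeasurableSpace α] [NormedAddCommGroup F] (μ : Measure α) (f : α → F) :
    eLpNorm f 2 μ ^ 2 = ∫⁻ x, nn(f x) ∂μ := by
  rw [eLpNorm_eq_lintegral_rpow_enorm_toReal nz nz, ← ENNReal.rpow_natCast,
    ← ENNReal.rpow_mul]
  norm_num

theorem sq_le_sq_enn {a b : ℝ≥0∞} (h : a ^ 2 ≤ b ^ 2) : a ≤ b :=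
  le_of_not_gt fun hc => absurd h (not_le.2 (ENNReal.pow_lt_pow_left two_ne_zero hc))

theorem cs_lint {α : Type*} [MeasurableSpace α] (μ : Measure α) {f g : α → ℝ≥0∞}
    (hf : AEMeasurable f μ) (hg : AEMeasurable g μ) :
    (∫⁻ x, f x * g x ∂μ) ^ 2 ≤ (∫⁻ x, f x ^ 2 ∂μ) * ∫⁻ x, g x ^ 2 ∂μ := by
  have h := ENNReal.lintegral_mul_le_Lp_mul_Lq μ (p := 2) (q := 2)
    (by constructor <;> norm_num) hf hg
  calc _ ≤ _ := pow_le_pow_left' h 2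
    _ = _ := by
      rw [mul_pow, ← ENNReal.rpow_natCast, ← ENNReal.rpow_natCast, ← ENNReal.rpow_mul,
        ← ENNReal.rpow_mul]
      norm_num

theorem sq_add_enn (a b : ℝ≥0∞) : (a + b) ^ 2 ≤ 2 * a ^ 2 + 2 * b ^ 2 := by
  have := ENNReal.rpow_add_le_mul_rpow_add_rpow a b (p := 2) nz
  norm_num at this
  simpa [mul_add] using this

theorem enorm_add_sq_le {F : Type*} [NormedAddCommGroup F] (a b : F) :
    nn(a + b) ≤ 2 * nn(a) + 2 * nn(b) :=
  (pow_le_pow_left' (enorm_add_le a b) 2).trans (sq_add_enn _ _)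

theorem enorm_sub_sq_le {F : Type*} [NormedAddCommGroup F] (a b : F) :
    nn(a - b) ≤ 2 * nn(a) + 2 * nn(b) := by
  simpa [sub_eq_add_neg] using enorm_add_sq_le a (-b)

theorem brezis {α F : Type*} [MeasurableSpace α] [NormedAddCommGroup F]
    (μ : Measure α) (f : ℕ → α → F) (g : α → F)
    (hf : ∀ j, AEStronglyMeasurable (f j) μ) (hg : AEStronglyMeasurable g μ)
    (hlim : ∀ᵐ x ∂μ, Tendsto (fun j => f j x) atTop (𝓝 (g x)))
    (hle : ∀ j, ∫⁻ x, nn(f j x) ∂μ ≤ ∫⁻ x, nn(g x) ∂μ)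
    (hfin : ∫⁻ x, nn(g x) ∂μ ≠ ⊤) :
    Tendsto (fun j => ∫⁻ x, nn(f j x - g x) ∂μ) atTop (𝓝 0) := by
  set N := ∫⁻ x, nn(g x) ∂μ with hN
  have m1 : ∀ j, AEMeasurable (fun x => nn(f j x)) μ := fun j => (hf j).enorm.pow_const 2
  have m2 : AEMeasurable (fun x => nn(g x)) μ := hg.enorm.pow_const 2
  have m3 : ∀ j, AEMeasurable (fun x => nn(f j x - g x)) μ :=
    fun j => ((hf j).sub hg).enorm.pow_const 2
  have hD : ∀ j, ∫⁻ x, nn(f j x - g x) ∂μ ≤ 4 * N := fun j => by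
    calc _ ≤ ∫⁻ x, (2 * nn(f j x) + 2 * nn(g x)) ∂μ :=
          lintegral_mono fun x => enorm_sub_sq_le _ _
      _ = 2 * ∫⁻ x, nn(f j x) ∂μ + 2 * N := by
          rw [lintegral_add_left' ((m1 j).const_mul 2), lintegral_const_mul'' _ (m1 j),
            lintegral_const_mul'' _ m2]
      _ ≤ 2 * N + 2 * N := by gcongr; exact hle j
      _ = 4 * N := by ring
  have h4 : 4 * N ≠ ⊤ := ENNReal.mul_ne_top nz hfin
  have key : 4 * N ≤ liminf (fun j => 4 * N - ∫⁻ x, nn(f j x - g x) ∂μ) atTop := by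
    calc 4 * N = ∫⁻ x, 4 * nn(g x) ∂μ := by rw [lintegral_const_mul'' _ m2]
      _ ≤ ∫⁻ x, liminf (fun j => (2 * nn(f j x) + 2 * nn(g x)) - nn(f j x - g x))
            atTop ∂μ := by
          apply lintegral_mono_ae
          filter_upwards [hlim] with x hx
          apply le_of_eq
          symm
          apply Tendsto.liminf_eq
          have a1 : Tendsto (fun j => nn(f j x)) atTop (𝓝 (nn(g x))) :=
            (ENNReal.continuous_pow 2).continuousAt.tendsto.comp hx.enorm
          have a2 : Tendsto (fun j => nn(f j x - g x)) atTop (𝓝 0) := by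
            have : Tendsto (fun j => f j x - g x) atTop (𝓝 0) := by
              simpa using hx.sub_const (g x)
            simpa [Function.comp_def] using
              (ENNReal.continuous_pow 2).continuousAt.tendsto.comp this.enorm
          have a3 : Tendsto (fun j => 2 * nn(f j x) + 2 * nn(g x)) atTop
              (𝓝 (2 * nn(g x) + 2 * nn(g x))) :=
            (ENNReal.Tendsto.const_mul a1 (Or.inr nz)).add tendsto_const_nhds
          have a4 := ENNReal.Tendsto.sub a3 a2 (Or.inr nz)
          convert a4 using 2
          rw [tsub_zero]; ring
      _ ≤ liminf (fun j => ∫⁻ x, ((2 * nn(f j x) + 2 * nn(g x)) - nn(f j x - g x)) ∂μ)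
            atTop := lintegral_liminf_le' fun j =>
              (((m1 j).const_mul 2).add (m2.const_mul 2)).sub (m3 j)
      _ ≤ _ := by
          refine liminf_le_liminf (Eventually.of_forall fun j => ?_)
          · change (∫⁻ x, ((2 * nn(f j x) + 2 * nn(g x)) - nn(f j x - g x)) ∂μ) ≤ _
            rw [lintegral_sub' (m3 j) ((hD j).trans_lt h4.lt_top).ne
              (Eventually.of_forall fun x => enorm_sub_sq_le _ _)]
            gcongr
            rw [lintegral_add_left' ((m1 j).const_mul 2), lintegral_const_mul'' _ (m1 j),
              lintegral_const_mul'' _ m2]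
            calc _ ≤ 2 * N + 2 * N := by gcongr; exact hle j
              _ = 4 * N := by ring
  rw [ENNReal.tendsto_atTop_zero]
  intro ε hε
  rcases le_or_gt (4 * N) ε with h | h
  · exact ⟨0, fun j _ => (hD j).trans h⟩
  · have hlt : 4 * N - ε < liminf (fun j => 4 * N - ∫⁻ x, nn(f j x - g x) ∂μ) atTop :=
      lt_of_lt_of_le (ENNReal.sub_lt_self h4 (by rintro h0; simp [h0] at h) hε.ne') key
    obtain ⟨J, hJ⟩ := eventually_atTop.1 (eventually_lt_of_lt_liminf hlt)
    refine ⟨J, fun j hj => ?_⟩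
    by_contra hc
    exact absurd (hJ j hj) (not_lt.2 (tsub_le_tsub_left (not_le.1 hc).le _))

open scoped Convolution

/-- A fixed sequence of mollifiers. -/
def bmp (n : ℕ) (j : ℕ) : ContDiffBump (0 : Euc n) :=
  ⟨1 / (2 * ((j : ℝ) + 1)), 1 / ((j : ℝ) + 1), by positivity, by
    apply one_div_lt_one_div_of_lt <;> nlinarith [(Nat.cast_nonneg j : (0:ℝ) ≤ j)]⟩

/-- Mollification. -/
def moll {n : ℕ} {F : Type*} [NormedAddCommGroup F] [NormedSpace ℝ F]
    (ρ : ContDiffBump (0 : Euc n)) (f : Euc n → F) : Euc n → F :=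
  (ρ.normed volume ⋆[ContinuousLinearMap.lsmul ℝ ℝ, volume] f)

theorem bmp_rOut (n : ℕ) : Tendsto (fun j => (bmp n j).rOut) atTop (𝓝 0) :=
  tendsto_one_div_add_atTop_nhds_zero_nat

theorem moll_ae {n : ℕ} {F : Type*} [NormedAddCommGroup F] [NormedSpace ℝ F] [CompleteSpace F]
    {f : Euc n → F} (hf : LocallyIntegrable f) :
    ∀ᵐ x, Tendsto (fun j => moll (bmp n j) f x) atTop (𝓝 (f x)) := by
  refine ContDiffBump.ae_convolution_tendsto_right_of_locallyIntegrable (K := 2) (bmp_rOut n)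
    (Eventually.of_forall fun j => ?_) hf
  simp only [bmp]
  have : (0:ℝ) < (j:ℝ) + 1 := by positivity
  field_simp; norm_num

theorem moll_smooth {n : ℕ} {F : Type*} [NormedAddCommGroup F] [NormedSpace ℝ F] [CompleteSpace F]
    (ρ : ContDiffBump (0 : Euc n))
    {f : Euc n → F} (hf : LocallyIntegrable f) : Sm (moll ρ f) :=
  ρ.hasCompactSupport_normed.contDiff_convolution_left _ ρ.contDiff_normed hf

theorem moll_young {n : ℕ} {F : Type*} [NormedAddCommGroup F] [NormedSpace ℝ F]
    (ρ : ContDiffBump (0 : Euc n)) {f : Euc n → F} (hf : AEStronglyMeasurable f volume) :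
    ∫⁻ x, nn(moll ρ f x) ≤ ∫⁻ x, nn(f x) := by
  set r : Euc n → ℝ≥0∞ := fun t => ‖ρ.normed volume t‖ₑ
  have hrm : Measurable r := ρ.continuous_normed.measurable.enorm
  have hr1 : ∫⁻ t, r t = 1 := by
    have h := ρ.integral_normed (μ := (volume : Measure (Euc n)))
    have h2 : ∫⁻ t, r t = ofReal (∫ t, ρ.normed volume t) := by
      rw [ofReal_integral_eq_lintegral_ofReal ρ.integrable_normed
        (Eventually.of_forall fun t => ρ.nonneg_normed t)]
      refine lintegral_congr fun t => ?_
      simp only [r]; rw [Real.enorm_eq_ofReal (ρ.nonneg_normed t)]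
    rw [h2, h]; simp
  have hfm : ∀ x, AEMeasurable (fun t => ‖f (x - t)‖ₑ) volume := fun x =>
    (hf.comp_quasiMeasurePreserving (quasiMeasurePreserving_sub_left volume x)).enorm
  have pt : ∀ x, nn(moll ρ f x) ≤ ∫⁻ t, r t * nn(f (x - t)) := fun x => by
    have h1 : ‖moll ρ f x‖ₑ ≤ ∫⁻ t, ‖f (x - t)‖ₑ ∂(volume.withDensity r) := by
      rw [lintegral_withDensity_eq_lintegral_mul₀ hrm.aemeasurable (hfm x)]
      refine (enorm_integral_le_lintegral_enorm _).trans (le_of_eq (lintegral_congr fun t => ?_))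
      simp [r, enorm_smul]
    have hfm' : AEMeasurable (fun t => ‖f (x - t)‖ₑ) (volume.withDensity r) :=
      (hfm x).mono_ac (withDensity_absolutelyContinuous _ _)
    calc _ ≤ (∫⁻ t, 1 * ‖f (x - t)‖ₑ ∂(volume.withDensity r)) ^ 2 := by
          simpa using pow_le_pow_left' h1 2
      _ ≤ _ := cs_lint _ aemeasurable_const hfm'
      _ = _ := by
          rw [lintegral_withDensity_eq_lintegral_mul₀ hrm.aemeasurable ((hfm x).pow_const 2)]
          simp [withDensity_apply, hr1]
  have hjm : AEMeasurable (fun p : Euc n × Euc n => r p.2 * nn(f (p.1 - p.2)))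
      (volume.prod volume) := by
    refine (hrm.comp measurable_snd).aemeasurable.mul ?_
    exact (hf.comp_quasiMeasurePreserving
      (quasiMeasurePreserving_sub_of_right_invariant volume volume)).enorm.pow_const 2
  calc _ ≤ ∫⁻ x, ∫⁻ t, r t * nn(f (x - t)) := lintegral_mono pt
    _ = ∫⁻ t, ∫⁻ x, r t * nn(f (x - t)) := lintegral_lintegral_swap hjm
    _ = ∫⁻ t, r t * ∫⁻ x, nn(f x) := by
        refine lintegral_congr fun t => ?_
        rw [lintegral_const_mul' _ _ (by simp [r]),
          lintegral_sub_right_eq_self (fun x => nn(f x)) t]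
    _ = _ := by rw [lintegral_mul_const _ hrm, hr1, one_mul]

theorem moll_L2 {n : ℕ} {F : Type*} [NormedAddCommGroup F] [NormedSpace ℝ F] [CompleteSpace F]
    {f : Euc n → F} (hf : MemLp f 2 volume) :
    Tendsto (fun j => eLpNorm (fun x => moll (bmp n j) f x - f x) 2 volume) atTop (𝓝 0) := by
  have hl : LocallyIntegrable f := hf.locallyIntegrable nz
  have h := brezis volume (fun j => moll (bmp n j) f) f
    (fun j => (moll_smooth _ hl).continuous.aestronglyMeasurable) hf.1 (moll_ae hl)
    (fun j => moll_young _ hf.1) (by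
      rw [← sqn]; exact ENNReal.pow_ne_top hf.2.ne)
  simp_rw [← sqn] at h
  have h2 := (ENNReal.continuous_rpow_const (y := (1/2 : ℝ))).continuousAt.tendsto.comp h
  simp only [Function.comp_def] at h2
  convert h2 using 2
  · rw [← ENNReal.rpow_natCast, ← ENNReal.rpow_mul]; norm_num
  · simp

/-- gradient of a mollification. -/
theorem moll_grad {n : ℕ} {U : Euc n → ℝ} {q : Euc n → Euc n} {O : Set (Euc n)}
    (hU : LocallyIntegrable U) (hg : IsDistribGradOn U q O)
    (ρ : ContDiffBump (0 : Euc n)) (x : Euc n) (hx : closedBall x ρ.rOut ⊆ O) :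
    gradient (moll ρ U) x = moll ρ q x := by
  set φ : Euc n → ℝ := fun t => ρ.normed volume (x - t) with hφ
  have hφs : Sm φ := ρ.contDiff_normed.comp (contDiff_const.sub contDiff_id)
  have hts : tsupport φ ⊆ closedBall x ρ.rOut := by
    apply closure_minimal _ isClosed_closedBall
    intro t ht
    have : x - t ∈ Function.support (ρ.normed volume) := ht
    rw [ρ.support_normed_eq, mem_ball_zero_iff] at this
    rw [mem_closedBall, dist_comm, dist_eq_norm]; exact this.le
  have hcs : HasCompactSupport φ :=
    HasCompactSupport.of_support_subset_isCompact (isCompact_closedBall x ρ.rOut)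
      ((subset_tsupport φ).trans hts)
  have hgφ : ∀ t, gradient φ t = - gradient (ρ.normed volume) (x - t) := fun t => by
    have h1 : HasFDerivAt (ρ.normed (volume : Measure (Euc n)))
      (fderiv ℝ (ρ.normed volume) (x - t)) (x - t) :=
      (ρ.contDiff_normed.differentiable (n := 1) one_ne_zero).differentiableAt.hasFDerivAt
    have h2 : HasFDerivAt φ (-(fderiv ℝ (ρ.normed (volume : Measure (Euc n))) (x - t))) t := by
      have := (h1.comp t ((hasFDerivAt_const x t).sub (hasFDerivAt_id t)))
      exact this.congr_fderiv (by ext; simp)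
    simp [gradient, h2.fderiv]
  have key := hg φ hφs hcs (hts.trans hx)
  have hd := (ρ.hasCompactSupport_normed (μ := volume)).hasFDerivAt_convolution_left
    (ContinuousLinearMap.lsmul ℝ ℝ) (ρ.contDiff_normed (μ := volume)) hU x
  have hL : ∫ t in O, U t • gradient φ t = ∫ t, U t • gradient φ t := by
    apply setIntegral_eq_integral_of_forall_compl_eq_zero
    intro t ht
    have h0 : t ∉ tsupport φ := fun h => ht (hx (hts h))
    have : gradient φ t = 0 := by
      simp only [gradient]
      rw [image_eq_zero_of_notMem_tsupport (fun h => h0 (tsupport_fderiv_subset ℝ h)), map_zero]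
    rw [this, smul_zero]
  have hR : ∫ t in O, φ t • q t = ∫ t, φ t • q t := by
    apply setIntegral_eq_integral_of_forall_compl_eq_zero
    intro t ht
    rw [image_eq_zero_of_notMem_tsupport (fun h => ht (hx (hts h))), zero_smul]
  rw [hL, hR] at key
  have e1 : moll ρ q x = ∫ t, φ t • q t := by
    simp only [moll, convolution_eq_swap, φ, ContinuousLinearMap.lsmul_apply]
  have e2 : gradient (moll ρ U) x = - ∫ t, U t • gradient φ t := by
    simp only [gradient, moll]
    rw [hd.fderiv, convolution_eq_swap]
    have : ∀ t, ((ContinuousLinearMap.lsmul ℝ ℝ).precompL (Euc n))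
        (fderiv ℝ (ρ.normed volume) (x - t)) (U t) =
        U t • fderiv ℝ (ρ.normed volume) (x - t) := fun t => by
      ext v; simp [ContinuousLinearMap.precompL_apply, mul_comm]
    simp_rw [this]
    rw [← integral_neg]
    have h3 := ((InnerProductSpace.toDual ℝ (Euc n)).symm.toContinuousLinearEquiv
      |>.toContinuousLinearMap).integral_comp_comm (μ := volume)
      (φ := fun t => U t • fderiv ℝ (ρ.normed volume) (x - t)) ?_
    · rw [← LinearIsometryEquiv.coe_toContinuousLinearEquiv]
      refine h3.symm.trans (integral_congr_ae (Eventually.of_forall fun t => ?_))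
      have := hgφ t
      simp only [gradient] at this
      simp [this]
    · have hc : Continuous (fun t => fderiv ℝ (ρ.normed (volume : Measure (Euc n))) (x - t)) :=
        (ρ.contDiff_normed.continuous_fderiv (n := 1) one_ne_zero).comp (by fun_prop)
      refine hU.integrable_smul_right_of_hasCompactSupport hc ?_
      refine HasCompactSupport.of_support_subset_isCompact (isCompact_closedBall x ρ.rOut) ?_
      intro t ht
      apply hts
      by_contra h0
      apply ht
      have h1 := hgφ t
      have : gradient φ t = 0 := by
        simp only [gradient]
        rw [image_eq_zero_of_notMem_tsupport (fun h => h0 (tsupport_fderiv_subset ℝ h)), map_zero]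
      rw [this] at h1
      simpa [gradient] using h1.symm
  rw [e1, e2, key, neg_neg]

theorem moll_lip {n : ℕ} (ρ : ContDiffBump (0 : Euc n)) {f : Euc n → ℝ} (hf : LipschitzWith 1 f) :
    LipschitzWith 1 (moll ρ f) := by
  have hi : ∀ x, Integrable (fun t => ρ.normed volume t • f (x - t)) := fun x => by
    have hc : Continuous (fun t => ρ.normed volume t • f (x - t)) :=
      ρ.continuous_normed.smul (hf.continuous.comp (by fun_prop))
    exact hc.integrable_of_hasCompactSupport (ρ.hasCompactSupport_normed.smul_right)
  refine LipschitzWith.of_dist_le_mul fun x y => ?_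
  rw [Real.dist_eq, NNReal.coe_one, one_mul]
  have e : ∀ x, moll ρ f x = ∫ t, ρ.normed volume t • f (x - t) := fun x => rfl
  rw [e, e, ← integral_sub (hi x) (hi y), ← Real.norm_eq_abs]
  calc _ ≤ ∫ t, ρ.normed volume t * dist x y := by
        refine norm_integral_le_of_norm_le (ρ.integrable_normed.mul_const _)
          (Eventually.of_forall fun t => ?_)
        rw [← smul_sub, norm_smul, Real.norm_of_nonneg (ρ.nonneg_normed t)]
        refine mul_le_mul_of_nonneg_left ?_ (ρ.nonneg_normed t)
        have := hf.dist_le_mul (x - t) (y - t)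
        simpa [Real.dist_eq] using this
    _ = _ := by rw [integral_mul_const, ρ.integral_normed, one_mul]

/-- regularised distance -/
theorem regdist {n : ℕ} (K : Set (Euc n)) {ρ : ℝ} (hρ : 0 < ρ) : ∃ D : Euc n → ℝ,
    Sm D ∧ ∀ x, |D x - infDist x K| ≤ ρ ∧ ‖fderiv ℝ D x‖ ≤ 1 := by
  let b : ContDiffBump (0 : Euc n) := ⟨ρ / 2, ρ, by positivity, by linarith⟩
  have hl : LipschitzWith 1 (fun x => infDist x K) := lipschitz_infDist_pt K
  refine ⟨moll b fun x => infDist x K, moll_smooth _ hl.continuous.locallyIntegrable,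
    fun x => ⟨?_, by simpa using norm_fderiv_le_of_lipschitz ℝ (moll_lip b hl)⟩⟩
  rw [← Real.dist_eq]
  refine b.dist_normed_convolution_le hl.continuous.aestronglyMeasurable fun y hy => ?_
  have := hl.dist_le_mul y x
  simp only [NNReal.coe_one, one_mul] at this
  exact this.trans (le_of_lt hy)

theorem ngr {n : ℕ} (f : Euc n → ℝ) (x : Euc n) : ‖gradient f x‖ = ‖fderiv ℝ f x‖ := by
  simp [gradient]

theorem ngr' {n : ℕ} (f : Euc n → ℝ) (x : Euc n) : ‖gradient f x‖ₑ = ‖fderiv ℝ f x‖ₑ := by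
  rw [← ofReal_norm, ngr, ofReal_norm]

theorem st_deriv : ∃ L : ℝ, 1 ≤ L ∧ ∀ t, ‖deriv Real.smoothTransition t‖ ≤ L := by
  have hc : Continuous (deriv Real.smoothTransition) :=
    (Real.smoothTransition.contDiff (n := 1)).continuous_deriv le_rfl
  obtain ⟨L, hL⟩ := isCompact_Icc.exists_bound_of_continuousOn (s := Icc (0:ℝ) 1) hc.continuousOn
  refine ⟨max L 1, le_max_right _ _, fun t => ?_⟩
  by_cases ht : t ∈ Icc (0:ℝ) 1
  · exact (hL t ht).trans (le_max_left _ _)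
  · have : deriv Real.smoothTransition t = 0 := by
      rw [mem_Icc, not_and_or, not_le, not_le] at ht
      rcases ht with ht | ht
      · rw [EventuallyEq.deriv_eq (f := fun _ => (0:ℝ)) ?_, deriv_const]
        filter_upwards [Iio_mem_nhds ht] with s hs
        exact Real.smoothTransition.zero_of_nonpos (le_of_lt hs)
      · rw [EventuallyEq.deriv_eq (f := fun _ => (1:ℝ)) ?_, deriv_const]
        filter_upwards [Ioi_mem_nhds ht] with s hs
        exact Real.smoothTransition.one_of_one_le (le_of_lt hs)
    rw [this]; simp

/-- bound for the derivative of the smooth transition -/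
def LS : ℝ := st_deriv.choose
theorem LS1 : 1 ≤ LS := st_deriv.choose_spec.1
theorem LSd (t : ℝ) : ‖deriv Real.smoothTransition t‖ ≤ LS := st_deriv.choose_spec.2 t

/-- cutoff: `0` where `dist ≤ a`, `1` where `dist ≥ b`. -/
theorem cutoff {n : ℕ} (K : Set (Euc n)) {a b : ℝ} (hab : a < b) : ∃ χ : Euc n → ℝ,
    Sm χ ∧ (∀ x, 0 ≤ χ x ∧ χ x ≤ 1) ∧ (∀ x, infDist x K ≤ a → χ x = 0) ∧
    (∀ x, b ≤ infDist x K → χ x = 1) ∧ ∀ x, ‖gradient χ x‖ ≤ 3 * LS / (b - a) := by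
  obtain ⟨D, hD, hD2⟩ := regdist K (ρ := (b - a) / 3) lz
  set h := (b - a) / 3 with hh
  have hp : 0 < h := by simp only [hh]; linarith
  have hin : Sm (fun x => (D x - (a + h)) / h) :=
    (hD.sub contDiff_const).div_const _
  refine ⟨fun x => Real.smoothTransition ((D x - (a + h)) / h),
    Real.smoothTransition.contDiff.comp hin, fun x => ⟨Real.smoothTransition.nonneg _,
      Real.smoothTransition.le_one _⟩, fun x hx => ?_, fun x hx => ?_, fun x => ?_⟩
  · apply Real.smoothTransition.zero_of_nonpos
    have := abs_le.1 (hD2 x).1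
    exact div_nonpos_of_nonpos_of_nonneg lz hp.le
  · apply Real.smoothTransition.one_of_one_le
    have := abs_le.1 (hD2 x).1
    rw [le_div_iff₀ hp]
    linarith [show b = a + 3 * h by simp only [hh]; ring]
  · rw [ngr]
    have h1 : HasFDerivAt (fun x => (D x - (a + h)) / h) (h⁻¹ • fderiv ℝ D x) x := by
      have := ((hD.differentiable (by simp)).differentiableAt.hasFDerivAt (x := x)).sub_const (a + h)
      simpa [div_eq_inv_mul] using this.const_mul h⁻¹
    have h2 := ((Real.smoothTransition.contDiff (n := 1)).differentiable one_ne_zero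
      ((D x - (a + h)) / h)).hasDerivAt.comp_hasFDerivAt x h1
    have h3 := h2.fderiv
    simp only [Function.comp_def] at h3
    rw [h3, norm_smul, norm_smul]
    calc _ ≤ LS * (‖h⁻¹‖ * 1) := by
          gcongr
          · linarith [LS1]
          · exact LSd _
          · exact (hD2 x).2
      _ = _ := by
          rw [Real.norm_of_nonneg pz, show b - a = 3 * h by simp only [hh]; ring]
          field_simp

theorem lint_aff {n : ℕ} (c : Euc n) {t : ℝ} (ht : 0 < t) (G : Euc n → ℝ≥0∞) (hG : Measurable G) :
    ∫⁻ y, G (c + t • y) = ofReal (t ^ n)⁻¹ * ∫⁻ y, G y := by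
  have h1 : ∫⁻ y, G (c + t • y) = ∫⁻ y, G (c + y) ∂(Measure.map (t • ·) volume) := by
    exact (lintegral_map (hG.comp (measurable_const_add c)) (measurable_const_smul t)).symm
  rw [h1, Measure.map_addHaar_smul _ ht.ne', lintegral_smul_measure, lintegral_add_left_eq_self]
  simp [abs_of_pos ht]

theorem poinc_pt {n : ℕ} {f : Euc n → ℝ} (hf : ContDiff ℝ 1 f) (y y' : Euc n) {R : ℝ}
    (hR : dist y y' ≤ 2 * R) :
    nn(f y' - f (y + (1/2:ℝ) • (y' - y))) ≤
      ofReal (2 * R ^ 2) * ∫⁻ t in Ioc (1/2:ℝ) 1, nn(fderiv ℝ f (y + t • (y' - y))) := by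
  have hd : ∀ t : ℝ, HasDerivAt (fun t : ℝ => f (y + t • (y' - y)))
      (fderiv ℝ f (y + t • (y' - y)) (y' - y)) t := fun t => by
    have h1 : HasDerivAt (fun t : ℝ => y + t • (y' - y)) (y' - y) t := by
      simpa using ((hasDerivAt_id t).smul_const (y' - y)).const_add y
    exact ((hf.differentiable one_ne_zero).differentiableAt.hasFDerivAt).comp_hasDerivAt t h1
  have hcf : Continuous fun t : ℝ => fderiv ℝ f (y + t • (y' - y)) :=
    (hf.continuous_fderiv one_ne_zero).comp (by fun_prop)
  have hc : Continuous fun t : ℝ => fderiv ℝ f (y + t • (y' - y)) (y' - y) :=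
    hcf.clm_apply continuous_const
  have h1 := intervalIntegral.integral_eq_sub_of_hasDerivAt (a := 1/2) (b := 1)
    (fun t _ => hd t) (hc.intervalIntegrable _ _)
  rw [intervalIntegral.integral_of_le nz] at h1
  simp only [one_smul, add_sub_cancel] at h1
  rw [← h1]
  set I := ∫⁻ t in Ioc (1/2:ℝ) 1, nn(fderiv ℝ f (y + t • (y' - y)))
  have h2 : ‖∫ t in Ioc (1/2:ℝ) 1, fderiv ℝ f (y + t • (y' - y)) (y' - y)‖ₑ ≤
      ∫⁻ t in Ioc (1/2:ℝ) 1, ofReal (2 * R) * ‖fderiv ℝ f (y + t • (y' - y))‖ₑ := by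
    refine (enorm_integral_le_lintegral_enorm _).trans (lintegral_mono fun t => ?_)
    rw [mul_comm]
    refine (ContinuousLinearMap.le_opENorm _ _).trans ?_
    gcongr
    rw [← ofReal_norm, ← dist_eq_norm, dist_comm]
    exact ofReal_le_ofReal hR
  refine (pow_le_pow_left' h2 2).trans ((cs_lint _ aemeasurable_const
    hcf.enorm.measurable.aemeasurable).trans ?_)
  simp only [lintegral_const, Measure.restrict_apply MeasurableSet.univ, univ_inter, Real.volume_Ioc]
  gcongr
  rw [← ofReal_pow (by linarith [dist_nonneg (x := y) (y := y')]),
    ← ofReal_mul pz]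
  apply ofReal_le_ofReal
  nlinarith

theorem poinc_smooth {n : ℕ} {f : Euc n → ℝ} (hf : ContDiff ℝ 1 f) (z : Euc n) {R : ℝ}
    (hR : 0 < R) :
    ∫⁻ y in ball z R, ∫⁻ y' in ball z R, nn(f y - f y') ≤
      ofReal (2 ^ (n + 3) * R ^ 2) * volume (ball z R) *
        ∫⁻ y in ball z R, nn(gradient f y) := by
  simp_rw [ngr']
  set B := ball z R
  set G : Euc n → ℝ≥0∞ := fun y => nn(fderiv ℝ f y)
  have hGc : Continuous G := by
    have := (hf.continuous_fderiv one_ne_zero).enorm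
    exact (ENNReal.continuous_pow 2).comp this
  set mid : Euc n → Euc n → Euc n := fun y y' => y + (1/2:ℝ) • (y' - y)
  have hmid : ∀ y y', mid y' y = mid y y' := fun y y' => by
    simp only [mid]; module
  have key : ∫⁻ y in B, ∫⁻ y' in B, nn(f y' - f (mid y y')) ≤
      ofReal (2 * R ^ 2) * (ofReal (2 ^ n) * (∫⁻ y in B, G y) * volume B) := by
    calc _ ≤ ∫⁻ y in B, ofReal (2 * R ^ 2) * (ofReal (2 ^ n) * ∫⁻ y in B, G y) := by
          refine setLIntegral_mono' measurableSet_ball fun y hy => ?_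
          calc _ ≤ ∫⁻ y' in B, ofReal (2 * R ^ 2) *
                ∫⁻ t in Ioc (1/2:ℝ) 1, G (y + t • (y' - y)) := by
                refine setLIntegral_mono' measurableSet_ball fun y' hy' => poinc_pt hf y y' ?_
                have := dist_triangle_right y y' z
                simp only [B, mem_ball] at hy hy'; linarith
            _ = ofReal (2 * R ^ 2) * ∫⁻ t in Ioc (1/2:ℝ) 1,
                ∫⁻ y' in B, G (y + t • (y' - y)) := by
                rw [lintegral_const_mul' _ _ ofReal_ne_top, lintegral_lintegral_swap]
                exact (hGc.comp (by fun_prop)).measurable.aemeasurable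
            _ ≤ ofReal (2 * R ^ 2) * ∫⁻ t in Ioc (1/2:ℝ) 1,
                (ofReal (2 ^ n) * ∫⁻ y in B, G y) := by
                gcongr ofReal (2 * R ^ 2) * ?_
                refine setLIntegral_mono' measurableSet_Ioc fun t ht => ?_
                have ht0 : 0 < t := by linarith [ht.1]
                calc _ ≤ ∫⁻ y', B.indicator G ((y - t • y) + t • y') := by
                      rw [← lintegral_indicator measurableSet_ball]
                      refine lintegral_mono fun y' => ?_
                      by_cases h : y' ∈ B
                      · have e : (y - t • y) + t • y' = y + t • (y' - y) := by module
                        have hm : y + t • (y' - y) ∈ B := by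
                          have := (convex_ball z R) hy h (a := 1 - t) (b := t) (by linarith [ht.2])
                            ht0.le (by ring)
                          convert this using 1; module
                        rw [e, indicator_of_mem h, indicator_of_mem hm]
                      · rw [indicator_of_notMem h]; exact zero_le
                  _ = _ := lint_aff _ ht0 _ (hGc.measurable.indicator measurableSet_ball)
                  _ ≤ _ := by
                      rw [lintegral_indicator measurableSet_ball]
                      gcongr
                      rw [inv_le_comm₀ pz pz, ← inv_pow]
                      gcongr; linarith [ht.1]
            _ ≤ _ := by
                gcongr ofReal (2 * R ^ 2) * ?_
                rw [lintegral_const, Measure.restrict_apply MeasurableSet.univ, univ_inter,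
                  Real.volume_Ioc]
                refine mul_le_of_le_one_right zero_le ?_
                rw [ofReal_le_one]; norm_num
      _ = _ := by
          rw [lintegral_const, Measure.restrict_apply MeasurableSet.univ, univ_inter]; ring
  have hfm : Continuous fun p : Euc n × Euc n => nn(f p.2 - f (mid p.1 p.2)) := by
    have hfc := hf.continuous
    have : Continuous fun p : Euc n × Euc n => mid p.1 p.2 := by simp only [mid]; fun_prop
    exact (ENNReal.continuous_pow 2).comp
      (((hfc.comp continuous_snd).sub (hfc.comp this)).enorm)
  calc _ ≤ ∫⁻ y in B, ∫⁻ y' in B, (2 * nn(f y - f (mid y' y)) +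
        2 * nn(f y' - f (mid y y'))) := by
        refine lintegral_mono fun y => lintegral_mono fun y' => ?_
        have := enorm_sub_sq_le (f y - f (mid y' y)) (f y' - f (mid y y'))
        rw [hmid y y', sub_sub_sub_cancel_right] at this; rwa [hmid y y']
    _ = 2 * (∫⁻ y in B, ∫⁻ y' in B, nn(f y - f (mid y' y))) +
        2 * ∫⁻ y in B, ∫⁻ y' in B, nn(f y' - f (mid y y')) := by
        have m2 : ∀ y, Measurable fun y' => nn(f y' - f (mid y y')) := fun y =>
          (hfm.comp (Continuous.prodMk_right y)).measurable
        have m1 : ∀ y, Measurable fun y' => nn(f y - f (mid y' y)) := fun y =>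
          (hfm.comp (Continuous.prodMk_left y)).measurable
        have m3 : Measurable fun y => ∫⁻ y' in B, nn(f y - f (mid y' y)) :=
          (hfm.comp continuous_swap).measurable.lintegral_prod_right'
        simp_rw [lintegral_add_left ((m1 _).const_mul 2), lintegral_const_mul 2 (m1 _),
          lintegral_const_mul 2 (m2 _)]
        rw [lintegral_add_left (m3.const_mul 2), lintegral_const_mul 2 m3, lintegral_const_mul]
        exact hfm.measurable.lintegral_prod_right'
    _ = 4 * ∫⁻ y in B, ∫⁻ y' in B, nn(f y' - f (mid y y')) := by
        rw [lintegral_lintegral_swap (f := fun y y' => nn(f y - f (mid y' y)))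
          (hfm.comp continuous_swap).measurable.aemeasurable]; ring
    _ ≤ _ := by
        refine (mul_le_mul_right key 4).trans (le_of_eq ?_)
        rw [show (4:ℝ≥0∞) = ofReal 4 by norm_num,
          show (2:ℝ) ^ (n+3) * R ^ 2 = 4 * (2 * R ^ 2) * 2 ^ n by ring,
          ofReal_mul (p := 4 * (2 * R ^ 2)) pz,
          ofReal_mul (p := 4) pz]; ring

theorem moll_sq_tendsto {n : ℕ} {q : Euc n → Euc n} (hq : MemLp q 2 volume) (B : Set (Euc n)) :
    Tendsto (fun j => ∫⁻ y in B, nn(moll (bmp n j) q y)) atTop (𝓝 (∫⁻ y in B, nn(q y))) := by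
  simp_rw [← sqn]
  refine (ENNReal.continuous_pow 2).continuousAt.tendsto.comp ?_
  have hl : LocallyIntegrable q := hq.locallyIntegrable nz
  have m1 : ∀ j, AEStronglyMeasurable (moll (bmp n j) q) (volume.restrict B) := fun j =>
    (moll_smooth _ hl).continuous.aestronglyMeasurable
  have h0 : Tendsto (fun j => eLpNorm (fun x => moll (bmp n j) q x - q x) 2 (volume.restrict B))
      atTop (𝓝 0) := tendsto_of_tendsto_of_tendsto_of_le_of_le tendsto_const_nhds (moll_L2 hq)
        (fun _ => zero_le) (fun j => eLpNorm_mono_measure _ Measure.restrict_le_self)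
  have hf : eLpNorm q 2 (volume.restrict B) ≠ ⊤ := (hq.restrict B).2.ne
  refine tendsto_of_tendsto_of_tendsto_of_le_of_le
    (g := fun j => eLpNorm q 2 (volume.restrict B) -
      eLpNorm (fun x => moll (bmp n j) q x - q x) 2 (volume.restrict B))
    (h := fun j => eLpNorm q 2 (volume.restrict B) +
      eLpNorm (fun x => moll (bmp n j) q x - q x) 2 (volume.restrict B)) ?_ ?_ ?_ ?_
  · simpa using ENNReal.Tendsto.sub (tendsto_const_nhds (x := eLpNorm q 2 (volume.restrict B))) h0
      (Or.inl hf)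
  · simpa using h0.const_add (eLpNorm q 2 (volume.restrict B))
  · intro j
    rw [tsub_le_iff_right]
    have := eLpNorm_sub_le (m1 j) ((m1 j).sub hq.1.restrict) (p := 2) nz
    simpa [Pi.sub_def] using this
  · intro j
    have := eLpNorm_add_le hq.1.restrict ((m1 j).sub hq.1.restrict) (p := 2) nz
    rw [add_sub_cancel] at this
    exact this

theorem poinc {n : ℕ} {U : Euc n → ℝ} {q : Euc n → Euc n} (hU : LocallyIntegrable U)
    (hq : MemLp q 2 volume) (hg : IsDistribGradOn U q univ) (z : Euc n) {R : ℝ} (hR : 0 < R) :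
    ∫⁻ y in ball z R, ∫⁻ y' in ball z R, nn(U y - U y') ≤
      ofReal (2 ^ (n + 3) * R ^ 2) * volume (ball z R) *
        ∫⁻ y in ball z R, nn(q y) := by
  set B := ball z R
  set f := fun j => moll (bmp n j) U
  have hf : ∀ j, Sm (f j) := fun j => moll_smooth _ hU
  have hc : ∀ j, Continuous fun p : Euc n × Euc n => nn(f j p.1 - f j p.2) := fun j =>
    (ENNReal.continuous_pow 2).comp
      ((((hf j).continuous.comp continuous_fst).sub ((hf j).continuous.comp continuous_snd)).enorm)
  have hlim : ∀ᵐ y ∂(volume.restrict B), Tendsto (fun j => f j y) atTop (𝓝 (U y)) :=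
    ae_restrict_of_ae (moll_ae hU)
  have h1 : ∀ j, ∫⁻ y in B, ∫⁻ y' in B, nn(f j y - f j y') ≤
      ofReal (2 ^ (n + 3) * R ^ 2) * volume B * ∫⁻ y in B, nn(moll (bmp n j) q y) :=
    fun j => by
      refine (poinc_smooth ((hf j).of_le (by simp)) z hR).trans (le_of_eq ?_)
      congr 1
      refine lintegral_congr fun y => ?_
      rw [moll_grad hU hg _ y (subset_univ _)]
  calc _ = ∫⁻ y in B, ∫⁻ y' in B, liminf (fun j => nn(f j y - f j y')) atTop := by
        refine lintegral_congr_ae ?_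
        filter_upwards [hlim] with y hy
        refine lintegral_congr_ae ?_
        filter_upwards [hlim] with y' hy'
        refine (Tendsto.liminf_eq ?_).symm
        exact (ENNReal.continuous_pow 2).continuousAt.tendsto.comp (hy.sub hy').enorm
    _ ≤ ∫⁻ y in B, liminf (fun j => ∫⁻ y' in B, nn(f j y - f j y')) atTop :=
        lintegral_mono fun y => lintegral_liminf_le fun j =>
          ((hc j).comp (Continuous.prodMk_right y)).measurable
    _ ≤ liminf (fun j => ∫⁻ y in B, ∫⁻ y' in B, nn(f j y - f j y')) atTop :=
        lintegral_liminf_le fun j => (hc j).measurable.lintegral_prod_right'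
    _ ≤ liminf (fun j => ofReal (2 ^ (n + 3) * R ^ 2) * volume B *
          ∫⁻ y in B, nn(moll (bmp n j) q y)) atTop :=
        liminf_le_liminf (Eventually.of_forall h1)
    _ = _ := by
        refine Tendsto.liminf_eq (ENNReal.Tendsto.const_mul (moll_sq_tendsto hq B) (Or.inr ?_))
        exact ENNReal.mul_ne_top ofReal_ne_top measure_ball_lt_top.ne

/-- standing assumptions -/
structure Geo (n : ℕ) (d Ca : ℝ) (Γ : Set (Euc n)) : Prop where
  hn : 2 ≤ n
  hd : 0 < d
  hdn : d < (n : ℝ) - 1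
  hC : 1 ≤ Ca
  ne : Γ.Nonempty
  cl : IsClosed Γ
  ar : AhlforsRegular n d Ca Γ

/-- local surface measure -/
def sg (d : ℝ) {n : ℕ} (Γ : Set (Euc n)) (x : Euc n) (R : ℝ) : Measure (Euc n) :=
  μH[d].restrict (Γ ∩ ball x R)

theorem layer_aux {α : Type*} [MeasurableSpace α] (ν : Measure α) (g : α → ℝ≥0∞) (S : Set α)
    (A : ℕ → Set α) (c e : ℕ → ℝ≥0∞) (K θ : ℝ≥0∞) (hS : S ⊆ ⋃ j, A j)
    (h1 : ∀ j, ∀ x ∈ A j, g x ≤ c j) (h2 : ∀ j, ν (A j) ≤ e j) (h3 : ∀ j, c j * e j ≤ K * θ ^ j)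
    (hm : ∀ j, MeasurableSet (A j)) :
    ∫⁻ x in S, g x ∂ν ≤ K * (1 - θ)⁻¹ := by
  calc _ ≤ ∫⁻ x in ⋃ j, A j, g x ∂ν := lintegral_mono_set hS
    _ ≤ ∑' j, ∫⁻ x in A j, g x ∂ν := lintegral_iUnion_le _ _
    _ ≤ ∑' j, K * θ ^ j := by
        refine ENNReal.tsum_le_tsum fun j => ?_
        calc _ ≤ ∫⁻ x in A j, c j ∂ν := setLIntegral_mono' (hm j) (h1 j)
          _ = c j * ν (A j) := by simp
          _ ≤ c j * e j := by gcongr; exact h2 j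
          _ ≤ _ := h3 j
    _ = _ := by rw [ENNReal.tsum_mul_left, ENNReal.tsum_geometric]

theorem layer_lo (a b : ℝ) (hb : 0 ≤ b) (hab : b < a) : ∃ C : ℝ≥0, ∀ {α : Type} [MeasurableSpace α]
    (ν : Measure α) (f : α → ℝ) (_ : Measurable f) (E : ℝ≥0∞) (ρ : ℝ), 0 < ρ →
    (∀ t, 0 < t → t ≤ ρ → ν {x | f x < t} ≤ E * ofReal (t ^ a)) →
    ∫⁻ x in {x | 0 < f x ∧ f x < ρ}, ofReal (f x ^ (-b)) ∂ν ≤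
      C * E * ofReal (ρ ^ (a - b)) := by
  have hθ : ofReal (2 ^ (b - a)) < 1 := by
    rw [ofReal_lt_one]; exact Real.rpow_lt_one_of_one_lt_of_neg nz lz
  refine ⟨(ofReal (2 ^ b) * (1 - ofReal (2 ^ (b - a)))⁻¹).toNNReal, ?_⟩
  intro α _ ν f hf E ρ hρ h
  rw [ENNReal.coe_toNNReal (ENNReal.mul_ne_top ofReal_ne_top
    (ENNReal.inv_ne_top.2 (tsub_pos_of_lt hθ).ne'))]
  have h2 : ∀ j : ℕ, (0:ℝ) < 2 ^ (-(j:ℝ)) := fun j => by positivity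
  have hm : ∀ t, MeasurableSet {x | f x < t} := fun t => hf measurableSet_Iio
  refine (layer_aux ν _ _ (fun j : ℕ => {x | ρ * 2 ^ (-(j:ℝ) - 1) ≤ f x} ∩ {x | f x < ρ * 2 ^ (-(j:ℝ))})
    (fun j => ofReal ((ρ * 2 ^ (-(j:ℝ) - 1)) ^ (-b)))
    (fun j => E * ofReal ((ρ * 2 ^ (-(j:ℝ))) ^ a))
    (ofReal (2 ^ b) * E * ofReal (ρ ^ (a - b))) (ofReal (2 ^ (b - a)))
    ?_ ?_ ?_ ?_ ?_).trans (le_of_eq (by ring))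
  · rintro x ⟨h0, h1⟩
    have hex : ∃ k : ℕ, ρ * 2 ^ (-(k:ℝ)) ≤ f x := by
      obtain ⟨k, hk⟩ := exists_pow_lt_of_lt_one (show 0 < f x / ρ by positivity)
        (show (1/2:ℝ) < 1 by norm_num)
      refine ⟨k, ?_⟩
      rw [lt_div_iff₀ hρ, one_div, inv_pow] at hk
      rw [Real.rpow_neg nz, Real.rpow_natCast]
      linarith
    classical
    obtain ⟨j, hj⟩ : ∃ j, Nat.find hex = j + 1 := Nat.exists_eq_succ_of_ne_zero fun h0 => by
      have := Nat.find_spec hex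
      rw [h0] at this; simp at this; linarith
    refine mem_iUnion.2 ⟨j, ?_, ?_⟩
    · have := Nat.find_spec hex
      rw [hj] at this; push_cast at this
      simpa [neg_add, sub_eq_add_neg, add_comm] using this
    · exact not_le.1 (Nat.find_min hex (m := j) (by omega))
  · intro j x hx
    apply ofReal_le_ofReal
    exact Real.rpow_le_rpow_of_nonpos pz hx.1 lz
  · intro j
    refine (measure_mono inter_subset_right).trans (h _ pz ?_)
    refine mul_le_of_le_one_right hρ.le ?_
    exact Real.rpow_le_one_of_one_le_of_nonpos nz (by simp)
  · intro j
    rw [mul_left_comm, ← ofReal_mul pz, ← ofReal_pow pz,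
      mul_comm _ E, mul_assoc, mul_assoc, ← ofReal_mul pz,
      ← ofReal_mul pz]
    refine le_of_eq ?_
    congr 2
    rw [Real.mul_rpow hρ.le pz, Real.mul_rpow hρ.le pz, ← Real.rpow_mul
      nz, ← Real.rpow_mul nz, ← Real.rpow_natCast, ← Real.rpow_mul nz]
    rw [mul_mul_mul_comm, ← Real.rpow_add hρ, ← Real.rpow_add nz, mul_left_comm,
      ← Real.rpow_add nz]
    congr 2 <;> ring
  · intro j
    exact (measurableSet_le measurable_const hf).inter (hm _)

section geo
variable {n : ℕ} {d Ca : ℝ} {Γ : Set (Euc n)}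

theorem Geo.up (g : Geo n d Ca Γ) (y : Euc n) {ρ : ℝ} (hρ : 0 < ρ) :
    μH[d] (Γ ∩ ball y ρ) ≤ ofReal (Ca * (2 * ρ) ^ d) := by
  rcases (Γ ∩ ball y ρ).eq_empty_or_nonempty with h | ⟨z, hz, hzy⟩
  · rw [h, measure_empty]; exact zero_le
  · refine (measure_mono ?_).trans (g.ar z hz (2 * ρ) pz).2
    refine inter_subset_inter_right _ (ball_subset_ball' ?_)
    rw [dist_comm]; linarith [mem_ball.1 hzy]

theorem Geo.lo (g : Geo n d Ca Γ) (y : Euc n) {ε : ℝ} (hy : infDist y Γ < ε) :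
    ofReal (Ca⁻¹ * ε ^ d) ≤ μH[d] (Γ ∩ ball y (2 * ε)) := by
  obtain ⟨z, hz, hzy⟩ := (infDist_lt_iff g.ne).1 hy
  refine (g.ar z hz ε (infDist_nonneg.trans_lt hy)).1.trans (measure_mono ?_)
  refine inter_subset_inter_right _ (ball_subset_ball' ?_)
  rw [dist_comm]; linarith

theorem Geo.sgf (g : Geo n d Ca Γ) (x : Euc n) (R : ℝ) : IsFiniteMeasure (sg d Γ x R) := by
  refine ⟨?_⟩
  rw [sg, Measure.restrict_apply MeasurableSet.univ, univ_inter]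
  rcases le_or_gt R 0 with h | h
  · simp [ball_eq_empty.2 h]
  · exact (g.up x h).trans_lt ofReal_lt_top

theorem sg_apply_ball (x y : Euc n) (R ρ : ℝ) :
    sg d Γ x R (ball y ρ) = μH[d] (Γ ∩ ball x R ∩ ball y ρ) := by
  rw [sg, Measure.restrict_apply measurableSet_ball, inter_comm]

theorem ton (ν : Measure (Euc n)) [SFinite ν] (ρ : ℝ) {G : Euc n → ℝ≥0∞} (hG : AEMeasurable G) :
    ∫⁻ z, (∫⁻ y in ball z ρ, G y) ∂ν = ∫⁻ y, ν (ball y ρ) * G y := by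
  have e : ∀ z y, (ball z ρ).indicator G y = (ball y ρ).indicator (fun _ => G y) z := fun z y => by
    simp [indicator, dist_comm]
  have hm : AEMeasurable (Function.uncurry fun z y => (ball z ρ).indicator G y)
      (ν.prod volume) := by
    have : (Function.uncurry fun z y => (ball z ρ).indicator G y) =
      {p : Euc n × Euc n | dist p.2 p.1 < ρ}.indicator fun p => G p.2 := by
      ext p; simp [indicator, Function.uncurry]
    rw [this]
    exact (hG.comp_snd).indicator (measurableSet_lt (by fun_prop) measurable_const)
  calc _ = ∫⁻ z, (∫⁻ y, (ball z ρ).indicator G y) ∂ν := by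
        refine lintegral_congr fun z => (lintegral_indicator measurableSet_ball _).symm
    _ = ∫⁻ y, ∫⁻ z, (ball z ρ).indicator G y ∂ν := lintegral_lintegral_swap hm
    _ = _ := by
        refine lintegral_congr fun y => ?_
        simp_rw [e]
        rw [lintegral_indicator measurableSet_ball]; simp [mul_comm]

/-- from boundary layers to surface integrals -/
theorem Geo.T1 (g : Geo n d Ca Γ) (x : Euc n) {ε R : ℝ} {Y : Set (Euc n)}
    (hY : Y ⊆ {y | infDist y Γ < ε} ∩ ball x R) {G : Euc n → ℝ≥0∞} (hm : MeasurableSet Y)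
    (hG : AEMeasurable G) :
    ofReal (Ca⁻¹ * ε ^ d) * ∫⁻ y in Y, G y ≤
      ∫⁻ z, (∫⁻ y in ball z (2 * ε), Y.indicator G y) ∂(sg d Γ x (R + 2 * ε)) := by
  have := g.sgf x (R + 2 * ε)
  rw [ton _ _ (hG.indicator hm), ← lintegral_const_mul' _ _ ofReal_ne_top,
    ← lintegral_indicator hm]
  refine lintegral_mono fun y => ?_
  by_cases h : y ∈ Y
  · rw [indicator_of_mem h, indicator_of_mem h]
    gcongr
    rw [sg_apply_ball]
    refine (g.lo y (hY h).1).trans (measure_mono ?_)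
    rintro z ⟨hz, hzy⟩
    refine ⟨⟨hz, ?_⟩, hzy⟩
    have := (hY h).2
    rw [mem_ball] at *
    linarith [dist_triangle z y x]
  · simp [h]

theorem Geo.T2 (g : Geo n d Ca Γ) (x : Euc n) {ρ R : ℝ} (hρ : 0 < ρ) {G : Euc n → ℝ≥0∞}
    (hG : AEMeasurable G) :
    ∫⁻ z, (∫⁻ y in ball z ρ, G y) ∂(sg d Γ x R) ≤ ofReal (Ca * (2 * ρ) ^ d) *
      ∫⁻ y in {y | infDist y Γ < ρ} ∩ ball x (R + ρ), G y := by
  have := g.sgf x R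
  have hm : MeasurableSet ({y | infDist y Γ < ρ} ∩ ball x (R + ρ)) :=
    (measurableSet_lt (by fun_prop) measurable_const).inter measurableSet_ball
  rw [ton _ _ hG, ← lintegral_const_mul' _ _ ofReal_ne_top, ← lintegral_indicator hm]
  refine lintegral_mono fun y => ?_
  rw [sg_apply_ball]
  by_cases h : y ∈ {y | infDist y Γ < ρ} ∩ ball x (R + ρ)
  · rw [indicator_of_mem h]
    gcongr
    exact (measure_mono (inter_subset_inter_left _ inter_subset_left)).trans (g.up y hρ)
  · rw [indicator_of_notMem h, show Γ ∩ ball x R ∩ ball y ρ = ∅ from ?_]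
    · simp
    · rw [eq_empty_iff_forall_notMem]
      rintro z ⟨⟨h1, h2⟩, h3⟩
      rw [mem_ball] at h2 h3
      refine h ⟨(infDist_le_dist_of_mem h1).trans_lt (by rwa [dist_comm]), ?_⟩
      rw [mem_ball]; rw [dist_comm] at h3; linarith [dist_triangle y z x]
end geo

/-- volume of the unit ball -/
def omn (n : ℕ) : ℝ≥0 := (volume (ball (0 : Euc n) 1)).toNNReal

theorem omn_pos (n : ℕ) : 0 < omn n :=
  ENNReal.toNNReal_pos (measure_ball_pos _ _ one_pos).ne' measure_ball_lt_top.ne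

theorem volb {n : ℕ} (z : Euc n) {ρ : ℝ} (hρ : 0 < ρ) :
    volume (ball z ρ) = omn n * ofReal (ρ ^ n) := by
  rw [omn, ENNReal.coe_toNNReal measure_ball_lt_top.ne]
  have := Measure.addHaar_ball_of_pos (volume : Measure (Euc n)) z hρ
  rw [finrank_euclideanSpace_fin] at this
  rw [this, mul_comm]

theorem ofr_cancel {a : ℝ} (ha : 0 < a) {X Y : ℝ≥0∞} (h : ofReal a * X ≤ Y) :
    X ≤ ofReal a⁻¹ * Y := by
  calc X = ofReal a⁻¹ * (ofReal a * X) := by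
        rw [← mul_assoc, ← ofReal_mul pz, inv_mul_cancel₀ ha.ne']; simp
    _ ≤ _ := by gcongr

theorem Geo.vol_lay (n : ℕ) (d Ca : ℝ) : ∃ C : ℝ≥0, ∀ Γ : Set (Euc n), Geo n d Ca Γ →
    ∀ (x : Euc n) (ε R : ℝ), 0 < ε → ε ≤ R →
    volume ({y | infDist y Γ < ε} ∩ ball x R) ≤
      C * ofReal (R ^ d) * ofReal (ε ^ ((n:ℝ) - d)) := by
  refine ⟨Real.toNNReal (Ca * 2 ^ n * Ca * 6 ^ d) * omn n, fun Γ g x ε R hε hR => ?_⟩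
  have hC : 0 < Ca := by linarith [g.hC]
  have hR0 : 0 < R := hε.trans_le hR
  set Y := {y | infDist y Γ < ε} ∩ ball x R
  have hm : MeasurableSet Y := (measurableSet_lt (by fun_prop) measurable_const).inter
    measurableSet_ball
  have h1 := g.T1 x (Subset.refl Y) (G := fun _ => 1) hm aemeasurable_const
  simp only [setLIntegral_one] at h1
  have h2 := ofr_cancel pz h1
  have h3 : ∫⁻ z, (∫⁻ y in ball z (2 * ε), Y.indicator (fun _ => 1) y) ∂(sg d Γ x (R + 2 * ε)) ≤
      omn n * ofReal ((2 * ε) ^ n) * ofReal (Ca * (6 * R) ^ d) := by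
    calc _ ≤ ∫⁻ z, omn n * ofReal ((2 * ε) ^ n) ∂(sg d Γ x (R + 2 * ε)) := by
          refine lintegral_mono fun z => ?_
          rw [← volb z pz]
          refine (lintegral_mono (g := fun _ => 1) fun y => indicator_le_self' (by simp) y).trans ?_
          simp
      _ ≤ _ := by
          rw [lintegral_const, sg, Measure.restrict_apply MeasurableSet.univ, univ_inter]
          refine mul_le_mul' le_rfl ?_
          refine (g.up x pz).trans (ofReal_le_ofReal ?_)
          exact mul_le_mul_of_nonneg_left (Real.rpow_le_rpow pz lz
            g.hd.le) hC.le
  refine h2.trans ((mul_le_mul_right h3 _).trans (le_of_eq ?_))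
  have e : (Ca⁻¹ * ε ^ d)⁻¹ * ((2 * ε) ^ n * (Ca * (6 * R) ^ d)) =
      Ca * 2 ^ n * Ca * 6 ^ d * (R ^ d * ε ^ ((n:ℝ) - d)) := by
    rw [Real.mul_rpow nz hR0.le, Real.rpow_sub hε, Real.rpow_natCast]
    field_simp
    rw [mul_pow]
  rw [ENNReal.coe_mul, mul_assoc, mul_left_comm,
    ← ofReal_mul pz, ← ofReal_mul pz,
    e, ofReal_mul pz, ofReal_mul (p := R ^ d) pz]
  simp only [ofReal]; ring

section
variable {n : ℕ} {d Ca : ℝ} {Γ : Set (Euc n)}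

theorem Geo.pos (g : Geo n d Ca Γ) {y : Euc n} (hy : y ∉ Γ) : 0 < infDist y Γ :=
  (g.cl.notMem_iff_infDist_pos g.ne).1 hy

theorem Geo.null (g : Geo n d Ca Γ) : volume Γ = 0 := by
  obtain ⟨C, hC⟩ := Geo.vol_lay n d Ca
  have h : ∀ R : ℕ, volume (Γ ∩ ball (0 : Euc n) (R + 1)) = 0 := fun R => by
    have hl : Tendsto (fun ε : ℝ => (C * ofReal (((R:ℝ) + 1) ^ d)) *
        ofReal (ε ^ ((n:ℝ) - d))) (𝓝[>] 0) (𝓝 0) := by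
      have h1 : Tendsto (fun ε : ℝ => ε ^ ((n:ℝ) - d)) (𝓝 0) (𝓝 0) := by
        have := (Real.continuousAt_rpow_const 0 ((n:ℝ) - d)
          (Or.inr (by linarith [g.hdn]))).tendsto
        rwa [Real.zero_rpow (by linarith [g.hdn])] at this
      have h2 := ENNReal.tendsto_ofReal (h1.mono_left (nhdsWithin_le_nhds (s := Ioi 0)))
      rw [ofReal_zero] at h2
      simpa using ENNReal.Tendsto.const_mul h2
        (Or.inr (ENNReal.mul_ne_top ENNReal.coe_ne_top ofReal_ne_top))
    refine le_antisymm (ge_of_tendsto hl ?_) zero_le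
    filter_upwards [Ioo_mem_nhdsGT (show (0:ℝ) < 1 by norm_num)] with ε hε
    refine (measure_mono ?_).trans (hC Γ g 0 ε (R + 1) hε.1 (by
      linarith [hε.2, (Nat.cast_nonneg R : (0:ℝ) ≤ R)]))
    refine inter_subset_inter_left _ fun y hy => ?_
    change infDist y Γ < ε
    rw [infDist_zero_of_mem hy]; exact hε.1
  refine measure_mono_null ?_ (measure_iUnion_null h)
  intro y hy
  obtain ⟨R, hR⟩ := exists_nat_gt (dist y 0)
  exact mem_iUnion.2 ⟨R, hy, mem_ball.2 lz⟩

theorem Geo.aeO (g : Geo n d Ca Γ) : ∀ᵐ y : Euc n, y ∉ Γ := measure_eq_zero_iff_ae_notMem.1 g.null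

theorem wW_meas (n : ℕ) (d : ℝ) (Γ : Set (Euc n)) : Measurable (weightW n d Γ) := by
  unfold weightW; fun_prop

theorem wW_em : Measurable fun x => ofReal (weightW n d Γ x) :=
  (wW_meas n d Γ).ennreal_ofReal

theorem mW_ac : measW n d Γ ≪ volume := withDensity_absolutelyContinuous _ _

theorem lmW {f : Euc n → ℝ≥0∞} (hf : AEMeasurable f) (S : Set (Euc n)) (hS : MeasurableSet S) :
    ∫⁻ x in S, f x ∂(measW n d Γ) = ∫⁻ x in S, ofReal (weightW n d Γ x) * f x := by
  rw [measW, restrict_withDensity hS, lintegral_withDensity_eq_lintegral_mul₀ wW_em.aemeasurable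
    hf.restrict]
  rfl

theorem Geo.w_ge (g : Geo n d Ca Γ) {y : Euc n} {ρ : ℝ} (hy : y ∉ Γ) (h : infDist y Γ ≤ ρ) :
    ρ ^ (d + 1 - (n:ℝ)) ≤ weightW n d Γ y :=
  Real.rpow_le_rpow_of_nonpos (g.pos hy) h (by linarith [g.hdn])

theorem Geo.w_le (g : Geo n d Ca Γ) {y : Euc n} {ρ : ℝ} (hρ : 0 < ρ) (h : ρ ≤ infDist y Γ) :
    weightW n d Γ y ≤ ρ ^ (d + 1 - (n:ℝ)) :=
  Real.rpow_le_rpow_of_nonpos hρ h (by linarith [g.hdn])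

theorem Geo.w_pos (g : Geo n d Ca Γ) {y : Euc n} (hy : y ∉ Γ) : 0 < weightW n d Γ y :=
  Real.rpow_pos_of_pos (g.pos hy) _

theorem Geo.ac (g : Geo n d Ca Γ) : volume ≪ measW n d Γ := by
  refine withDensity_absolutelyContinuous' wW_em.aemeasurable ?_
  filter_upwards [g.aeO] with y hy
  simpa using g.w_pos hy

end

theorem Geo.mball (n : ℕ) (d Ca : ℝ) (hdn : d < (n:ℝ) - 1) : ∃ C : ℝ≥0, ∀ Γ : Set (Euc n),
    Geo n d Ca Γ → ∀ x ∈ Γ, ∀ R : ℝ, 0 < R →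
    measW n d Γ (ball x R) ≤ C * ofReal (R ^ (d + 1)) := by
  obtain ⟨C, hC⟩ := Geo.vol_lay n d Ca
  obtain ⟨C', hC'⟩ := layer_lo ((n:ℝ) - d) ((n:ℝ) - 1 - d) lz lz
  refine ⟨C' * C, fun Γ g x hx R hR => ?_⟩
  have hm : Measurable fun y => infDist y Γ := by fun_prop
  have h := hC' (volume.restrict (ball x R)) (fun y => infDist y Γ) hm
    (C * ofReal (R ^ d)) R hR fun t ht htR => by
      rw [Measure.restrict_apply (measurableSet_lt hm measurable_const)]
      exact hC Γ g x t R ht htR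
  calc _ = ∫⁻ y in ball x R, ofReal (weightW n d Γ y) := by
        rw [measW, withDensity_apply _ measurableSet_ball]
    _ = ∫⁻ y in {y | 0 < infDist y Γ ∧ infDist y Γ < R}, ofReal (infDist y Γ ^
        (-((n:ℝ) - 1 - d))) ∂(volume.restrict (ball x R)) := by
        have hms : MeasurableSet {y | 0 < infDist y Γ ∧ infDist y Γ < R} :=
          (measurableSet_lt measurable_const hm).inter (measurableSet_lt hm measurable_const)
        rw [Measure.restrict_restrict hms]
        have : ({y | 0 < infDist y Γ ∧ infDist y Γ < R} ∩ ball x R : Set (Euc n)) =ᵐ[volume]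
            ball x R := by
          filter_upwards [g.aeO] with y hy
          refine propext ⟨fun h => h.2, fun h => ⟨⟨g.pos hy, ?_⟩, h⟩⟩
          exact (infDist_le_dist_of_mem hx).trans_lt h
        rw [Measure.restrict_congr_set this]
        refine lintegral_congr fun y => ?_
        rw [weightW]; congr 2; ring
    _ ≤ _ := h
    _ = _ := by
        rw [show d + 1 = d + ((n:ℝ) - d - ((n:ℝ) - 1 - d)) by ring, Real.rpow_add hR,
          ofReal_mul pz]
        push_cast; ring

section
variable {n : ℕ}

theorem gr_out {φ : Euc n → ℝ} {x : Euc n} (h : x ∉ tsupport φ) : gradient φ x = 0 := by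
  rw [← norm_eq_zero, ngr, fderiv_of_notMem_tsupport (𝕜 := ℝ) h, norm_zero]

theorem gr_cont {φ : Euc n → ℝ} (h : Sm φ) : Continuous (gradient φ) := by
  unfold gradient
  exact (LinearIsometryEquiv.continuous _).comp (h.continuous_fderiv (by simp))

theorem gr_cs {φ : Euc n → ℝ} (h : HasCompactSupport φ) : HasCompactSupport (gradient φ) :=
  HasCompactSupport.intro h fun _ hx => gr_out hx

theorem dg_iff {u : Euc n → ℝ} {v : Euc n → Euc n} {E : Set (Euc n)} : IsDistribGradOn u v E ↔
    ∀ φ : Euc n → ℝ, Sm φ → HasCompactSupport φ → tsupport φ ⊆ E →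
    ∫ x, u x • gradient φ x = -∫ x, φ x • v x := by
  unfold IsDistribGradOn
  refine forall₄_congr fun φ _ _ hs => ?_
  rw [setIntegral_eq_integral_of_forall_compl_eq_zero, setIntegral_eq_integral_of_forall_compl_eq_zero]
  · intro x hx; rw [image_eq_zero_of_notMem_tsupport fun h => hx (hs h), zero_smul]
  · intro x hx; rw [gr_out fun h => hx (hs h), smul_zero]

theorem ibp {f ψ : Euc n → ℝ} (hf : Sm f) (hψ : Sm ψ)
    (hc : HasCompactSupport ψ) : ∫ x, f x • gradient ψ x = -∫ x, ψ x • gradient f x := by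
  have i1 : Integrable fun x => f x • gradient ψ x :=
    (hf.continuous.smul (gr_cont hψ)).integrable_of_hasCompactSupport (gr_cs hc).smul_left
  have i2 : Integrable fun x => ψ x • gradient f x :=
    (hψ.continuous.smul (gr_cont hf)).integrable_of_hasCompactSupport hc.smul_right
  refine ext_inner_left ℝ fun v => ?_
  rw [inner_neg_right, ← integral_inner i1, ← integral_inner i2]
  have e : ∀ (h : Euc n → ℝ) x, inner ℝ v (gradient h x) = fderiv ℝ h x v := fun h x => by
    rw [real_inner_comm]; simp [gradient]
  simp only [inner_smul_right, e]
  have := integral_mul_fderiv_eq_neg_fderiv_mul_of_integrable (μ := volume) (f := f) (g := ψ) (v := v)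
    ?_ ?_ ?_ (fun x _ => hf.differentiable (by simp) x) (fun x _ => hψ.differentiable (by simp) x)
  · rw [this]; simp_rw [mul_comm]
  · simpa only [inner_smul_right, e, mul_comm] using i2.const_inner (𝕜 := ℝ) v
  · simpa only [inner_smul_right, e] using i1.const_inner (𝕜 := ℝ) v
  · exact (hf.continuous.mul hψ.continuous).integrable_of_hasCompactSupport hc.mul_left

theorem grad_comp {f : Euc n → ℝ} {F : ℝ → ℝ} {x : Euc n} (hF : DifferentiableAt ℝ F (f x))
    (hf : DifferentiableAt ℝ f x) :
    gradient (fun y => F (f y)) x = deriv F (f x) • gradient f x := by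
  unfold gradient
  rw [show (fun y => F (f y)) = F ∘ f from rfl, (hF.hasDerivAt.comp_hasFDerivAt x hf.hasFDerivAt).fderiv, map_smul]

theorem grad_mul {f h : Euc n → ℝ} {x : Euc n} (hF : DifferentiableAt ℝ h x)
    (hf : DifferentiableAt ℝ f x) :
    gradient (fun y => f y * h y) x = f x • gradient h x + h x • gradient f x := by
  unfold gradient
  rw [fderiv_fun_mul hf hF]; simp

theorem chain {U : Euc n → ℝ} {q : Euc n → Euc n} {O : Set (Euc n)} (hO : IsOpen O)
    (hU : LocallyIntegrable U) (hq : MemLp q 2 volume) (hg : IsDistribGradOn U q O) {F : ℝ → ℝ}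
    (hF : Sm F) (hb : (∃ N, ∀ t, |F t| ≤ N) ∨ MemLp U 2 volume) {N' : ℝ} (hb' : ∀ t, |deriv F t| ≤ N') :
    IsDistribGradOn (fun x => F (U x)) (fun x => deriv F (U x) • q x) O := by
  rw [dg_iff]
  intro ψ hψ hc hs
  have hdF : Continuous (deriv F) := hF.continuous_deriv (by simp)
  have hql : LocallyIntegrable q := hq.locallyIntegrable nz
  obtain ⟨η, hη, hηO⟩ := hc.isCompact.exists_cthickening_subset_open hO hs
  set f := fun j => moll (bmp n j) U
  have hf : ∀ j, Sm (f j) := fun j => moll_smooth _ hU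
  have hψi : Integrable fun x => gradient ψ x := (gr_cont hψ).integrable_of_hasCompactSupport (gr_cs hc)
  have hψ2 : MemLp ψ 2 volume := hψ.continuous.memLp_of_hasCompactSupport hc
  have hψq : Integrable fun x => ψ x • q x :=
    memLp_one_iff_integrable.1 (hq.smul hψ2)
  have L : Tendsto (fun j => ∫ x, F (f j x) • gradient ψ x) atTop (𝓝 (∫ x, F (U x) • gradient ψ x)) := by
    rcases hb with ⟨N, hb⟩ | hU2
    · refine tendsto_integral_of_dominated_convergence (fun x => N * ‖gradient ψ x‖)
        (fun j => ((hF.continuous.comp (hf j).continuous).smul (gr_cont hψ)).aestronglyMeasurable)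
        (hψi.norm.const_mul N) (fun j => Eventually.of_forall fun x => ?_) ?_
      · rw [norm_smul]; gcongr; exact hb _
      · filter_upwards [moll_ae hU] with x hx
        exact ((hF.continuous.tendsto _).comp hx).smul_const _
    · have hFl : ∀ s t, |F s - F t| ≤ N' * |s - t| := fun s t => by
        have := convex_univ.norm_image_sub_le_of_norm_deriv_le (f := F) (C := N') (x := t) (y := s)
          (fun x _ => hF.differentiable (by simp) x) (fun x _ => hb' x) (mem_univ _) (mem_univ _)
        simpa using this
      have hψ3 : MemLp (fun x => gradient ψ x) 2 volume :=
        (gr_cont hψ).memLp_of_hasCompactSupport (gr_cs hc)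
      have h0 := ENNReal.Tendsto.const_mul (a := ofReal N' * eLpNorm (fun x => gradient ψ x) 2 volume)
        (moll_L2 hU2) (Or.inr (ENNReal.mul_ne_top ofReal_ne_top hψ3.2.ne))
      rw [mul_zero] at h0
      have hFi : ∀ h : Euc n → ℝ, MemLp h 2 volume → Integrable fun x => F (h x) • gradient ψ x := by
        intro h hh
        have i0 : MemLp (fun x => F (h x) - F 0) 2 volume :=
          hh.of_le_mul (c := N') ((hF.continuous.comp_aestronglyMeasurable hh.1).sub
            aestronglyMeasurable_const) (Eventually.of_forall fun x => by simpa using hFl (h x) 0)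
        have i1 : Integrable ((fun x => F (h x) - F 0) • fun x => gradient ψ x) :=
          memLp_one_iff_integrable.1 (hψ3.smul i0)
        refine (i1.add (hψi.smul (F 0))).congr (Eventually.of_forall fun x => ?_)
        simp [sub_smul]
      have hfm : ∀ j, MemLp (f j) 2 volume := fun j =>
        ⟨(hf j).continuous.aestronglyMeasurable, by
          have := moll_young (bmp n j) hU2.1
          rw [← sqn, ← sqn] at this
          exact (sq_le_sq_enn this).trans_lt hU2.2⟩
      rw [tendsto_iff_enorm_sub_tendsto_zero]
      refine tendsto_of_tendsto_of_tendsto_of_le_of_le tendsto_const_nhds h0 (fun _ => zero_le)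
        fun j => ?_
      beta_reduce
      rw [← integral_sub (hFi _ (hfm j)) (hFi _ hU2)]
      refine (enorm_integral_le_lintegral_enorm _).trans ?_
      have hm3 : AEStronglyMeasurable (fun x => f j x - U x) volume := (hfm j).1.sub hU2.1
      calc _ ≤ ∫⁻ x, ofReal N' * ‖(f j x - U x) • gradient ψ x‖ₑ := by
            refine lintegral_mono fun x => ?_
            rw [← sub_smul, enorm_smul, enorm_smul, ← mul_assoc]
            refine mul_le_mul' ?_ le_rfl
            rw [Real.enorm_eq_ofReal_abs, Real.enorm_eq_ofReal_abs, ← ofReal_mul'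
              (abs_nonneg _)]
            exact ofReal_le_ofReal (hFl _ _)
        _ = ofReal N' * eLpNorm (fun x => (f j x - U x) • gradient ψ x) 1 volume := by
            rw [lintegral_const_mul' _ _ ofReal_ne_top, eLpNorm_one_eq_lintegral_enorm]
        _ ≤ _ := by
            rw [mul_assoc]; refine mul_le_mul' le_rfl ?_
            rw [mul_comm]
            change eLpNorm ((fun x => f j x - U x) • fun x => gradient ψ x) 1 volume ≤
              eLpNorm (fun x => f j x - U x) 2 volume * _
            generalize (fun x => f j x - U x) = G at hm3 ⊢
            exact eLpNorm_smul_le_mul_eLpNorm (p := 2) (q := 2) (r := 1) hψ3.1 hm3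
  have R1 : Tendsto (fun j => ∫ x, ψ x • deriv F (f j x) • q x) atTop
      (𝓝 (∫ x, ψ x • deriv F (U x) • q x)) := by
    refine tendsto_integral_of_dominated_convergence (fun x => N' * ‖ψ x • q x‖)
      (fun j => hψ.continuous.aestronglyMeasurable.smul
        ((hdF.comp (hf j).continuous).aestronglyMeasurable.smul hq.1))
      (hψq.norm.const_mul N') (fun j => Eventually.of_forall fun x => ?_) ?_
    · rw [smul_comm, norm_smul]; gcongr; exact hb' _
    · filter_upwards [moll_ae hU] with x hx
      exact (((hdF.tendsto _).comp hx).smul_const _).const_smul _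
  have hmq : ∀ j, MemLp (moll (bmp n j) q) 2 volume := fun j =>
    ⟨(moll_smooth _ hql).continuous.aestronglyMeasurable, by
      have := moll_young (bmp n j) hq.1
      rw [← sqn, ← sqn] at this
      exact (sq_le_sq_enn this).trans_lt hq.2⟩
  have iA : ∀ j, Integrable fun x => ψ x • deriv F (f j x) • (moll (bmp n j) q x - q x) := fun j => by
    have : Integrable (ψ • (moll (bmp n j) q - q)) :=
      memLp_one_iff_integrable.1 (((hmq j).sub hq).smul hψ2)
    refine (this.norm.const_mul N').mono' (hψ.continuous.aestronglyMeasurable.smul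
        ((hdF.comp (hf j).continuous).aestronglyMeasurable.smul ((hmq j).1.sub hq.1)))
        (Eventually.of_forall fun x => ?_)
    rw [smul_comm, norm_smul]; exact mul_le_mul_of_nonneg_right (hb' _) (norm_nonneg _)
  have iB : ∀ j, Integrable fun x => ψ x • deriv F (f j x) • q x := fun j => by
    refine (hψq.norm.const_mul N').mono' (hψ.continuous.aestronglyMeasurable.smul
        ((hdF.comp (hf j).continuous).aestronglyMeasurable.smul hq.1))
        (Eventually.of_forall fun x => ?_)
    rw [smul_comm, norm_smul]; gcongr; exact hb' _
  have R2 : Tendsto (fun j => ∫ x, ψ x • deriv F (f j x) • (moll (bmp n j) q x - q x)) atTop (𝓝 0) := by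
    rw [tendsto_zero_iff_enorm_tendsto_zero]
    have h0 := ENNReal.Tendsto.const_mul (a := ofReal N' * eLpNorm ψ 2 volume) (moll_L2 hq)
      (Or.inr (ENNReal.mul_ne_top ofReal_ne_top hψ2.2.ne))
    rw [mul_zero] at h0
    refine tendsto_of_tendsto_of_tendsto_of_le_of_le tendsto_const_nhds h0 (fun _ => zero_le)
      fun j => ?_
    refine (enorm_integral_le_lintegral_enorm _).trans ?_
    calc _ ≤ ∫⁻ x, ofReal N' * ‖ψ x • (moll (bmp n j) q x - q x)‖ₑ := by
          refine lintegral_mono fun x => ?_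
          rw [smul_comm, enorm_smul]; gcongr
          rw [Real.enorm_eq_ofReal_abs]; exact ofReal_le_ofReal (hb' _)
      _ = ofReal N' * eLpNorm (fun x => ψ x • (moll (bmp n j) q x - q x)) 1 volume := by
          rw [lintegral_const_mul' _ _ ofReal_ne_top, eLpNorm_one_eq_lintegral_enorm]
      _ ≤ _ := by
          rw [mul_assoc]; refine mul_le_mul' le_rfl ?_
          have hm3 : AEStronglyMeasurable (fun x => moll (bmp n j) q x - q x) volume :=
            (hmq j).1.sub hq.1
          change eLpNorm (ψ • fun x => moll (bmp n j) q x - q x) 1 volume ≤ _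
          generalize (fun x => moll (bmp n j) q x - q x) = G at hm3 ⊢
          exact eLpNorm_smul_le_mul_eLpNorm (p := 2) (q := 2) (r := 1) hm3 hψ2.1
  have E : ∀ᶠ j in atTop, ∫ x, F (f j x) • gradient ψ x =
      -((∫ x, ψ x • deriv F (f j x) • q x) +
        ∫ x, ψ x • deriv F (f j x) • (moll (bmp n j) q x - q x)) := by
    filter_upwards [(bmp_rOut n).eventually (eventually_le_nhds hη)] with j hj
    rw [ibp (f := fun x => F (f j x)) (hF.comp (hf j)) hψ hc, ← integral_add (iB j) (iA j)]
    congr 1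
    refine integral_congr_ae (Eventually.of_forall fun x => ?_)
    beta_reduce
    by_cases hx : x ∈ tsupport ψ
    · rw [← smul_add, ← smul_add, add_sub_cancel, ← moll_grad hU hg, grad_comp]
      · exact (hF.differentiable (by simp)) _
      · exact (hf j).differentiable (by simp) _
      · refine Subset.trans ?_ hηO
        exact (closedBall_subset_cthickening hx _).trans (cthickening_mono hj _)
    · simp [image_eq_zero_of_notMem_tsupport hx]
  refine tendsto_nhds_unique (L.congr' E) ?_
  simpa using (R1.add R2).neg

end

section
variable {n : ℕ} {d Ca : ℝ} {Γ : Set (Euc n)}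

theorem rpow_seq {κ : ℝ} (hκ : 0 < κ) : Tendsto (fun j : ℕ => (1 / ((j:ℝ) + 1)) ^ κ) atTop (𝓝 0) := by
  have h := (Real.continuousAt_rpow_const 0 κ (Or.inr hκ.le)).tendsto
  rw [Real.zero_rpow hκ.ne'] at h
  exact h.comp tendsto_one_div_add_atTop_nhds_zero_nat

theorem Geo.remov (g : Geo n d Ca Γ) {U : Euc n → ℝ} {q : Euc n → Euc n} (hU : LocallyIntegrable U)
    (hq : MemLp q 2 volume) (hg : IsDistribGradOn U q Γᶜ) : IsDistribGradOn U q univ := by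
  rw [dg_iff]
  intro ψ hψ hc _
  set κ := ((n:ℝ) - 1 - d) / 2
  have hκ : 0 < κ := by have := g.hdn; simp only [κ]; linarith
  set ε : ℕ → ℝ := fun j => 1 / ((j:ℝ) + 1)
  have hε : ∀ j, 0 < ε j := fun j => by simp only [ε]; positivity
  have hε1 : ∀ j, ε j ≤ 1 := fun j => by
    simp only [ε]; rw [div_le_one pz]; linarith [(Nat.cast_nonneg j : (0:ℝ) ≤ j)]
  have hε0 : Tendsto ε atTop (𝓝 0) := tendsto_one_div_add_atTop_nhds_zero_nat
  set h : ℕ → ℝ := fun j => ε j ^ κ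
  have hh : ∀ j, 0 < h j := fun j => Real.rpow_pos_of_pos (hε j) _
  have hh0 : Tendsto h atTop (𝓝 0) := rpow_seq hκ
  choose χ hχ1 hχ2 hχ3 hχ4 hχ5 using fun j => cutoff Γ (show ε j < 2 * ε j by linarith [hε j])
  set F : ℕ → ℝ → ℝ := fun j t => (h j)⁻¹ * Real.sin (t * h j)
  have hF : ∀ j, Sm (F j) := fun j =>
    contDiff_const.mul (Real.contDiff_sin.comp (contDiff_id.mul contDiff_const))
  have hF' : ∀ j t, deriv (F j) t = Real.cos (t * h j) := fun j t => by
    have h1 : HasDerivAt (fun t : ℝ => t * h j) (1 * h j) t := (hasDerivAt_id t).mul_const _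
    have := (h1.sin.const_mul ((h j)⁻¹)).deriv
    simp only [F]; rw [this]; have := (hh j).ne'; field_simp
  have hFb : ∀ j t, |F j t| ≤ (h j)⁻¹ := fun j t => by
    simp only [F]; rw [abs_mul, abs_of_pos (inv_pos.2 (hh j))]
    exact mul_le_of_le_one_right (inv_pos.2 (hh j)).le (Real.abs_sin_le_one _)
  have hFb2 : ∀ j t, |F j t| ≤ |t| := fun j t => by
    simp only [F]; rw [abs_mul, abs_of_pos (inv_pos.2 (hh j)), inv_mul_le_iff₀ (hh j)]
    refine Real.abs_sin_le_abs.trans ?_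
    rw [abs_mul, abs_of_pos (hh j), mul_comm]
  have hFb3 : ∀ j t, |deriv (F j) t| ≤ 1 := fun j t => by rw [hF']; exact Real.abs_cos_le_one _
  have hFl : ∀ t, Tendsto (fun j => F j t) atTop (𝓝 t) := fun t => by
    have h1 : HasDerivAt (fun s : ℝ => Real.sin (t * s)) (Real.cos (t * 0) * (t * 1)) 0 :=
      ((hasDerivAt_id (0:ℝ)).const_mul t).sin
    have h2 := (hasDerivAt_iff_tendsto_slope_zero.1 h1).comp
      (tendsto_nhdsWithin_iff.2 ⟨hh0, Eventually.of_forall fun j => (hh j).ne'⟩)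
    simpa [Function.comp_def, F] using h2
  have hFl' : ∀ t, Tendsto (fun j => deriv (F j) t) atTop (𝓝 1) := fun t => by
    simp_rw [hF']
    have h1 : Tendsto (fun j => t * h j) atTop (𝓝 0) := by simpa using hh0.const_mul t
    have h2 := (Real.continuous_cos.tendsto 0).comp h1
    rwa [Real.cos_zero] at h2
  have hχl : ∀ y ∉ Γ, ∀ᶠ j in atTop, χ j y = 1 := fun y hy => by
    have : ∀ᶠ j in atTop, ε j < infDist y Γ / 2 := hε0.eventually_lt_const (half_pos (g.pos hy))
    filter_upwards [this] with j hj
    exact hχ4 j y lz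
  have hψU : Integrable fun x => U x • gradient ψ x :=
    hU.integrable_smul_right_of_hasCompactSupport (gr_cont hψ) (gr_cs hc)
  have hψ2 : MemLp ψ 2 volume := hψ.continuous.memLp_of_hasCompactSupport hc
  have hψq : Integrable fun x => ψ x • q x := memLp_one_iff_integrable.1 (hq.smul hψ2)
  have mF : ∀ j, AEStronglyMeasurable (fun x => F j (U x)) := fun j =>
    (hF j).continuous.comp_aestronglyMeasurable hU.aestronglyMeasurable
  have T1 : Tendsto (fun j => ∫ x, (F j (U x) * χ j x) • gradient ψ x) atTop
      (𝓝 (∫ x, U x • gradient ψ x)) := by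
    refine tendsto_integral_of_dominated_convergence (fun x => ‖U x • gradient ψ x‖)
      (fun j => ((mF j).mul (hχ1 j).continuous.aestronglyMeasurable).smul
        (gr_cont hψ).aestronglyMeasurable) hψU.norm
      (fun j => Eventually.of_forall fun x => ?_) ?_
    · rw [norm_smul, norm_smul, norm_mul]
      refine mul_le_mul_of_nonneg_right ?_ (norm_nonneg _)
      rw [Real.norm_of_nonneg (hχ2 j x).1]
      exact (mul_le_of_le_one_right (norm_nonneg _) (hχ2 j x).2).trans (hFb2 j _)
    · filter_upwards [g.aeO] with x hx
      refine Tendsto.smul_const ?_ _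
      refine (hFl (U x)).congr' ?_
      filter_upwards [hχl x hx] with j hj
      rw [hj, mul_one]
  have T3 : Tendsto (fun j => ∫ x, (ψ x * χ j x) • deriv (F j) (U x) • q x) atTop
      (𝓝 (∫ x, ψ x • q x)) := by
    refine tendsto_integral_of_dominated_convergence (fun x => ‖ψ x • q x‖)
      (fun j => (hψ.continuous.mul (hχ1 j).continuous).aestronglyMeasurable.smul
        ((((hF j).continuous_deriv (by simp)).comp_aestronglyMeasurable
          hU.aestronglyMeasurable).smul hq.1)) hψq.norm
      (fun j => Eventually.of_forall fun x => ?_) ?_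
    · rw [norm_smul, norm_smul, norm_smul, norm_mul, Real.norm_of_nonneg (hχ2 j x).1]
      have h1 := hFb3 j (U x)
      rw [← Real.norm_eq_abs] at h1
      refine mul_le_mul (mul_le_of_le_one_right (norm_nonneg _) (hχ2 j x).2)
        (mul_le_of_le_one_left (norm_nonneg _) h1) pz (norm_nonneg _)
    · filter_upwards [g.aeO] with x hx
      have := (hFl' (U x)).smul_const (q x)
      rw [one_smul] at this
      refine (this.const_smul (ψ x)).congr' ?_
      filter_upwards [hχl x hx] with j hj
      rw [hj, mul_one]
  obtain ⟨R, hR⟩ := hc.isCompact.isBounded.subset_ball (0 : Euc n)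
  obtain ⟨M, hM⟩ := hc.exists_bound_of_continuous hψ.continuous
  have hM0 : 0 ≤ M := (norm_nonneg _).trans (hM 0)
  obtain ⟨C, hC⟩ := Geo.vol_lay n d Ca
  set R' := max R 3
  have hLS := LS1
  have T2 : Tendsto (fun j => ∫ x, (F j (U x) * ψ x) • gradient (χ j) x) atTop (𝓝 0) := by
    rw [tendsto_zero_iff_enorm_tendsto_zero]
    have hl : Tendsto (fun j => ofReal (M * (3 * LS) * 3 ^ ((n:ℝ) - d) * h j) *
        (C * ofReal (R' ^ d))) atTop (𝓝 0) := by
      have h1 := ENNReal.tendsto_ofReal (hh0.const_mul (M * (3 * LS) * 3 ^ ((n:ℝ) - d)))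
      rw [mul_zero, ofReal_zero] at h1
      simpa using ENNReal.Tendsto.mul_const h1 (Or.inr (ENNReal.mul_ne_top ENNReal.coe_ne_top
        ofReal_ne_top))
    refine tendsto_of_tendsto_of_tendsto_of_le_of_le tendsto_const_nhds hl (fun _ => zero_le)
      fun j => (enorm_integral_le_lintegral_enorm _).trans ?_
    set S := {y | infDist y Γ < 3 * ε j} ∩ ball (0 : Euc n) R'
    have hS : MeasurableSet S := (measurableSet_lt (by fun_prop) measurable_const).inter
      measurableSet_ball
    have hpt : ∀ x, ‖(F j (U x) * ψ x) • gradient (χ j) x‖ₑ ≤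
        S.indicator (fun _ => ofReal ((h j)⁻¹ * M * (3 * LS / ε j))) x := fun x => by
      by_cases hx : x ∈ S
      · rw [indicator_of_mem hx, ← ofReal_norm, norm_smul, norm_mul]
        refine ofReal_le_ofReal ?_
        have h5 := hχ5 j x
        rw [show 2 * ε j - ε j = ε j by ring] at h5
        have h6 := hFb j (U x)
        rw [← Real.norm_eq_abs] at h6
        have := hε j; have := hh j
        gcongr
        exact hM x
      · rw [indicator_of_notMem hx]
        refine le_of_eq ?_
        rw [enorm_eq_zero]
        by_cases h1 : x ∈ ball (0 : Euc n) R'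
        · have h2 : 3 * ε j ≤ infDist x Γ := not_lt.1 fun h2 => hx ⟨h2, h1⟩
          have : χ j =ᶠ[𝓝 x] fun _ => 1 := by
            have ho : IsOpen {y | 2 * ε j < infDist y Γ} :=
              isOpen_lt continuous_const (continuous_infDist_pt _)
            filter_upwards [ho.mem_nhds (show 2 * ε j < infDist x Γ by linarith [hε j])] with y hy
            exact hχ4 j y (le_of_lt hy)
          have : gradient (χ j) x = 0 := by
            rw [← norm_eq_zero, ngr, this.fderiv_eq]; simp
          rw [this, smul_zero]
        · have : x ∉ tsupport ψ := fun hx => h1 (ball_subset_ball (le_max_left _ _) (hR hx))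
          rw [image_eq_zero_of_notMem_tsupport this]; simp
    refine (lintegral_mono hpt).trans ?_
    rw [lintegral_indicator hS, setLIntegral_const]
    have hRε : 3 * ε j ≤ R' := by
      have := hε1 j; have := le_max_right R 3; simp only [R']; linarith
    refine (mul_le_mul' le_rfl (hC Γ g 0 (3 * ε j) R' (by linarith [hε j]) hRε)).trans (le_of_eq ?_)
    have e : M * (3 * LS) * 3 ^ ((n:ℝ) - d) * h j = ((h j)⁻¹ * M * (3 * LS / ε j)) *
        (3 * ε j) ^ ((n:ℝ) - d) := by
      rw [Real.mul_rpow nz (hε j).le]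
      have h1 : ε j ^ ((n:ℝ) - d) = h j * h j * ε j := by
        simp only [h]
        rw [← Real.rpow_add (hε j), ← Real.rpow_add_one (hε j).ne']
        congr 1; simp only [κ]; ring
      rw [h1]
      have := hε j; have := hh j
      field_simp
    rw [e, ofReal_mul (p := (h j)⁻¹ * M * (3 * LS / ε j)) (by have := hε j; have := hh j; positivity)]
    ring
  have E : ∀ j, (∫ x, (F j (U x) * χ j x) • gradient ψ x) + ∫ x, (F j (U x) * ψ x) • gradient (χ j) x =
      -∫ x, (ψ x * χ j x) • deriv (F j) (U x) • q x := fun j => by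
    have hs : tsupport (fun x => ψ x * χ j x) ⊆ Γᶜ := by
      have hcl : IsClosed {y | ε j ≤ infDist y Γ} := isClosed_le continuous_const (continuous_infDist_pt _)
      refine (closure_minimal (fun y hy => ?_) hcl).trans fun y (hy : ε j ≤ infDist y Γ) hyΓ => ?_
      · change ε j ≤ infDist y Γ
        by_contra h
        exact hy (by simp [hχ3 j y (not_le.1 h).le])
      · rw [infDist_zero_of_mem hyΓ] at hy; linarith [hε j]
    have := dg_iff.1 (chain g.cl.isOpen_compl hU hq hg (hF j) (Or.inl ⟨_, hFb j⟩) (hFb3 j))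
      (fun x => ψ x * χ j x) (hψ.mul (hχ1 j)) hc.mul_right hs
    rw [← this, ← integral_add]
    · refine integral_congr_ae (Eventually.of_forall fun x => ?_)
      beta_reduce
      rw [grad_mul ((hχ1 j).differentiable (by simp) _) (hψ.differentiable (by simp) _), smul_add,
        smul_smul, smul_smul, add_comm]
    · refine (((gr_cont hψ).integrable_of_hasCompactSupport (gr_cs hc)).norm.const_mul (h j)⁻¹).mono'
        (((mF j).mul (hχ1 j).continuous.aestronglyMeasurable).smul
        (gr_cont hψ).aestronglyMeasurable) (Eventually.of_forall fun x => ?_)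
      rw [norm_smul, norm_mul, Real.norm_of_nonneg (hχ2 j x).1]
      exact mul_le_mul_of_nonneg_right ((mul_le_of_le_one_right (norm_nonneg _) (hχ2 j x).2).trans
        (hFb j _)) (norm_nonneg _)
    · refine ((hψ.continuous.norm.mul (gr_cont (hχ1 j)).norm).integrable_of_hasCompactSupport
        (hc.norm.mul_right)).const_mul (h j)⁻¹ |>.mono' (((mF j).mul
        hψ.continuous.aestronglyMeasurable).smul (gr_cont (hχ1 j)).aestronglyMeasurable)
        (Eventually.of_forall fun x => ?_)
      rw [norm_smul, norm_mul, mul_assoc]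
      exact mul_le_mul_of_nonneg_right (hFb j _) pz
  have l1 := T1.add T2
  rw [add_zero] at l1
  exact tendsto_nhds_unique l1 (T3.neg.congr fun j => (E j).symm)
end

/-- globalised solution -/
structure Good (n : ℕ) (d : ℝ) (Γ : Set (Euc n)) (A : Euc n → Euc n →L[ℝ] Euc n) (O : Set (Euc n))
    (U : Euc n → ℝ) (q : Euc n → Euc n) : Prop where
  U2 : MemLp U 2 volume
  q2 : MemLp q 2 volume
  qm : ∫⁻ y, nn(q y) ∂(measW n d Γ) < ⊤
  gr : IsDistribGradOn U q univ
  sol : SolOn Γ A q O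

section
variable {n : ℕ} {d Ca : ℝ} {Γ : Set (Euc n)}

theorem li1 {F : Type*} [NormedAddCommGroup F] [NormedSpace ℝ F] {f : Euc n → F} {O : Set (Euc n)}
    (hf : LocallyIntegrableOn f O) {φ : Euc n → ℝ} (hφ : Continuous φ) (hc : HasCompactSupport φ)
    (hs : tsupport φ ⊆ O) : Integrable fun x => φ x • f x := by
  have h1 := hf.integrableOn_compact_subset hs hc.isCompact
  have h2 := h1.continuousOn_smul hφ.continuousOn hc.isCompact
  refine (integrableOn_iff_integrable_of_support_subset ?_).1 h2
  intro x hx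
  by_contra h
  exact hx (by simp [image_eq_zero_of_notMem_tsupport h])

theorem li2 {f : Euc n → ℝ} {O : Set (Euc n)}
    (hf : LocallyIntegrableOn f O) {φ : Euc n → Euc n} (hφ : Continuous φ) (hc : HasCompactSupport φ)
    (hs : tsupport φ ⊆ O) : Integrable fun x => f x • φ x := by
  have h1 := hf.integrableOn_compact_subset hs hc.isCompact
  have h2 := h1.smul_continuousOn hφ.continuousOn hc.isCompact
  refine (integrableOn_iff_integrable_of_support_subset ?_).1 h2
  intro x hx
  by_contra h
  exact hx (by simp [image_eq_zero_of_notMem_tsupport h])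

theorem gr_ts {φ : Euc n → ℝ} : tsupport (gradient φ) ⊆ tsupport φ := by
  refine closure_minimal (fun x hx => ?_) (isClosed_tsupport _)
  by_contra h
  exact hx (gr_out h)

theorem grad_add' {f h : Euc n → ℝ} {x : Euc n} (hF : DifferentiableAt ℝ h x)
    (hf : DifferentiableAt ℝ f x) :
    gradient (fun y => f y + h y) x = gradient f x + gradient h x := by
  unfold gradient
  rw [fderiv_fun_add hf hF]; simp

theorem sol_congr {A : Euc n → Euc n →L[ℝ] Euc n} {v q : Euc n → Euc n} {O O' : Set (Euc n)}
    (hO : O ⊆ O') (h : ∀ᵐ y, y ∈ O → v y = q y) (hs : SolOn Γ A v O') : SolOn Γ A q O := by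
  intro φ h1 h2 h3
  rw [← hs φ h1 h2 (h3.trans hO)]
  refine integral_congr_ae (ae_restrict_of_ae ?_)
  filter_upwards [h] with y hy
  by_cases hyO : y ∈ O
  · rw [hy hyO]
  · rw [gr_out fun h => hyO (h3 h)]; simp

theorem sol_red {A : Euc n → Euc n →L[ℝ] Euc n} {u U : Euc n → ℝ} {v q : Euc n → Euc n}
    {O E B : Set (Euc n)} (hO : IsOpen O) (hE : IsOpen E) (hEB : E ⊆ B) (hOE : O ⊆ E)
    (hu : LocallyIntegrableOn u B) (huv : IsDistribGradOn u v E) (hs : SolOn Γ A v E)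
    (hU : ∀ y ∈ O, U y = u y) (hq : MemLp q 2 volume) (hUq : IsDistribGradOn U q univ) :
    SolOn Γ A q O := by
  rw [dg_iff] at huv hUq
  have hql : LocallyIntegrable q := hq.locallyIntegrable nz
  have hUu : ∀ ψ : Euc n → ℝ, tsupport ψ ⊆ O →
      ∫ x, U x • gradient ψ x = ∫ x, u x • gradient ψ x := fun ψ h => by
    refine integral_congr_ae (Eventually.of_forall fun x => ?_)
    beta_reduce
    by_cases hx : x ∈ tsupport ψ
    · rw [hU x (h hx)]
    · rw [gr_out hx]; simp
  by_cases hv : LocallyIntegrableOn v E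
  · refine sol_congr hOE ?_ hs
    have := hO.ae_eq_zero_of_integral_contDiff_smul_eq_zero (μ := volume) (f := fun x => v x - q x)
      ((hv.mono_set hOE).sub (hql.locallyIntegrableOn O)) fun ψ h1 h2 h3 => by
        have e1 := huv ψ h1 h2 (h3.trans hOE)
        have e2 := hUq ψ h1 h2 (subset_univ _)
        rw [hUu ψ h3, e1, neg_inj] at e2
        simp_rw [smul_sub]
        rw [integral_sub (li1 hv h1.continuous h2 (h3.trans hOE))
          (li1 (hql.locallyIntegrableOn univ) h1.continuous h2 (subset_univ _)), e2, sub_self]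
    filter_upwards [this] with y hy h
    exact sub_eq_zero.1 (hy h)
  · have hz : ∀ ψ : Euc n → ℝ, Sm ψ → HasCompactSupport ψ → tsupport ψ ⊆ E →
        ∫ x, u x • gradient ψ x = 0 := by
      intro ψ h1 h2 h3
      by_cases hi : Integrable fun x => ψ x • v x
      swap
      · rw [huv ψ h1 h2 h3, integral_undef hi, neg_zero]
      unfold LocallyIntegrableOn at hv
      push Not at hv
      obtain ⟨p, hp, hpv⟩ := hv
      obtain ⟨ρ, hρ, hρE⟩ := Metric.isOpen_iff.1 hE p hp
      set b : ContDiffBump p := ⟨ρ / 4, ρ / 2, by positivity, by linarith⟩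
      have hbE : tsupport b ⊆ E := by
        rw [b.tsupport_eq]
        exact (closedBall_subset_ball (show ρ / 2 < ρ by linarith)).trans hρE
      have hbi : ¬ Integrable fun x => b x • v x := fun h => hpv ⟨ball p (ρ / 4),
        mem_nhdsWithin_of_mem_nhds (ball_mem_nhds _ pz), by
          refine (h.integrableOn (s := ball p (ρ / 4))).congr_fun (fun y hy => ?_) measurableSet_ball
          beta_reduce
          rw [b.one_of_mem_closedBall (ball_subset_closedBall hy), one_smul]⟩
      have hbs : Sm b := b.contDiff
      have e1 := huv b hbs b.hasCompactSupport hbE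
      rw [integral_undef hbi, neg_zero] at e1
      have hts : tsupport (fun x => ψ x + b x) ⊆ E :=
        (closure_minimal (fun x hx => by
          by_contra hh
          rw [mem_union, not_or] at hh
          exact hx (by simp [image_eq_zero_of_notMem_tsupport hh.1,
            image_eq_zero_of_notMem_tsupport hh.2]))
          ((isClosed_tsupport ψ).union (isClosed_tsupport b))).trans (union_subset h3 hbE)
      have e2 := huv (fun x => ψ x + b x) (h1.add hbs) (h2.add b.hasCompactSupport) hts
      have hni : ¬ Integrable fun x => (ψ x + b x) • v x := fun h => hbi (by
        refine (h.sub hi).congr (Eventually.of_forall fun x => ?_)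
        simp [add_smul])
      rw [integral_undef hni, neg_zero] at e2
      have e3 : ∀ x, u x • gradient (fun x => ψ x + b x) x =
          u x • gradient ψ x + u x • gradient b x := fun x => by
        rw [grad_add' (hbs.differentiable (by simp) _) (h1.differentiable (by simp) _), smul_add]
      simp_rw [e3] at e2
      rw [integral_add (li2 hu (gr_cont h1) (gr_cs h2) (gr_ts.trans (h3.trans hEB)))
        (li2 hu (gr_cont hbs) (gr_cs b.hasCompactSupport) (gr_ts.trans (hbE.trans hEB))), e1,
        add_zero] at e2
      exact e2
    have := hO.ae_eq_zero_of_integral_contDiff_smul_eq_zero (μ := volume) (f := q)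
      (hql.locallyIntegrableOn O) fun ψ h1 h2 h3 => by
        have e2 := hUq ψ h1 h2 (subset_univ _)
        rw [hUu ψ h3, hz ψ h1 h2 (h3.trans hOE)] at e2
        exact neg_eq_zero.1 e2.symm
    refine sol_congr (v := fun _ => 0) (O' := O) Subset.rfl ?_ ?_
    · filter_upwards [this] with y hy h
      exact (hy h).symm
    · intro φ _ _ _
      simp

theorem U_L2 (hn : 2 ≤ n) {U : Euc n → ℝ} {q : Euc n → Euc n} (hU : LocallyIntegrable U)
    (hq : MemLp q 2 volume) (hg : IsDistribGradOn U q univ) (x : Euc n) {R : ℝ} (hR : 0 < R)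
    (h0 : ∀ y ∉ ball x R, U y = 0) : MemLp U 2 volume := by
  refine ⟨hU.aestronglyMeasurable, ?_⟩
  have hp := poinc hU hq hg x (R := 2 * R) pz
  have hfin : ∫⁻ y in ball x (2 * R), nn(q y) < ⊤ := by
    refine (lintegral_mono' Measure.restrict_le_self le_rfl).trans_lt ?_
    rw [← sqn]; exact ENNReal.pow_lt_top hq.2
  have hv : volume (ball x (2 * R) \ ball x R) ≠ 0 := by
    intro h
    have h1 : volume (ball x (2 * R)) ≤ volume (ball x R) := by
      rw [← sdiff_union_of_subset (ball_subset_ball (by linarith : R ≤ 2 * R) : ball x R ⊆ ball x (2 * R))]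
      exact (measure_union_le _ _).trans (by rw [h, zero_add])
    rw [volb x pz, volb x hR, mul_pow] at h1
    have h2 := (ENNReal.mul_le_mul_iff_right (ENNReal.coe_ne_zero.2 (omn_pos n).ne')
      ENNReal.coe_ne_top).1 h1
    rw [ofReal_le_ofReal_iff pz] at h2
    have h3 : (1:ℝ) < 2 ^ n := one_lt_pow₀ nz (by omega)
    have h4 : 0 < R ^ n := by positivity
    nlinarith
  have hlow : ∫⁻ y in ball x (2 * R), volume (ball x (2 * R) \ ball x R) * nn(U y) ≤
      ∫⁻ y in ball x (2 * R), ∫⁻ y' in ball x (2 * R), nn(U y - U y') := by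
    refine lintegral_mono fun y => ?_
    calc volume (ball x (2 * R) \ ball x R) * nn(U y) =
        ∫⁻ y' in ball x (2 * R) \ ball x R, nn(U y) := by
          rw [setLIntegral_const, mul_comm]
      _ = ∫⁻ y' in ball x (2 * R) \ ball x R, nn(U y - U y') := by
          refine setLIntegral_congr_fun (measurableSet_ball.diff measurableSet_ball) fun y' hy' => ?_
          beta_reduce
          rw [h0 y' hy'.2, sub_zero]
      _ ≤ _ := lintegral_mono_set sdiff_subset
  have h1 := (hlow.trans hp).trans_lt (ENNReal.mul_lt_top (ENNReal.mul_lt_top ofReal_lt_top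
    measure_ball_lt_top) hfin)
  rw [lintegral_const_mul'' _ (hU.aestronglyMeasurable.enorm.pow_const 2).restrict] at h1
  have h2 := ENNReal.lt_top_of_mul_ne_top_right h1.ne hv
  have h3 : ∫⁻ y, nn(U y) < ⊤ := by
    rw [← setLIntegral_eq_of_support_subset (s := ball x (2 * R))]
    · exact h2
    · intro y hy
      by_contra h
      exact hy (by simp [h0 y fun h' => h (ball_subset_ball lz h')])
  rw [← sqn] at h3
  by_contra h
  rw [not_lt, top_le_iff] at h
  rw [h] at h3; simp at h3

theorem Geo.reduce (g : Geo n d Ca Γ) {A : Euc n → Euc n →L[ℝ] Euc n} {x : Euc n} (hx : x ∈ Γ)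
    {r r' : ℝ} (hr' : 0 < r') (hr : r' < r) {u : Euc n → ℝ} {v : Euc n → Euc n}
    (hu : MemWrOn n d Γ (ball x r) u) (huv : IsDistribGradOn u v (ball x r \ Γ))
    (hs : SolOn Γ A v (ball x r \ Γ)) :
    ∃ U q, Good n d Γ A (ball x r' \ Γ) U q ∧ ∀ y ∈ ball x r', U y = u y := by
  set b : ContDiffBump x := ⟨r', (r' + r) / 2, hr', by linarith⟩
  have hbr : tsupport b ⊆ ball x r := by
    rw [b.tsupport_eq]
    exact closedBall_subset_ball (show (r' + r) / 2 < r by linarith)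
  obtain ⟨q, hq⟩ := hu.2 b b.contDiff b.hasCompactSupport hbr
  have hUi : Integrable fun y => b y * u y := li1 hu.1 b.continuous b.hasCompactSupport hbr
  have hUl := hUi.locallyIntegrable
  have hΓ : (volume : Measure (Euc n)).restrict Γᶜ = volume :=
    Measure.restrict_eq_self_of_ae_mem g.aeO
  have hqm : AEStronglyMeasurable q volume := by
    have := hq.gradLocInt.aestronglyMeasurable
    rwa [hΓ] at this
  have hmΓ : (measW n d Γ).restrict Γᶜ = measW n d Γ :=
    Measure.restrict_eq_self_of_ae_mem (mW_ac.ae_le g.aeO)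
  have hqW : ∫⁻ y, nn(q y) ∂(measW n d Γ) < ⊤ := by
    have := hq.l2
    rw [hmΓ] at this
    simpa only [ofReal_pow (norm_nonneg _), ofReal_norm] using this
  have hq0 : ∀ᵐ y, y ∉ ball x r → q y = 0 := by
    have := (g.cl.isOpen_compl.inter (isClosed_tsupport b).isOpen_compl).ae_eq_zero_of_integral_contDiff_smul_eq_zero
      (μ := volume) (f := q) (hq.gradLocInt.mono_set inter_subset_left) fun ψ h1 h2 h3 => by
        have e := dg_iff.1 hq.isGrad ψ h1 h2 (h3.trans inter_subset_left)
        rw [integral_eq_zero_of_ae (Eventually.of_forall fun y => ?_)] at e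
        · exact neg_eq_zero.1 e.symm
        · by_cases hy : y ∈ tsupport ψ
          · have := (h3 hy).2
            simp [image_eq_zero_of_notMem_tsupport this]
          · simp [gr_out hy]
    filter_upwards [this, g.aeO] with y hy hyΓ hyb
    exact hy ⟨hyΓ, fun h => hyb (hbr h)⟩
  have hr0 : 0 < r := by linarith
  have hq2 : MemLp q 2 volume := by
    refine ⟨hqm, ?_⟩
    have h1 : ofReal (r ^ (d + 1 - (n:ℝ))) * ∫⁻ y, nn(q y) ≤
        ∫⁻ y, nn(q y) ∂(measW n d Γ) := by
      have := lmW (d := d) (Γ := Γ) (hqm.enorm.pow_const 2) univ MeasurableSet.univ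
      rw [Measure.restrict_univ, Measure.restrict_univ] at this
      rw [this, ← lintegral_const_mul' _ _ ofReal_ne_top]
      refine lintegral_mono_ae ?_
      filter_upwards [hq0, g.aeO] with y hy hyΓ
      by_cases hyb : y ∈ ball x r
      · gcongr
        exact g.w_ge hyΓ ((infDist_le_dist_of_mem hx).trans (le_of_lt hyb))
      · simp [hy hyb]
    have h2 := h1.trans_lt hqW
    have h3 := ENNReal.lt_top_of_mul_ne_top_right h2.ne (by
      rw [Ne, ofReal_eq_zero, not_le]; positivity)
    rw [← sqn] at h3
    by_contra h
    rw [not_lt, top_le_iff] at h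
    rw [h] at h3; simp at h3
  have hgr := g.remov hUl hq2 hq.isGrad
  have hUu : ∀ y ∈ ball x r', b y * u y = u y := fun y hy => by
    rw [b.one_of_mem_closedBall (ball_subset_closedBall hy), one_mul]
  refine ⟨_, q, ⟨U_L2 g.hn hUl hq2 hgr x hr0 fun y hy => ?_, hq2, hqW, hgr, ?_⟩, hUu⟩
  · rw [image_eq_zero_of_notMem_tsupport fun h => hy (hbr h), zero_mul]
  · refine sol_red (E := ball x r \ Γ) (B := ball x r) (isOpen_ball.sdiff g.cl) (isOpen_ball.sdiff g.cl)
      sdiff_subset (sdiff_subset_sdiff_left (ball_subset_ball hr.le)) hu.1 huv hs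
      (fun y hy => hUu y hy.1) hq2 hgr
end

section
variable {n : ℕ} {d Ca : ℝ} {Γ : Set (Euc n)}

theorem avg_cs {U : Euc n → ℝ} (hU : LocallyIntegrable U) (z : Euc n) {ρ : ℝ} (hρ : 0 < ρ) (c : ℝ) :
    volume (ball z ρ) * nn((⨍ y in ball z ρ, U y) - c) ≤ ∫⁻ y in ball z ρ, nn(U y - c) := by
  set B := ball z ρ
  have hv0 : volume B ≠ 0 := (measure_ball_pos _ _ hρ).ne'
  have hv1 : volume B ≠ ⊤ := measure_ball_lt_top.ne
  have hi : IntegrableOn U B :=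
    (hU.integrableOn_isCompact (isCompact_closedBall z ρ)).mono_set ball_subset_closedBall
  have hc : IntegrableOn (fun _ : Euc n => c) B := integrableOn_const hv1
  have e : ∫ y in B, (U y - c) = volume.real B * ((⨍ y in B, U y) - c) := by
    rw [integral_sub hi hc, setAverage_eq, setIntegral_const, smul_eq_mul, smul_eq_mul, mul_sub,
      mul_inv_cancel_left₀]
    exact (ENNReal.toReal_pos hv0 hv1).ne'
  have h1 : volume B * ‖(⨍ y in B, U y) - c‖ₑ ≤ ∫⁻ y in B, ‖U y - c‖ₑ := by
    have := enorm_integral_le_lintegral_enorm (μ := volume.restrict B) fun y => U y - c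
    rw [e, enorm_mul] at this
    convert this using 2
    rw [Real.enorm_of_nonneg pz, measureReal_def, ofReal_toReal hv1]
  have h2 : (∫⁻ y in B, ‖U y - c‖ₑ) ^ 2 ≤ (∫⁻ y in B, nn(U y - c)) * volume B := by
    have := cs_lint (volume.restrict B) (f := fun y => ‖U y - c‖ₑ) (g := fun _ => 1)
      ((hU.aestronglyMeasurable.sub aestronglyMeasurable_const).enorm.restrict) aemeasurable_const
    simpa using this
  have h3 := (pow_le_pow_left' h1 2).trans h2
  rw [mul_pow, sq (volume B), mul_assoc, mul_comm _ (volume B)] at h3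
  rwa [ENNReal.mul_le_mul_iff_right hv0 hv1] at h3

theorem avg2 {U : Euc n → ℝ} (hU : LocallyIntegrable U) (z : Euc n) {ρ : ℝ} (hρ : 0 < ρ) (y : Euc n) :
    volume (ball z ρ) * nn(U y - ⨍ y' in ball z ρ, U y') ≤
      ∫⁻ y' in ball z ρ, nn(U y - U y') := by
  have := avg_cs hU z hρ (U y)
  rw [enorm_sub_rev] at this
  simpa only [enorm_sub_rev] using this

/-- dyadic difference bound -/
def DD (q : Euc n → Euc n) (z : Euc n) (ρ : ℝ) : ℝ≥0∞ :=
  (volume (ball z ρ))⁻¹ * (ofReal (2 ^ (2 * n + 3) * ρ ^ 2) * ∫⁻ y in ball z ρ, nn(q y))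

theorem dd1 {U : Euc n → ℝ} {q : Euc n → Euc n} (hU : LocallyIntegrable U)
    (hq : MemLp q 2 volume) (hg : IsDistribGradOn U q univ) (z : Euc n) {ρ : ℝ} (hρ : 0 < ρ) :
    2 ^ n * ∫⁻ y in ball z ρ, nn(U y - ⨍ y' in ball z ρ, U y') ≤ volume (ball z ρ) * DD q z ρ := by
  have hv0 : volume (ball z ρ) ≠ 0 := (measure_ball_pos _ _ hρ).ne'
  have hv1 : volume (ball z ρ) ≠ ⊤ := measure_ball_lt_top.ne
  rw [DD, ENNReal.mul_inv_cancel_left hv0 hv1]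
  have h1 : volume (ball z ρ) * ∫⁻ y in ball z ρ, nn(U y - ⨍ y' in ball z ρ, U y') ≤
      volume (ball z ρ) * (ofReal (2 ^ (n + 3) * ρ ^ 2) * ∫⁻ y in ball z ρ, nn(q y)) := by
    rw [← lintegral_const_mul' _ _ hv1]
    refine (lintegral_mono fun y => avg2 hU z hρ y).trans ((poinc hU hq hg z hρ).trans (le_of_eq ?_))
    ring
  rw [ENNReal.mul_le_mul_iff_right hv0 hv1] at h1
  refine (mul_le_mul_right h1 _).trans (le_of_eq ?_)
  rw [← mul_assoc, show (2:ℝ≥0∞) ^ n = ofReal (2 ^ n) by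
    rw [ofReal_pow nz]; simp, ← ofReal_mul pz]
  congr 2; ring

theorem dd2 {U : Euc n → ℝ} {q : Euc n → Euc n} (hU : LocallyIntegrable U)
    (hq : MemLp q 2 volume) (hg : IsDistribGradOn U q univ) (z : Euc n) {ρ : ℝ} (hρ : 0 < ρ) :
    nn((⨍ y in ball z ρ, U y) - ⨍ y in ball z (ρ / 2), U y) ≤ DD q z ρ := by
  have hv0 : volume (ball z ρ) ≠ 0 := (measure_ball_pos _ _ hρ).ne'
  have hv1 : volume (ball z ρ) ≠ ⊤ := measure_ball_lt_top.ne
  have h1 := avg_cs hU z (half_pos hρ) (⨍ y in ball z ρ, U y)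
  have h2 : volume (ball z ρ) = 2 ^ n * volume (ball z (ρ / 2)) := by
    rw [volb z hρ, volb z (half_pos hρ), mul_left_comm, show (2:ℝ≥0∞) ^ n = ofReal (2 ^ n) by
      rw [ofReal_pow nz]; simp, ← ofReal_mul pz, ← mul_pow]
    congr 3; ring
  rw [← ENNReal.mul_le_mul_iff_right hv0 hv1]
  refine le_trans ?_ (dd1 hU hq hg z hρ)
  rw [h2, mul_assoc, enorm_sub_rev]
  gcongr
  exact h1.trans (lintegral_mono_set (ball_subset_ball lz))

theorem sq_split (a b : ℝ≥0∞) : (a + b) ^ 2 ≤ 3 * a ^ 2 + 3 / 2 * b ^ 2 := by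
  rcases eq_or_ne a ⊤ with rfl | ha
  · simp
  rcases eq_or_ne b ⊤ with rfl | hb
  · rw [show ((⊤:ℝ≥0∞)) ^ 2 = ⊤ by simp, ENNReal.mul_top (by simp)]; simp
  lift a to ℝ≥0 using ha
  lift b to ℝ≥0 using hb
  rw [show (3:ℝ≥0∞) / 2 = ((3 / 2 : ℝ≥0) : ℝ≥0∞) by
    rw [ENNReal.coe_div nz]; norm_num]
  norm_cast
  rw [← NNReal.coe_le_coe]
  push_cast
  nlinarith [sq_nonneg (2 * (a:ℝ) - b)]

/-- trace error -/
def EE (q : Euc n → Euc n) (ρ : ℝ) (z : Euc n) : ℝ≥0∞ :=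
  ∑' j : ℕ, 3 * (3 / 2) ^ j * DD q z (ρ / 2 ^ j)

theorem ee1 {U : Euc n → ℝ} {q : Euc n → Euc n} (hU : LocallyIntegrable U)
    (hq : MemLp q 2 volume) (hg : IsDistribGradOn U q univ) (z : Euc n) {ρ : ℝ} (hρ : 0 < ρ) {τ : ℝ}
    (ht : HasTraceAt U z τ) : nn((⨍ y in ball z ρ, U y) - τ) ≤ EE q ρ z := by
  have key : ∀ J : ℕ, ∀ ρ : ℝ, 0 < ρ → nn((⨍ y in ball z ρ, U y) - ⨍ y in ball z (ρ / 2 ^ J), U y) ≤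
      ∑ j ∈ Finset.range J, 3 * (3 / 2) ^ j * DD q z (ρ / 2 ^ j) := by
    intro J
    induction J with
    | zero => intro ρ _; simp
    | succ J ih =>
      intro ρ hρ
      have h1 := ih (ρ / 2) pz
      rw [Finset.sum_range_succ', ← sub_add_sub_cancel _ (⨍ y in ball z (ρ / 2), U y)]
      refine (pow_le_pow_left' (enorm_add_le _ _) 2).trans ((sq_split _ _).trans ?_)
      rw [add_comm]
      refine add_le_add ?_ ?_
      · rw [show ρ / 2 ^ (J + 1) = ρ / 2 / 2 ^ J by rw [pow_succ]; field_simp]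
        refine (mul_le_mul_right h1 _).trans (le_of_eq ?_)
        rw [Finset.mul_sum]
        refine Finset.sum_congr rfl fun j _ => ?_
        rw [show ρ / 2 ^ (j + 1) = ρ / 2 / 2 ^ j by rw [pow_succ]; field_simp, pow_succ]
        ring
      · simp only [pow_zero, mul_one, div_one]
        gcongr
        exact dd2 hU hq hg z hρ
  have hl : Tendsto (fun J : ℕ => ρ / 2 ^ J) atTop (𝓝[>] 0) := by
    refine tendsto_nhdsWithin_iff.2 ⟨?_, Eventually.of_forall fun J => by
      simp only [mem_Ioi]; positivity⟩
    have := (tendsto_pow_atTop_nhds_zero_of_lt_one (r := (1/2:ℝ)) nz nz).const_mul ρ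
    rw [mul_zero] at this
    refine this.congr fun J => ?_
    rw [one_div, inv_pow]; rfl
  have h2 := ((tendsto_const_nhds (x := ⨍ y in ball z ρ, U y)).sub (ht.comp hl)).enorm
  have h3 := (ENNReal.continuous_pow 2).continuousAt.tendsto.comp h2
  refine le_of_tendsto h3 (Eventually.of_forall fun J => ?_)
  exact (key J ρ hρ).trans (ENNReal.sum_le_tsum _)

theorem ee2 {U : Euc n → ℝ} {q : Euc n → Euc n} (hU : LocallyIntegrable U)
    (hq : MemLp q 2 volume) (hg : IsDistribGradOn U q univ) (z : Euc n) {ρ : ℝ} (hρ : 0 < ρ) {τ : ℝ}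
    (ht : HasTraceAt U z τ) :
    ∫⁻ y in ball z ρ, nn(U y - τ) ≤ 4 * volume (ball z ρ) * EE q ρ z := by
  have h1 := ee1 hU hq hg z hρ ht
  have h2 : ∫⁻ y in ball z ρ, nn(U y - ⨍ y' in ball z ρ, U y') ≤ volume (ball z ρ) * EE q ρ z := by
    calc _ ≤ 2 ^ n * ∫⁻ y in ball z ρ, nn(U y - ⨍ y' in ball z ρ, U y') :=
          le_mul_of_one_le_left zero_le (one_le_pow₀ nz)
      _ ≤ _ := dd1 hU hq hg z hρ
      _ ≤ _ := by
        gcongr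
        refine le_trans ?_ (ENNReal.le_tsum 0)
        simp only [pow_zero, mul_one, div_one]
        exact le_mul_of_one_le_left zero_le nz
  calc _ ≤ ∫⁻ y in ball z ρ, (2 * nn(U y - ⨍ y' in ball z ρ, U y') +
        2 * nn((⨍ y' in ball z ρ, U y') - τ)) := by
        refine lintegral_mono fun y => ?_
        rw [← sub_add_sub_cancel (U y) (⨍ y' in ball z ρ, U y') τ]
        exact enorm_add_sq_le _ _
    _ = (2 * ∫⁻ y in ball z ρ, nn(U y - ⨍ y' in ball z ρ, U y')) +
        2 * nn((⨍ y' in ball z ρ, U y') - τ) * volume (ball z ρ) := by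
        rw [lintegral_add_right _ measurable_const, lintegral_const_mul' _ _ nz,
          setLIntegral_const]
    _ ≤ 2 * (volume (ball z ρ) * EE q ρ z) + 2 * EE q ρ z * volume (ball z ρ) := by gcongr
    _ = _ := by ring

theorem Geo.ee3 (n : ℕ) (d Ca : ℝ) : ∃ C : ℝ≥0, ∀ Γ : Set (Euc n), Geo n d Ca Γ →
    ∀ q : Euc n → Euc n, AEStronglyMeasurable q volume → ∀ x R ρ, 0 < ρ →
    ∫⁻ z, EE q ρ z ∂(sg d Γ x R) ≤ C * ofReal ρ *
      ∫⁻ y in {y | infDist y Γ < ρ} ∩ ball x (R + ρ), nn(q y) ∂(measW n d Γ) := by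
  set K : ℝ := ((omn n : ℝ))⁻¹ * 2 ^ (2 * n + 3) * Ca * 2 ^ d with hK
  refine ⟨(ofReal K).toNNReal * 12, fun Γ g q hq x R ρ hρ => ?_⟩
  have hC : 0 < Ca := by linarith [g.hC]
  have ho : 0 < (omn n : ℝ) := omn_pos n
  rw [ENNReal.coe_mul, ENNReal.coe_toNNReal ofReal_ne_top]
  set e := ∫⁻ y in {y | infDist y Γ < ρ} ∩ ball x (R + ρ), nn(q y) ∂(measW n d Γ)
  have hqm : AEMeasurable (fun y => nn(q y)) := hq.enorm.pow_const 2
  have hD : ∀ s, 0 < s → s ≤ ρ → ∫⁻ z, DD q z s ∂(sg d Γ x R) ≤ ofReal (K * s) * e := by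
    intro s hs hsρ
    have hm : MeasurableSet ({y | infDist y Γ < s} ∩ ball x (R + s)) :=
      (measurableSet_lt (by fun_prop) measurable_const).inter measurableSet_ball
    have e1 : ∀ z, DD q z s = ofReal ((omn n * s ^ n)⁻¹ * (2 ^ (2 * n + 3) * s ^ 2)) *
        ∫⁻ y in ball z s, nn(q y) := fun z => by
      rw [DD, volb z hs, ← mul_assoc, ofReal_mul (p := (omn n * s ^ n)⁻¹) pz,
        ofReal_inv_of_pos pz, ofReal_mul ho.le,
        ofReal_coe_nnreal]
    simp_rw [e1]
    rw [lintegral_const_mul' _ _ ofReal_ne_top]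
    have h2 := g.T2 x hs hqm (R := R)
    have h3 : ofReal (s ^ (d + 1 - (n:ℝ))) *
        ∫⁻ y in {y | infDist y Γ < s} ∩ ball x (R + s), nn(q y) ≤ e := by
      refine le_trans ?_ (lintegral_mono_set (s := {y | infDist y Γ < s} ∩ ball x (R + s)) ?_)
      · rw [lmW hqm _ hm, ← lintegral_const_mul' _ _ ofReal_ne_top]
        refine lintegral_mono_ae ?_
        filter_upwards [ae_restrict_of_ae g.aeO, ae_restrict_mem hm] with y hy hy2
        gcongr
        exact g.w_ge hy (le_of_lt hy2.1)
      · rintro y ⟨h1, h2⟩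
        exact ⟨lt_of_lt_of_le h1 hsρ, ball_subset_ball lz h2⟩
    have h4 := ofr_cancel pz h3
    refine (mul_le_mul_right (h2.trans (mul_le_mul_right h4 _)) _).trans (le_of_eq ?_)
    rw [← mul_assoc, ← mul_assoc, ← ofReal_mul pz,
      ← ofReal_mul pz]
    congr 2
    rw [Real.mul_rpow nz hs.le, Real.rpow_sub hs, Real.rpow_add hs, Real.rpow_natCast,
      Real.rpow_one]
    simp only [hK]
    field_simp
  have hDm : ∀ s, 0 < s → AEMeasurable (fun z => DD q z s) (sg d Γ x R) := fun s hs => by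
    have := g.sgf x R
    have hm : AEMeasurable (Function.uncurry fun z y => (ball z s).indicator (fun y => nn(q y)) y)
        ((sg d Γ x R).prod volume) := by
      have : (Function.uncurry fun z y => (ball z s).indicator (fun y => nn(q y)) y) =
        {p : Euc n × Euc n | dist p.2 p.1 < s}.indicator fun p => nn(q p.2) := by
        ext p; simp [indicator, Function.uncurry]
      rw [this]
      exact (hqm.comp_snd).indicator (measurableSet_lt (by fun_prop) measurable_const)
    have h2 := hm.lintegral_prod_right'
    have h3 : (fun z => ∫⁻ y in ball z s, nn(q y)) =
        fun z => ∫⁻ y, (ball z s).indicator (fun y => nn(q y)) y := by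
      ext z; rw [lintegral_indicator measurableSet_ball]
    unfold DD
    simp_rw [volb _ hs]
    refine AEMeasurable.const_mul (AEMeasurable.const_mul ?_ _) _
    rw [h3]; exact h2
  unfold EE
  rw [lintegral_tsum fun j => (hDm _ pz).const_mul _]
  calc _ ≤ ∑' j : ℕ, 3 * (ofReal (K * ρ) * e) * (3 / 4) ^ j := by
        refine ENNReal.tsum_le_tsum fun j => ?_
        rw [lintegral_const_mul'' _ (hDm _ pz)]
        refine (mul_le_mul_right (hD (ρ / 2 ^ j) pz
          (div_le_self hρ.le (one_le_pow₀ nz))) _).trans (le_of_eq ?_)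
        have h34 : ((3:ℝ≥0∞) / 4) ^ j = (3 / 2) ^ j * ofReal ((2 ^ j)⁻¹) := by
          rw [ofReal_inv_of_pos pz, ofReal_pow nz,
            ENNReal.inv_pow, ← mul_pow]
          congr 1
          rw [ofReal_ofNat, div_eq_mul_inv, div_eq_mul_inv, mul_assoc,
            ← ENNReal.mul_inv (by simp) (by simp)]
          norm_num
        rw [h34, show K * (ρ / 2 ^ j) = K * ρ * (2 ^ j)⁻¹ by ring,
          ofReal_mul (p := K * ρ) pz]
        ring
    _ = _ := by
        rw [ENNReal.tsum_mul_left, ENNReal.tsum_geometric,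
          show (1 - 3 / 4 : ℝ≥0∞)⁻¹ = 4 by
            rw [show (1:ℝ≥0∞) - 3 / 4 = 1 / 4 from by
              refine ENNReal.sub_eq_of_eq_add (by finiteness) ?_
              rw [ENNReal.div_add_div_same]; norm_num; rw [ENNReal.div_self] <;> simp]
            simp, ofReal_mul pz]
        push_cast; ring

theorem Geo.layer (n : ℕ) (d Ca : ℝ) : ∃ C : ℝ≥0, ∀ Γ : Set (Euc n), Geo n d Ca Γ →
    ∀ (U : Euc n → ℝ) (q : Euc n → Euc n), LocallyIntegrable U → MemLp q 2 volume →
    IsDistribGradOn U q univ → ∀ (x : Euc n) (R ρ k : ℝ), 0 < ρ →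
    (∀ᵐ z ∂(sg d Γ x (R + 2 * ρ)), ∃ τ ≤ k, HasTraceAt U z τ) →
    ∫⁻ y in {y | infDist y Γ < ρ} ∩ ball x R, nn(max (U y - k) 0) ≤
      C * ofReal (ρ ^ ((n:ℝ) - d + 1)) *
      ∫⁻ y in {y | infDist y Γ < 2 * ρ} ∩ ball x (R + 4 * ρ), nn(q y) ∂(measW n d Γ) := by
  obtain ⟨C, hC⟩ := Geo.ee3 n d Ca
  refine ⟨(ofReal (4 * omn n * 2 ^ (n + 1) * Ca)).toNNReal * C,
    fun Γ g U q hU hq hg x R ρ k hρ ht => ?_⟩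
  have hC0 : 0 < Ca := by linarith [g.hC]
  rw [ENNReal.coe_mul, ENNReal.coe_toNNReal ofReal_ne_top]
  have hm : MeasurableSet ({y | infDist y Γ < ρ} ∩ ball x R) :=
    (measurableSet_lt (by fun_prop) measurable_const).inter measurableSet_ball
  have hG : AEMeasurable (fun y => nn(max (U y - k) 0)) :=
    ((hU.aestronglyMeasurable.aemeasurable.sub_const k).max aemeasurable_const).enorm.pow_const 2
  have h1 := g.T1 x (subset_refl _) hm hG
  have h3 := hC Γ g q hq.1 x (R + 2 * ρ) (2 * ρ) pz
  have h2 : ∫⁻ z, (∫⁻ y in ball z (2 * ρ), ({y | infDist y Γ < ρ} ∩ ball x R).indicator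
      (fun y => nn(max (U y - k) 0)) y) ∂(sg d Γ x (R + 2 * ρ)) ≤
      ∫⁻ z, 4 * (omn n * ofReal ((2 * ρ) ^ n)) * EE q (2 * ρ) z ∂(sg d Γ x (R + 2 * ρ)) := by
    refine lintegral_mono_ae ?_
    filter_upwards [ht] with z hz
    obtain ⟨τ, hτ, hz⟩ := hz
    rw [← volb z pz]
    refine le_trans (lintegral_mono fun y => ?_) (ee2 hU hq hg z pz hz)
    refine (indicator_le_self _ _ _).trans ?_
    gcongr
    rw [Real.enorm_eq_ofReal_abs, Real.enorm_eq_ofReal_abs]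
    apply ofReal_le_ofReal
    rw [abs_of_nonneg (le_max_right _ _)]
    exact max_le ((by linarith : U y - k ≤ U y - τ).trans (le_abs_self _)) (abs_nonneg _)
  rw [lintegral_const_mul' _ _ (by finiteness)] at h2
  have h4 := ofr_cancel pz (h1.trans (h2.trans (mul_le_mul_right h3 _)))
  refine h4.trans (le_of_eq ?_)
  rw [show R + 2 * ρ + 2 * ρ = R + 4 * ρ by ring]
  set e := ∫⁻ y in {y | infDist y Γ < 2 * ρ} ∩ ball x (R + 4 * ρ), nn(q y) ∂(measW n d Γ)
  have : ofReal (Ca⁻¹ * ρ ^ d)⁻¹ * (4 * (↑(omn n) * ofReal ((2 * ρ) ^ n)) *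
      (ofReal (2 * ρ))) = ofReal (4 * omn n * 2 ^ (n + 1) * Ca) *
        ofReal (ρ ^ ((n:ℝ) - d + 1)) := by
    rw [← ofReal_coe_nnreal, show (4:ℝ≥0∞) = ofReal 4 by simp,
      ← ofReal_mul pz, ← ofReal_mul pz,
      ← ofReal_mul pz, ← ofReal_mul pz,
      ← ofReal_mul pz]
    congr 1
    rw [Real.rpow_add hρ, Real.rpow_sub hρ, Real.rpow_natCast, Real.rpow_one, mul_pow]
    field_simp
    ring
  calc _ = (ofReal (Ca⁻¹ * ρ ^ d)⁻¹ * (4 * (↑(omn n) * ofReal ((2 * ρ) ^ n)) *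
      (ofReal (2 * ρ)))) * C * e := by ring
    _ = _ := by rw [this]; ring

end

section
variable {n : ℕ} {d Ca : ℝ} {Γ : Set (Euc n)}

theorem laym (Γ : Set (Euc n)) (ρ R : ℝ) (x : Euc n) :
    MeasurableSet ({y | infDist y Γ < ρ} ∩ ball x R) :=
  (measurableSet_lt (by fun_prop) measurable_const).inter measurableSet_ball

theorem Geo.lay2 (n : ℕ) (d Ca : ℝ) (hdn : d < (n:ℝ) - 1) : ∃ C : ℝ≥0, ∀ Γ : Set (Euc n), Geo n d Ca Γ →
    ∀ (U : Euc n → ℝ) (q : Euc n → Euc n), LocallyIntegrable U → MemLp q 2 volume →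
    IsDistribGradOn U q univ → ∀ (x : Euc n) (R ρ k : ℝ), 0 < ρ →
    (∀ᵐ z ∂(sg d Γ x (R + 2 * ρ)), ∃ τ ≤ k, HasTraceAt U z τ) →
    ∫⁻ y in {y | infDist y Γ < ρ} ∩ ball x R, nn(max (U y - k) 0) ∂(measW n d Γ) ≤
      C * ofReal (ρ ^ 2) *
      ∫⁻ y in {y | infDist y Γ < 2 * ρ} ∩ ball x (R + 4 * ρ), nn(q y) ∂(measW n d Γ) := by
  obtain ⟨C, hC⟩ := Geo.layer n d Ca
  obtain ⟨C', hC'⟩ := layer_lo ((n:ℝ) - d + 1) ((n:ℝ) - 1 - d) lz lz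
  refine ⟨C' * C, fun Γ g U q hU hq hg x R ρ k hρ ht => ?_⟩
  set e := ∫⁻ y in {y | infDist y Γ < 2 * ρ} ∩ ball x (R + 4 * ρ), nn(q y) ∂(measW n d Γ)
  set G : Euc n → ℝ≥0∞ := fun y => nn(max (U y - k) 0) with hGd
  have hG : AEMeasurable G :=
    ((hU.aestronglyMeasurable.aemeasurable.sub_const k).max aemeasurable_const).enorm.pow_const 2
  set ν := (volume.restrict (ball x R)).withDensity G with hν
  have hms : ∀ t, MeasurableSet {y : Euc n | infDist y Γ < t} := fun t =>
    measurableSet_lt (by fun_prop) measurable_const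
  have hms2 : MeasurableSet {y : Euc n | 0 < infDist y Γ ∧ infDist y Γ < ρ} :=
    ((measurableSet_lt measurable_const (g := fun y => infDist y Γ) (by fun_prop)).inter (hms ρ):)
  have h := hC' ν (fun y => infDist y Γ) (by fun_prop) (C * e) ρ hρ ?_
  · refine le_trans ?_ (h.trans (le_of_eq ?_))
    · rw [lmW hG _ (laym _ _ _ _), hν, restrict_withDensity hms2,
        lintegral_withDensity_eq_lintegral_mul₀ hG.restrict.restrict (by fun_prop),
        Measure.restrict_restrict hms2]
      rw [Measure.restrict_congr_set (t := {y | 0 < infDist y Γ ∧ infDist y Γ < ρ} ∩ ball x R)]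
      · refine le_of_eq (lintegral_congr fun y => ?_)
        simp only [Pi.mul_apply]
        rw [mul_comm, weightW]; congr 3; ring
      · rw [eventuallyEq_set]
        filter_upwards [g.aeO] with y hy
        have := g.pos hy
        simp [this]
    · rw [ENNReal.coe_mul, show (n:ℝ) - d + 1 - ((n:ℝ) - 1 - d) = ((2:ℕ):ℝ) by push_cast; ring,
        Real.rpow_natCast]; ring
  · intro t ht0 htρ
    rw [hν, withDensity_apply _ (hms _), Measure.restrict_restrict (hms _)]
    have hl := hC Γ g U q hU hq hg x R t k ht0 ?_
    · refine hl.trans ?_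
      rw [mul_right_comm]
      refine mul_le_mul' (mul_le_mul' le_rfl (lintegral_mono_set ?_)) le_rfl
      rintro y ⟨h1, h2⟩
      exact ⟨lt_of_lt_of_le h1 (show 2 * t ≤ 2 * ρ by linarith), ball_subset_ball lz h2⟩
    · refine ae_mono (Measure.restrict_mono ?_ le_rfl) ht
      exact inter_subset_inter_right _ (ball_subset_ball lz)

theorem prodg {V : Euc n → ℝ} {p : Euc n → Euc n} (hV : LocallyIntegrable V)
    (hp : LocallyIntegrable p) (hg : IsDistribGradOn V p univ) {η : Euc n → ℝ}
    (hη : Sm η) :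
    IsDistribGradOn (fun y => η y * V y) (fun y => V y • gradient η y + η y • p y) univ := by
  rw [dg_iff] at hg ⊢
  intro φ hφ hc _
  have h := hg (fun y => η y * φ y) (hη.mul hφ) hc.mul_left (subset_univ _)
  have e : ∀ y, V y • gradient (fun y => η y * φ y) y =
      (η y * V y) • gradient φ y + φ y • V y • gradient η y := fun y => by
    rw [grad_mul (hφ.differentiable (by simp) _) (hη.differentiable (by simp) _)]
    module
  simp_rw [e] at h
  have i1 : Integrable fun y => (η y * V y) • gradient φ y := by
    have := li2 (φ := fun y => η y • gradient φ y) (hV.locallyIntegrableOn univ)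
      (hη.continuous.smul (gr_cont hφ)) ((gr_cs hc).smul_left (f := η)) (subset_univ _)
    refine this.congr (Eventually.of_forall fun y => ?_)
    module
  have i2 : Integrable fun y => φ y • V y • gradient η y := by
    have := li2 (φ := fun y => φ y • gradient η y) (hV.locallyIntegrableOn univ)
      (hφ.continuous.smul (gr_cont hη)) (hc.smul_right (f' := gradient η)) (subset_univ _)
    refine this.congr (Eventually.of_forall fun y => ?_)
    module
  have i3 : Integrable fun y => φ y • η y • p y := by
    have := li1 (φ := fun y => φ y * η y) (hp.locallyIntegrableOn univ)
      (hφ.continuous.mul hη.continuous) (hc.mul_right (f' := η)) (subset_univ _)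
    refine this.congr (Eventually.of_forall fun y => ?_)
    module
  rw [integral_add i1 i2] at h
  simp_rw [smul_add]
  rw [integral_add i2 i3]
  have e3 : ∫ x, (η x * φ x) • p x = ∫ y, φ y • η y • p y :=
    integral_congr_ae (Eventually.of_forall fun y => by beta_reduce; module)
  rw [e3] at h
  rw [neg_add, ← h]; abel

/-- approximable by smooth functions supported in `V \ Γ` -/
def InH0 (n : ℕ) (d : ℝ) (Γ V : Set (Euc n)) (f : Euc n → ℝ) (p : Euc n → Euc n) : Prop :=
  ∀ ε : ℝ≥0∞, 0 < ε → ∃ φ : Euc n → ℝ, Sm φ ∧ HasCompactSupport φ ∧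
    tsupport φ ⊆ V \ Γ ∧ ∫⁻ y, nn(φ y - f y) ∂(measW n d Γ) ≤ ε ∧
    ∫⁻ y, nn(gradient φ y - p y) ∂(measW n d Γ) ≤ ε

theorem moll_out {F : Type*} [NormedAddCommGroup F] [NormedSpace ℝ F] {ρ : ContDiffBump (0 : Euc n)}
    {f : Euc n → F} {K : Set (Euc n)} (hf : ∀ y ∉ K, f y = 0) {x : Euc n}
    (hx : x ∉ cthickening ρ.rOut K) : moll ρ f x = 0 := by
  unfold moll
  rw [convolution_def]
  refine integral_eq_zero_of_ae (Eventually.of_forall fun t => ?_)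
  by_cases ht : t ∈ ball (0 : Euc n) ρ.rOut
  · have : x - t ∉ K := fun h => hx (mem_cthickening_of_dist_le _ _ _ _ h (by
      simp [dist_eq_norm] at ht ⊢; exact ht.le))
    simp [hf _ this]
  · have : ρ.normed volume t = 0 := by
      rw [← ρ.support_normed_eq (μ := volume)] at ht
      simpa using ht
    simp [this]

theorem Geo.h0cpt (g : Geo n d Ca Γ) {V : Set (Euc n)} (hV : IsOpen V) {f : Euc n → ℝ}
    {p : Euc n → Euc n} (hf : MemLp f 2 volume) (hp : MemLp p 2 volume)
    (hg : IsDistribGradOn f p univ) {K : Set (Euc n)} (hK : IsCompact K) (hKV : K ⊆ V \ Γ)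
    (hf0 : ∀ y ∉ K, f y = 0) (hp0 : ∀ y ∉ K, p y = 0) : InH0 n d Γ V f p := by
  intro ε hε
  obtain ⟨η, hη, hηO⟩ := hK.exists_cthickening_subset_open (hV.sdiff g.cl) hKV
  have hfl : LocallyIntegrable f := hf.locallyIntegrable nz
  have hpl : LocallyIntegrable p := hp.locallyIntegrable nz
  set K' := cthickening η K
  have hK' : IsCompact K' := hK.cthickening
  obtain ⟨c, hc, hcK⟩ : ∃ c, 0 < c ∧ ∀ y ∈ K', c ≤ infDist y Γ := by
    rcases K'.eq_empty_or_nonempty with h | h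
    · exact ⟨1, one_pos, by simp [h]⟩
    · obtain ⟨y, hy, hm⟩ := hK'.exists_isMinOn h (f := fun y => infDist y Γ) (by fun_prop)
      exact ⟨_, g.pos (hηO hy).2, fun z hz => hm hz⟩
  set W := ofReal (c ^ (d + 1 - (n:ℝ)))
  have key : ∀ {F : Type} [NormedAddCommGroup F] (h : Euc n → F), AEStronglyMeasurable h volume →
      (∀ y ∉ K', h y = 0) → ∫⁻ y, nn(h y) ∂(measW n d Γ) ≤ W * ∫⁻ y, nn(h y) := by
    intro F _ h hm h0
    have := lmW (d := d) (Γ := Γ) (hm.enorm.pow_const 2) univ MeasurableSet.univ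
    rw [Measure.restrict_univ, Measure.restrict_univ] at this
    rw [this, ← lintegral_const_mul' _ _ ofReal_ne_top]
    refine lintegral_mono fun y => ?_
    by_cases hy : y ∈ K'
    · refine mul_le_mul' (ofReal_le_ofReal (g.w_le hc (hcK y hy))) le_rfl
    · simp [h0 y hy]
  have lim : ∀ {F : Type} [NormedAddCommGroup F] [NormedSpace ℝ F] [CompleteSpace F] {h : Euc n → F},
      MemLp h 2 volume → ∀ᶠ j in atTop, W * ∫⁻ y, nn(moll (bmp n j) h y - h y) ≤ ε := by
    intro F _ _ _ h hh
    have h1 := (ENNReal.continuous_pow 2).continuousAt.tendsto.comp (moll_L2 hh)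
    have h2 := ENNReal.Tendsto.const_mul (a := W) h1 (Or.inr ofReal_ne_top)
    simp only [ne_eq, OfNat.ofNat_ne_zero, not_false_eq_true, zero_pow, mul_zero] at h2
    filter_upwards [h2.eventually (eventually_le_nhds hε)] with j hj
    rw [← sqn]; exact hj
  obtain ⟨j, h1, h2, h3⟩ := ((lim hf).and ((lim hp).and
    ((bmp_rOut n).eventually (eventually_le_nhds hη)))).exists
  have hsub : ∀ y ∉ K', y ∉ cthickening (bmp n j).rOut K := fun y hy h => hy (cthickening_mono h3 _ h)
  have hKK : ∀ y ∉ K', y ∉ K := fun y hy h => hy (self_subset_cthickening K h)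
  have hts : tsupport (moll (bmp n j) f) ⊆ K' :=
    closure_minimal (fun y hy => by
      by_contra h
      exact hy (moll_out hf0 (hsub y h))) hK'.isClosed
  refine ⟨moll (bmp n j) f, moll_smooth _ hfl, HasCompactSupport.of_support_subset_isCompact hK'
    ((subset_tsupport _).trans hts), hts.trans hηO, ?_, ?_⟩
  · refine le_trans (key _ ?_ ?_) h1
    · exact (moll_smooth _ hfl).continuous.aestronglyMeasurable.sub hf.1
    · intro y hy
      rw [moll_out hf0 (hsub y hy), hf0 y (hKK y hy), sub_zero]
  · simp_rw [fun y => moll_grad hfl hg (bmp n j) y (subset_univ _)]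
    refine le_trans (key _ ?_ ?_) h2
    · exact (moll_smooth _ hpl).continuous.aestronglyMeasurable.sub hp.1
    · intro y hy
      rw [moll_out hp0 (hsub y hy), hp0 y (hKK y hy), sub_zero]

theorem InH0.lim {V : Set (Euc n)} {f : Euc n → ℝ} {p : Euc n → Euc n} 
    (h : ∀ ε : ℝ≥0∞, 0 < ε → ∃ f' p', InH0 n d Γ V f' p' ∧ AEStronglyMeasurable f' (measW n d Γ) ∧
      AEStronglyMeasurable p' (measW n d Γ) ∧
      ∫⁻ y, nn(f' y - f y) ∂(measW n d Γ) ≤ ε ∧ ∫⁻ y, nn(p' y - p y) ∂(measW n d Γ) ≤ ε) :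
    InH0 n d Γ V f p := by
  intro ε hε
  have h4 : ε / 4 ≠ 0 := (ENNReal.div_pos hε.ne' nz).ne'
  obtain ⟨f', p', h1, hm1, hm2, h2, h3⟩ := h (ε / 4) h4.bot_lt
  obtain ⟨φ, a1, a2, a3, a4, a5⟩ := h1 (ε / 4) h4.bot_lt
  have tri : ∀ {F : Type} [NormedAddCommGroup F] {a b c : Euc n → F},
      AEStronglyMeasurable a (measW n d Γ) → AEStronglyMeasurable b (measW n d Γ) →
      ∫⁻ y, nn(a y - b y) ∂(measW n d Γ) ≤ ε / 4 → ∫⁻ y, nn(b y - c y) ∂(measW n d Γ) ≤ ε / 4 →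
      ∫⁻ y, nn(a y - c y) ∂(measW n d Γ) ≤ ε := by
    intro F _ a b c ha hb h1 h2
    calc _ ≤ ∫⁻ y, (2 * nn(a y - b y) + 2 * nn(b y - c y)) ∂(measW n d Γ) := by
          refine lintegral_mono fun y => ?_
          rw [← sub_add_sub_cancel (a y) (b y) (c y)]; exact enorm_add_sq_le _ _
      _ = (2 * ∫⁻ y, nn(a y - b y) ∂(measW n d Γ)) + 2 * ∫⁻ y, nn(b y - c y) ∂(measW n d Γ) := by
          rw [lintegral_add_left' (f := fun y => 2 * nn(a y - b y)) (((ha.sub hb).enorm.pow_const 2).const_mul 2),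
            lintegral_const_mul' _ _ nz, lintegral_const_mul' 2 _ nz]
      _ ≤ 2 * (ε / 4) + 2 * (ε / 4) := by gcongr
      _ = ε := by
          rw [← add_mul, show (2:ℝ≥0∞) + 2 = 4 by norm_num, ENNReal.mul_div_cancel] <;> norm_num
  exact ⟨φ, a1, a2, a3, tri a1.continuous.aestronglyMeasurable hm1 a4 h2,
    tri (gr_cont a1).aestronglyMeasurable hm2 a5 h3⟩

end

section
variable {n : ℕ} {d Ca : ℝ} {Γ : Set (Euc n)} {A : Euc n → Euc n →L[ℝ] Euc n}
  {x : Euc n} {R k N : ℝ} {U : Euc n → ℝ} {q : Euc n → Euc n} {F : ℝ → ℝ}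

/-- solution in a ball with trace at most `k` -/
structure Sbs (n : ℕ) (d : ℝ) (Γ : Set (Euc n)) (A : Euc n → Euc n →L[ℝ] Euc n) (x : Euc n) (R : ℝ)
    (U : Euc n → ℝ) (q : Euc n → Euc n) (k : ℝ) : Prop where
  gd : Good n d Γ A (ball x R \ Γ) U q
  tr : ∀ᵐ z ∂(sg d Γ x R), ∃ τ ≤ k, HasTraceAt U z τ

/-- truncation functions -/
structure Fn (F : ℝ → ℝ) (k N : ℝ) : Prop where
  sm : Sm F
  bd : ∀ t, |deriv F t| ≤ N
  z : ∀ t ≤ k, F t = 0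

theorem Fn.lip (h : Fn F k N) (s t : ℝ) : |F s - F t| ≤ N * |s - t| := by
  have := convex_univ.norm_image_sub_le_of_norm_deriv_le (f := F) (C := N) (x := t) (y := s)
    (fun x _ => h.sm.differentiable (by simp) x) (fun x _ => h.bd x) (mem_univ _) (mem_univ _)
  simpa using this

theorem Fn.N0 (h : Fn F k N) : 0 ≤ N := (abs_nonneg _).trans (h.bd 0)

theorem Fn.le (h : Fn F k N) (t : ℝ) : |F t| ≤ N * max (t - k) 0 := by
  rcases le_total t k with h1 | h1
  · rw [h.z t h1, max_eq_right lz]; simp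
  · have := h.lip t k
    rwa [h.z k le_rfl, sub_zero, abs_of_nonneg (by linarith : 0 ≤ t - k), ← max_eq_left (a := t - k) (b := 0)
      lz] at this

theorem Fn.leE (h : Fn F k N) (t : ℝ) : ‖F t‖ₑ ≤ ofReal N * ‖max (t - k) 0‖ₑ := by
  rw [Real.enorm_eq_ofReal_abs, Real.enorm_eq_ofReal_abs, abs_of_nonneg (le_max_right (t-k) 0),
    ← ofReal_mul h.N0]
  exact ofReal_le_ofReal (h.le t)

theorem Fn.memS {E : Type*} [NormedAddCommGroup E] [NormedSpace ℝ E] (h : Fn F k N)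
    (hU : MemLp U 2 volume) {ζ : Euc n → E} (hζ : Continuous ζ) (hc : HasCompactSupport ζ) :
    MemLp (fun y => F (U y) • ζ y) 2 volume := by
  obtain ⟨B, hB⟩ := hc.exists_bound_of_continuous hζ
  have h1 : MemLp (fun y => (F (U y) - F 0) • ζ y) 2 volume := by
    refine hU.of_le_mul (c := N * B) (((h.sm.continuous.comp_aestronglyMeasurable hU.1).sub
      aestronglyMeasurable_const).smul hζ.aestronglyMeasurable) (Eventually.of_forall fun y => ?_)
    rw [norm_smul, mul_right_comm]
    have := h.lip (U y) 0
    rw [sub_zero] at this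
    exact mul_le_mul this (hB y) (norm_nonneg _) (mul_nonneg h.N0 (abs_nonneg _))
  have h2 : MemLp ζ 2 volume := hζ.memLp_of_hasCompactSupport hc
  refine (h1.add (h2.const_smul (F 0))).ae_eq (Eventually.of_forall fun y => ?_)
  simp [sub_smul]

theorem Fn.li (h : Fn F k N) (hU : MemLp U 2 volume) : LocallyIntegrable fun y => F (U y) := by
  have h1 : MemLp (fun y => F (U y) - F 0) 2 volume :=
    hU.of_le_mul (c := N) ((h.sm.continuous.comp_aestronglyMeasurable hU.1).sub
      aestronglyMeasurable_const) (Eventually.of_forall fun y => by simpa using h.lip (U y) 0)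
  have := (h1.locallyIntegrable nz).add (locallyIntegrable_const (F 0))
  refine this.congr (Eventually.of_forall fun y => ?_)
  simp

theorem Fn.mq (h : Fn F k N) (hU : MemLp U 2 volume) (hq : MemLp q 2 volume) :
    MemLp (fun y => deriv F (U y) • q y) 2 volume := by
  refine hq.of_le_mul (c := N) (((h.sm.continuous_deriv (by simp)).comp_aestronglyMeasurable hU.1).smul
    hq.1) (Eventually.of_forall fun y => ?_)
  rw [norm_smul]
  exact mul_le_mul_of_nonneg_right (h.bd _) (norm_nonneg _)

theorem Geo.lay_lim (g : Geo n d Ca Γ) {G : Euc n → ℝ≥0∞} (hG : ∫⁻ y, G y ∂(measW n d Γ) < ⊤)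
    {ε : ℝ≥0∞} (hε : 0 < ε) : ∃ ρb : ℝ, 0 < ρb ∧ ∀ ρ ≤ ρb,
    ∫⁻ y in {y | infDist y Γ < ρ}, G y ∂(measW n d Γ) ≤ ε := by
  set ν := (measW n d Γ).withDensity G
  have hf : IsFiniteMeasure ν := ⟨by
    rw [withDensity_apply _ MeasurableSet.univ, Measure.restrict_univ]; exact hG⟩
  have hms : ∀ t, MeasurableSet {y : Euc n | infDist y Γ < t} := fun t =>
    measurableSet_lt (by fun_prop) measurable_const
  set s : ℕ → Set (Euc n) := fun j => {y | infDist y Γ < 1 / ((j:ℝ) + 1)}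
  have ht : Tendsto (ν ∘ s) atTop (𝓝 (ν (⋂ j, s j))) := by
    refine tendsto_measure_iInter_atTop (fun j => (hms _).nullMeasurableSet) ?_ ⟨0, measure_ne_top _ _⟩
    intro i j hij y hy
    have h1 : (1:ℝ) / ((j:ℝ) + 1) ≤ 1 / ((i:ℝ) + 1) :=
      one_div_le_one_div_of_le pz (by simpa using hij)
    exact lt_of_lt_of_le (show infDist y Γ < 1 / ((j:ℝ) + 1) from hy) h1
  have h0 : ν (⋂ j, s j) = 0 := by
    have : ⋂ j, s j ⊆ Γ := by
      intro y hy
      by_contra h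
      have hp := g.pos h
      obtain ⟨j, hj⟩ := exists_nat_one_div_lt hp
      have := mem_iInter.1 hy j
      exact lt_asymm hj this
    refine measure_mono_null this ?_
    exact (withDensity_absolutelyContinuous _ _) (mW_ac g.null)
  rw [h0] at ht
  obtain ⟨j, hj⟩ := (ht.eventually (eventually_le_nhds hε)).exists
  refine ⟨1 / ((j:ℝ) + 1), by positivity, fun ρ hρ => ?_⟩
  rw [← withDensity_apply _ (hms _)]
  refine (measure_mono ?_).trans hj
  intro y hy
  exact lt_of_lt_of_le hy hρ

theorem Sbs.lay (g : Geo n d Ca Γ) (h : Sbs n d Γ A x R U q k) {R' : ℝ} (hR : R' < R) :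
    ∃ C : ℝ≥0, ∃ ρa : ℝ, 0 < ρa ∧ ∀ ρ, 0 < ρ → ρ ≤ ρa →
      ∫⁻ y in {y | infDist y Γ < ρ} ∩ ball x R', nn(max (U y - k) 0) ∂(measW n d Γ) ≤
      C * ofReal (ρ ^ 2) *
      ∫⁻ y in {y | infDist y Γ < 2 * ρ}, nn(q y) ∂(measW n d Γ) := by
  obtain ⟨C, hC⟩ := Geo.lay2 n d Ca g.hdn
  refine ⟨C, (R - R') / 2, by linarith, fun ρ h0 h1 => ?_⟩
  refine (hC Γ g U q (h.gd.U2.locallyIntegrable nz) h.gd.q2 h.gd.gr x R' ρ k h0 ?_).trans ?_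
  · refine ae_mono (Measure.restrict_mono ?_ le_rfl) h.tr
    exact inter_subset_inter_right _ (ball_subset_ball lz)
  · exact mul_le_mul' le_rfl (lintegral_mono_set inter_subset_left)

theorem Sbs.fin (g : Geo n d Ca Γ) (h : Sbs n d Γ A x R U q k) {R' : ℝ} (hR : R' < R) :
    ∫⁻ y in ball x R', nn(max (U y - k) 0) ∂(measW n d Γ) < ⊤ := by
  obtain ⟨C, ρa, hρ, hl⟩ := h.lay g hR
  have hms : MeasurableSet {y : Euc n | infDist y Γ < ρa} :=
    measurableSet_lt (by fun_prop) measurable_const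
  have hG : AEMeasurable (fun y => nn(max (U y - k) 0)) :=
    ((h.gd.U2.1.aemeasurable.sub_const k).max aemeasurable_const).enorm.pow_const 2
  have hsub : ball x R' ⊆ ({y | infDist y Γ < ρa} ∩ ball x R') ∪ ({y | infDist y Γ < ρa}ᶜ ∩ ball x R') :=
    fun y hy => by by_cases h : infDist y Γ < ρa <;> simp [h, mem_ball.1 hy]
  refine (lintegral_mono_set hsub).trans_lt ((lintegral_union_le _ _ _).trans_lt
    (ENNReal.add_lt_top.2 ⟨?_, ?_⟩))
  · refine (hl ρa hρ le_rfl).trans_lt (ENNReal.mul_lt_top (by finiteness) ?_)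
    exact (lintegral_mono' Measure.restrict_le_self le_rfl).trans_lt h.gd.qm
  · rw [lmW hG _ (hms.compl.inter measurableSet_ball)]
    calc _ ≤ ∫⁻ y in {y | infDist y Γ < ρa}ᶜ ∩ ball x R', ofReal (ρa ^ (d + 1 - (n:ℝ))) *
          (2 * nn(U y) + 2 * nn(k)) := by
          refine setLIntegral_mono' (hms.compl.inter measurableSet_ball) fun y hy => ?_
          refine mul_le_mul' (ofReal_le_ofReal (g.w_le hρ ?_)) ?_
          · exact not_lt.1 hy.1
          · refine le_trans ?_ (enorm_sub_sq_le _ _)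
            gcongr
            rw [Real.enorm_eq_ofReal_abs, Real.enorm_eq_ofReal_abs, abs_of_nonneg (le_max_right _ _)]
            exact ofReal_le_ofReal (max_le (le_abs_self _) (abs_nonneg _))
      _ ≤ ∫⁻ y in ball x R', ofReal (ρa ^ (d + 1 - (n:ℝ))) *
          (2 * nn(U y) + 2 * nn(k)) := lintegral_mono_set inter_subset_right
      _ < ⊤ := by
          rw [lintegral_const_mul' _ _ ofReal_ne_top, lintegral_add_right _ measurable_const,
            setLIntegral_const, lintegral_const_mul' _ _ nz]
          refine ENNReal.mul_lt_top ofReal_lt_top (ENNReal.add_lt_top.2 ⟨?_, ?_⟩)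
          · refine ENNReal.mul_lt_top nz ?_
            refine (lintegral_mono' Measure.restrict_le_self le_rfl).trans_lt ?_
            rw [← sqn]; exact ENNReal.pow_lt_top h.gd.U2.2
          · exact ENNReal.mul_lt_top (by finiteness) measure_ball_lt_top

/-- gradient field of `η F(U)` -/
def pf (η : Euc n → ℝ) (F : ℝ → ℝ) (U : Euc n → ℝ) (q : Euc n → Euc n) (y : Euc n) : Euc n :=
  F (U y) • gradient η y + η y • (deriv F (U y) • q y)

theorem pf_memLp (hF : Fn F k N) (hU : MemLp U 2 volume) (hq : MemLp q 2 volume) {η : Euc n → ℝ}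
    (hη : Sm η) (hc : HasCompactSupport η) : MemLp (pf η F U q) 2 volume := by
  refine (hF.memS hU (gr_cont hη) (gr_cs hc)).add ?_
  obtain ⟨B, hB⟩ := hc.exists_bound_of_continuous hη.continuous
  refine (hF.mq hU hq).of_le_mul (c := B) (hη.continuous.aestronglyMeasurable.smul (hF.mq hU hq).1)
    (Eventually.of_forall fun y => ?_)
  rw [norm_smul]
  exact mul_le_mul_of_nonneg_right (hB _) (norm_nonneg _)

theorem pf_out {η : Euc n → ℝ} {y : Euc n} (hy : y ∉ tsupport η) : pf η F U q y = 0 := by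
  simp [pf, gr_out hy, image_eq_zero_of_notMem_tsupport hy]

theorem pf_fin (g : Geo n d Ca Γ) (h : Sbs n d Γ A x R U q k) (hF : Fn F k N) {η : Euc n → ℝ}
    (hη : Sm η) (hc : HasCompactSupport η) (hs : tsupport η ⊆ ball x R) :
    ∫⁻ y, nn(pf η F U q y) ∂(measW n d Γ) < ⊤ := by
  obtain ⟨R', hR', hsR⟩ := exists_lt_subset_ball (isClosed_tsupport _) hs
  obtain ⟨B, hB⟩ := hc.exists_bound_of_continuous hη.continuous
  obtain ⟨B', hB'⟩ := (gr_cs hc).exists_bound_of_continuous (gr_cont hη)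
  have hB0 : 0 ≤ B := (norm_nonneg _).trans (hB 0)
  have hfin := h.fin g hR'
  have hG : AEMeasurable (fun y => nn(max (U y - k) 0)) (measW n d Γ) :=
    (((h.gd.U2.1.aemeasurable.sub_const k).max aemeasurable_const).enorm.pow_const 2).mono_ac mW_ac
  calc _ ≤ ∫⁻ y, ((ball x R').indicator (fun y => ofReal (2 * (N * B') ^ 2) * nn(max (U y - k) 0)) y +
        ofReal (2 * (B * N) ^ 2) * nn(q y)) ∂(measW n d Γ) := by
        refine lintegral_mono fun y => ?_
        by_cases hy : y ∈ tsupport η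
        · rw [indicator_of_mem (hsR hy)]
          refine (enorm_add_sq_le _ _).trans (add_le_add ?_ ?_)
          · rw [ofReal_mul nz, ofReal_ofNat, mul_assoc,
              ofReal_pow (mul_nonneg hF.N0 ((norm_nonneg _).trans (hB' 0))), ← mul_pow]
            gcongr
            rw [enorm_smul, mul_comm N, ofReal_mul ((norm_nonneg _).trans (hB' 0)), mul_assoc, mul_comm]
            refine mul_le_mul' ?_ (hF.leE _)
            rw [← ofReal_norm]
            exact ofReal_le_ofReal (hB' y)
          · rw [ofReal_mul nz, ofReal_ofNat, mul_assoc,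
              ofReal_pow (mul_nonneg hB0 hF.N0), ← mul_pow]
            gcongr
            rw [smul_smul, enorm_smul]
            gcongr
            rw [Real.enorm_eq_ofReal_abs, abs_mul]
            exact ofReal_le_ofReal (mul_le_mul (hB y) (hF.bd _) (abs_nonneg _) hB0)
        · simp [pf_out hy]
    _ < ⊤ := by
        rw [lintegral_add_left' ((hG.const_mul _).indicator measurableSet_ball),
          lintegral_indicator measurableSet_ball, lintegral_const_mul' _ _ ofReal_ne_top,
          lintegral_const_mul' _ _ ofReal_ne_top]
        exact ENNReal.add_lt_top.2 ⟨ENNReal.mul_lt_top (by finiteness) hfin,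
          ENNReal.mul_lt_top (by finiteness) h.gd.qm⟩

end

section
variable {n : ℕ} {d Ca : ℝ} {Γ : Set (Euc n)} {A : Euc n → Euc n →L[ℝ] Euc n}
  {x : Euc n} {R k N : ℝ} {U : Euc n → ℝ} {q : Euc n → Euc n} {F : ℝ → ℝ}

theorem enr_pick {ε K : ℝ≥0∞} (hε : 0 < ε) (hK : K ≠ ⊤) : ∃ εc : ℝ≥0∞, 0 < εc ∧ K * εc ≤ ε := by
  refine ⟨ε / (K + 1), ENNReal.div_pos hε.ne' (by finiteness), ?_⟩
  calc _ ≤ (K + 1) * (ε / (K + 1)) := mul_le_mul' le_self_add le_rfl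
    _ ≤ ε := ENNReal.mul_div_le

theorem gr_const {φ : Euc n → ℝ} {y : Euc n} {c : ℝ} (h : φ =ᶠ[𝓝 y] fun _ => c) : gradient φ y = 0 := by
  rw [← norm_eq_zero, ngr, h.fderiv_eq, fderiv_fun_const]; simp

theorem Sbs.h0 (g : Geo n d Ca Γ) (h : Sbs n d Γ A x R U q k) (hF : Fn F k N) {η : Euc n → ℝ}
    (hη : Sm η) (hc : HasCompactSupport η) (hs : tsupport η ⊆ ball x R) :
    InH0 n d Γ (ball x R) (fun y => η y * F (U y)) (pf η F U q) := by
  obtain ⟨R', hR', hsR⟩ := exists_lt_subset_ball (isClosed_tsupport _) hs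
  obtain ⟨B, hB⟩ := hc.exists_bound_of_continuous hη.continuous
  have hB0 : 0 ≤ B := (norm_nonneg _).trans (hB 0)
  obtain ⟨C, ρa, hρa, hl⟩ := h.lay g hR'
  have hfin := pf_fin g h hF hη hc hs
  have hU := h.gd.U2
  have hq := h.gd.q2
  have hms : ∀ t, MeasurableSet {y : Euc n | infDist y Γ < t} := fun t =>
    measurableSet_lt (by fun_prop) measurable_const
  have hM : AEMeasurable (fun y => nn(max (U y - k) 0)) (measW n d Γ) :=
    (((hU.1.aemeasurable.sub_const k).max aemeasurable_const).enorm.pow_const 2).mono_ac mW_ac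
  refine InH0.lim fun ε hε => ?_
  set cb : ℝ≥0∞ := ofReal B * ofReal N with hcb
  set K : ℝ≥0∞ := cb ^ 2 * C + 2 * (cb ^ 2 * C * ofReal ((9 * LS) ^ 2)) with hK
  have hε2 : 0 < ε / 2 := ENNReal.div_pos hε.ne' nz
  obtain ⟨εc, hεc, hKε⟩ := enr_pick (K := K) hε2 (by simp only [hK, hcb]; finiteness)
  obtain ⟨εe, hεe, hKε3⟩ := enr_pick (K := 2) hε2 (by finiteness)
  obtain ⟨ρb, hρb, hl1⟩ := g.lay_lim hfin hεe
  obtain ⟨ρc, hρc, hl2⟩ := g.lay_lim h.gd.qm hεc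
  obtain ⟨t, ht, ht0, ht1, ht2, ht3⟩ : ∃ t : ℝ, 0 < t ∧ 3 * t ≤ ρa ∧ 3 * t ≤ ρb ∧ 6 * t ≤ ρc ∧ 3 * t ≤ 1 := by
    refine ⟨min (min ρa ρb) (min ρc 1) / 6, by positivity, ?_, ?_, ?_, ?_⟩ <;>
    linarith [min_le_left (min ρa ρb) (min ρc 1), min_le_right (min ρa ρb) (min ρc 1),
      min_le_left ρa ρb, min_le_right ρa ρb, min_le_left ρc 1, min_le_right ρc 1,
      show 0 < min (min ρa ρb) (min ρc 1) by positivity]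
  obtain ⟨χ, hχ, hχ01, hχ0, hχ1, hχg⟩ := cutoff Γ (a := t) (b := 2 * t) lz
  set I := ∫⁻ y in {y | infDist y Γ < 6 * t}, nn(q y) ∂(measW n d Γ)
  have hI : I ≤ εc := hl2 _ ht2
  have hlay := hl (3 * t) pz ht0
  rw [show 2 * (3 * t) = 6 * t by ring] at hlay
  set S := {y | infDist y Γ < 3 * t} ∩ ball x R'
  have hSm : MeasurableSet S := (hms _).inter measurableSet_ball
  have hη' : Sm (fun y => χ y * η y) := hχ.mul hη
  have hc' : HasCompactSupport (fun y => χ y * η y) := hc.mul_left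
  have hmp : MemLp (pf (fun y => χ y * η y) F U q) 2 volume := pf_memLp hF hU hq hη' hc'
  have hmf : MemLp (fun y => (χ y * η y) * F (U y)) 2 volume := by
    refine (hF.memS hU hη'.continuous hc').ae_eq (Eventually.of_forall fun y => ?_)
    simp [mul_comm]
  have hgχ : ∀ y, 2 * t < infDist y Γ → gradient χ y = 0 := fun y hy => by
    refine gr_const (c := 1) ?_
    have : {y : Euc n | 2 * t < infDist y Γ} ∈ 𝓝 y :=
      (isOpen_lt continuous_const (continuous_infDist_pt Γ)).mem_nhds hy
    filter_upwards [this] with z hz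
    exact hχ1 z (le_of_lt hz)
  have hpfe : ∀ y, pf (fun y => χ y * η y) F U q y = χ y • pf η F U q y + (F (U y) * η y) • gradient χ y := by
    intro y
    unfold pf
    rw [grad_mul (hη.differentiable (by simp) _) (hχ.differentiable (by simp) _)]
    module
  refine ⟨fun y => (χ y * η y) * F (U y), pf (fun y => χ y * η y) F U q, ?_, hmf.1.mono_ac mW_ac,
    hmp.1.mono_ac mW_ac, ?_, ?_⟩
  · refine g.h0cpt isOpen_ball hmf hmp ?_ (K := tsupport η ∩ {y | t ≤ infDist y Γ})
      (hc.isCompact.inter_right (isClosed_le continuous_const (continuous_infDist_pt Γ))) ?_ ?_ ?_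
    · exact prodg (hF.li hU) ((hF.mq hU hq).locallyIntegrable nz)
        (chain isOpen_univ (hU.locallyIntegrable nz) hq h.gd.gr hF.sm (Or.inr hU) hF.bd) hη'
    · rintro y ⟨h1, h2⟩
      refine ⟨hs h1, fun h3 => ?_⟩
      have : t ≤ infDist y Γ := h2
      rw [infDist_zero_of_mem h3] at this
      linarith
    · intro y hy
      by_cases h1 : y ∈ tsupport η
      · have : infDist y Γ < t := by
          by_contra h2; exact hy ⟨h1, not_lt.1 h2⟩
        simp [hχ0 y this.le]
      · simp [image_eq_zero_of_notMem_tsupport h1]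
    · intro y hy
      apply pf_out
      intro h1
      apply hy
      refine ⟨closure_mono (Function.support_mul_subset_right χ η) h1, ?_⟩
      have h2 : tsupport (fun y => χ y * η y) ⊆ {y | t ≤ infDist y Γ} := by
        refine closure_minimal ?_ (isClosed_le continuous_const (continuous_infDist_pt Γ))
        intro z hz
        by_contra h3
        have h4 : infDist z Γ < t := not_le.1 h3
        exact hz (by simp [hχ0 z h4.le])
      exact h2 h1
  · calc _ ≤ ∫⁻ y, S.indicator (fun y => cb ^ 2 * nn(max (U y - k) 0)) y ∂(measW n d Γ) := by
          refine lintegral_mono fun y => ?_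
          show nn(χ y * η y * F (U y) - η y * F (U y)) ≤ _
          have e : χ y * η y * F (U y) - η y * F (U y) = (χ y - 1) * (η y * F (U y)) := by ring
          rw [e]
          by_cases hy : y ∈ S
          · rw [indicator_of_mem hy, ← mul_pow, enorm_mul, enorm_mul, hcb, mul_assoc]
            refine pow_le_pow_left' ?_ 2
            refine le_trans (mul_le_mul' (b := 1) ?_ (mul_le_mul' ?_ (hF.leE _))) (one_mul _).le
            · rw [Real.enorm_eq_ofReal_abs, ← ofReal_one]
              exact ofReal_le_ofReal (abs_le.2 ⟨by linarith [(hχ01 y).1], by linarith [(hχ01 y).2]⟩)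
            · rw [← ofReal_norm]; exact ofReal_le_ofReal (hB y)
          · rw [indicator_of_notMem hy]
            by_cases h1 : y ∈ tsupport η
            · have : 3 * t ≤ infDist y Γ := by
                by_contra h2; exact hy ⟨not_le.1 h2, hsR h1⟩
              simp [hχ1 y lz]
            · simp [image_eq_zero_of_notMem_tsupport h1]
      _ = cb ^ 2 * ∫⁻ y in S, nn(max (U y - k) 0) ∂(measW n d Γ) := by
          rw [lintegral_indicator hSm, lintegral_const_mul' _ _ (by simp only [hcb]; finiteness)]
      _ ≤ cb ^ 2 * (C * ofReal ((3 * t) ^ 2) * I) := mul_le_mul' le_rfl hlay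
      _ ≤ cb ^ 2 * (C * 1 * I) := by
          gcongr
          rw [← ofReal_one]
          exact ofReal_le_ofReal (by nlinarith)
      _ = cb ^ 2 * C * I := by ring
      _ ≤ K * εc := mul_le_mul' le_self_add hI
      _ ≤ ε := hKε.trans ENNReal.half_le_self
  · have hmpm : AEMeasurable (fun y => nn(pf η F U q y)) (measW n d Γ) :=
      ((pf_memLp hF hU hq hη hc).1.mono_ac mW_ac).enorm.pow_const 2
    calc _ ≤ ∫⁻ y, (({y | infDist y Γ < 3 * t}).indicator (fun y => 2 * nn(pf η F U q y)) y +
          S.indicator (fun y => 2 * (cb ^ 2 * ofReal ((3 * LS / t) ^ 2)) * nn(max (U y - k) 0)) y)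
            ∂(measW n d Γ) := by
          refine lintegral_mono fun y => ?_
          have e : pf (fun y => χ y * η y) F U q y - pf η F U q y =
            (χ y - 1) • pf η F U q y + (F (U y) * η y) • gradient χ y := by rw [hpfe]; module
          rw [e]
          refine (enorm_add_sq_le _ _).trans (add_le_add ?_ ?_)
          · by_cases hy : y ∈ {y | infDist y Γ < 3 * t}
            · rw [indicator_of_mem hy, enorm_smul]
              gcongr
              refine le_trans (mul_le_mul' (b := 1) ?_ le_rfl) (one_mul _).le
              rw [Real.enorm_eq_ofReal_abs, ← ofReal_one]
              exact ofReal_le_ofReal (abs_le.2 ⟨by linarith [(hχ01 y).1], by linarith [(hχ01 y).2]⟩)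
            · have : 3 * t ≤ infDist y Γ := not_lt.1 hy
              simp [hχ1 y lz]
          · by_cases hy : y ∈ S
            · rw [indicator_of_mem hy, mul_assoc, ofReal_pow (by have := LS1; positivity), ← mul_pow, ← mul_pow,
                enorm_smul, enorm_mul]
              refine mul_le_mul' le_rfl (pow_le_pow_left' ?_ 2)
              calc _ ≤ (ofReal N * ‖max (U y - k) 0‖ₑ) * ofReal B * ofReal (3 * LS / t) := by
                    refine mul_le_mul' (mul_le_mul' (hF.leE _) ?_) ?_
                    · rw [← ofReal_norm]; exact ofReal_le_ofReal (hB y)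
                    · rw [← ofReal_norm]
                      refine ofReal_le_ofReal ((hχg y).trans (le_of_eq ?_))
                      congr 1; ring
                _ = _ := by rw [hcb]; ring
            · rw [indicator_of_notMem hy]
              by_cases h1 : y ∈ tsupport η
              · have : 3 * t ≤ infDist y Γ := by
                  by_contra h2; exact hy ⟨not_le.1 h2, hsR h1⟩
                simp [hgχ y lz]
              · simp [image_eq_zero_of_notMem_tsupport h1]
      _ = 2 * (∫⁻ y in {y | infDist y Γ < 3 * t}, nn(pf η F U q y) ∂(measW n d Γ)) +
          2 * (cb ^ 2 * ofReal ((3 * LS / t) ^ 2)) *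
            ∫⁻ y in S, nn(max (U y - k) 0) ∂(measW n d Γ) := by
          rw [lintegral_add_left' ((hmpm.const_mul 2).indicator (hms _)), lintegral_indicator (hms _),
            lintegral_indicator hSm, lintegral_const_mul' _ _ nz,
            lintegral_const_mul' _ _ (by simp only [hcb]; finiteness)]
      _ ≤ 2 * εe + 2 * (cb ^ 2 * ofReal ((3 * LS / t) ^ 2)) * (C * ofReal ((3 * t) ^ 2) * I) :=
          add_le_add (mul_le_mul' le_rfl (hl1 _ ht1)) (mul_le_mul' le_rfl hlay)
      _ = 2 * εe + 2 * (cb ^ 2 * C * ofReal ((9 * LS) ^ 2)) * I := by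
          rw [show (9 * LS) ^ 2 = (3 * LS / t) ^ 2 * (3 * t) ^ 2 by field_simp; ring,
            ofReal_mul (p := (3 * LS / t) ^ 2) pz]
          ring
      _ ≤ ε / 2 + K * εc := add_le_add hKε3 (mul_le_mul' le_add_self hI)
      _ ≤ ε / 2 + ε / 2 := by gcongr
      _ = ε := ENNReal.add_halves ε
end

section
variable {n : ℕ} {d Ca Cb : ℝ} {Γ : Set (Euc n)} {A : Euc n → Euc n →L[ℝ] Euc n}
  {x : Euc n} {R k N : ℝ} {U : Euc n → ℝ} {q : Euc n → Euc n} {F : ℝ → ℝ}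

/-- coefficient assumptions -/
structure Ell (n : ℕ) (d : ℝ) (Γ : Set (Euc n)) (A : Euc n → Euc n →L[ℝ] Euc n) (Cb : ℝ) : Prop where
  m : AEStronglyMeasurable A volume
  e : EllipticOn n d Γ A Cb
  c : 1 ≤ Cb

theorem lmU {f : Euc n → ℝ≥0∞} (hf : AEMeasurable f) :
    ∫⁻ x, f x ∂(measW n d Γ) = ∫⁻ x, ofReal (weightW n d Γ x) * f x := by
  have := lmW (d := d) (Γ := Γ) hf univ MeasurableSet.univ
  rwa [setLIntegral_univ, setLIntegral_univ] at this

theorem bl_m (hA : AEStronglyMeasurable A volume) {q p : Euc n → Euc n} (hq : AEStronglyMeasurable q volume)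
    (hp : AEStronglyMeasurable p volume) :
    AEStronglyMeasurable (fun y => ∑ i, A y (q y) i * p y i) volume := by
  have h1 : AEStronglyMeasurable (fun y => A y (q y)) volume :=
    (isBoundedBilinearMap_apply (𝕜 := ℝ) (E := Euc n) (F := Euc n)).continuous.comp_aestronglyMeasurable
      (hA.prodMk hq)
  have hc : ∀ i : Fin n, Continuous fun v : Euc n => v i := fun i => by fun_prop
  refine Finset.aestronglyMeasurable_fun_sum _ fun i _ => ?_
  exact ((hc i).comp_aestronglyMeasurable h1).mul ((hc i).comp_aestronglyMeasurable hp)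

theorem bl_le (g : Geo n d Ca Γ) (hE : Ell n d Γ A Cb) {q p : Euc n → Euc n}
    (hq : AEStronglyMeasurable q volume) (hp : AEStronglyMeasurable p volume) :
    (∫⁻ y in Γᶜ, ‖∑ i, A y (q y) i * p y i‖ₑ) ^ 2 ≤ ofReal (Cb ^ 2) *
      ((∫⁻ y, nn(q y) ∂(measW n d Γ)) * ∫⁻ y, nn(p y) ∂(measW n d Γ)) := by
  have hc := hE.c
  refine le_trans ?_ (mul_le_mul' le_rfl (cs_lint (measW n d Γ) (hq.mono_ac mW_ac).enorm (hp.mono_ac mW_ac).enorm))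
  rw [ofReal_pow lz, ← mul_pow]
  refine pow_le_pow_left' ?_ 2
  rw [lmU (f := fun y => ‖q y‖ₑ * ‖p y‖ₑ) (hq.enorm.mul hp.enorm),
    ← lintegral_const_mul' _ _ ofReal_ne_top]
  refine le_trans (setLIntegral_mono' g.cl.measurableSet.compl fun y hy => ?_)
    (lintegral_mono' Measure.restrict_le_self le_rfl)
  have := (hE.e y hy).1 (q y) (p y)
  rw [Real.enorm_eq_ofReal_abs, ← ofReal_norm, ← ofReal_norm, ← ofReal_mul (norm_nonneg _),
    ← ofReal_mul (g.w_pos hy).le, ← ofReal_mul lz]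
  refine ofReal_le_ofReal (this.trans (le_of_eq (by ring)))

theorem bl_int (g : Geo n d Ca Γ) (hE : Ell n d Γ A Cb) {q p : Euc n → Euc n}
    (hq : AEStronglyMeasurable q volume) (hp : AEStronglyMeasurable p volume)
    (hq2 : ∫⁻ y, nn(q y) ∂(measW n d Γ) < ⊤) (hp2 : ∫⁻ y, nn(p y) ∂(measW n d Γ) < ⊤) :
    Integrable (fun y => ∑ i, A y (q y) i * p y i) (volume.restrict Γᶜ) := by
  refine ⟨(bl_m hE.m hq hp).restrict, ?_⟩
  have h := (bl_le g hE hq hp).trans_lt (ENNReal.mul_lt_top ofReal_lt_top (ENNReal.mul_lt_top hq2 hp2))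
  rw [HasFiniteIntegral]
  by_contra hc
  rw [not_lt, top_le_iff] at hc
  rw [hc] at h
  simp at h

theorem InH0.test (g : Geo n d Ca Γ) (hE : Ell n d Γ A Cb) {V : Set (Euc n)} {f : Euc n → ℝ}
    {q p : Euc n → Euc n} (h : InH0 n d Γ V f p)
    (hq : AEStronglyMeasurable q volume) (hp : AEStronglyMeasurable p volume)
    (hq2 : ∫⁻ y, nn(q y) ∂(measW n d Γ) < ⊤) (hp2 : ∫⁻ y, nn(p y) ∂(measW n d Γ) < ⊤)
    (hs : SolOn Γ A q (V \ Γ)) : ∫ y in Γᶜ, ∑ i, A y (q y) i * p y i = 0 := by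
  set I := ∫ y in Γᶜ, ∑ i, A y (q y) i * p y i
  suffices h0 : nn(I) ≤ 0 by simpa using h0
  refine le_of_forall_pos_le_add fun ε hε => ?_
  rw [zero_add]
  obtain ⟨εc, he, hk⟩ := enr_pick (K := ofReal (Cb ^ 2) * ∫⁻ y, nn(q y) ∂(measW n d Γ)) hε
    (ENNReal.mul_lt_top ofReal_lt_top hq2).ne
  obtain ⟨φ, h1, h2, h3, h4, h5⟩ := h (min εc 1) (lt_min he one_pos)
  have hgm : AEStronglyMeasurable (gradient φ) volume := (gr_cont h1).aestronglyMeasurable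
  have hs' := hs φ h1 h2 h3
  have hr : ∀ y, ∑ i, A y (q y) i * gradient φ y i =
      ∑ i, A y (q y) i * (gradient φ y - p y) i + ∑ i, A y (q y) i * p y i := fun y => by
    rw [← Finset.sum_add_distrib]
    exact Finset.sum_congr rfl fun i _ => by simp; ring
  simp_rw [hr] at hs'
  rw [integral_add (f := fun y => ∑ i, A y (q y) i * (gradient φ y - p y) i) (bl_int g hE hq (hgm.sub hp) hq2 ((h5.trans (min_le_right _ _)).trans_lt (by simp)))
    (bl_int g hE hq hp hq2 hp2)] at hs'
  have hI : I = -∫ y in Γᶜ, ∑ i, A y (q y) i * (gradient φ y - p y) i := by linarith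
  rw [hI, enorm_neg]
  calc _ ≤ (∫⁻ y in Γᶜ, ‖∑ i, A y (q y) i * (gradient φ y - p y) i‖ₑ) ^ 2 :=
        pow_le_pow_left' (enorm_integral_le_lintegral_enorm _) 2
    _ ≤ _ := bl_le g hE hq (hgm.sub hp)
    _ ≤ ofReal (Cb ^ 2) * ((∫⁻ y, nn(q y) ∂(measW n d Γ)) * εc) := by
        refine mul_le_mul' le_rfl (mul_le_mul' le_rfl (h5.trans (min_le_left _ _)))
    _ ≤ ε := by rw [← mul_assoc]; exact hk

theorem lint_cmp {α : Type*} [MeasurableSpace α] {μ : Measure α} {a b I : α → ℝ} (hb : AEStronglyMeasurable b μ)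
    (hb0 : 0 ≤ᵐ[μ] b) (ha0 : 0 ≤ᵐ[μ] a) (hI : Integrable I μ) (h0 : ∫ y, I y ∂μ ≤ 0)
    (h : ∀ᵐ y ∂μ, a y ≤ b y + I y) :
    ∫⁻ y, ofReal (a y) ∂μ ≤ ∫⁻ y, ofReal (b y) ∂μ := by
  by_cases hf : ∫⁻ y, ofReal (b y) ∂μ = ⊤
  · rw [hf]; exact le_top
  have hbi : Integrable b μ := (lintegral_ofReal_ne_top_iff_integrable hb hb0).1 hf
  calc _ ≤ ∫⁻ y, ofReal (b y + I y) ∂μ :=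
        lintegral_mono_ae (h.mono fun y hy => ofReal_le_ofReal hy)
    _ = ofReal (∫ y, (b y + I y) ∂μ) := by
        rw [ofReal_integral_eq_lintegral_ofReal (f := fun y => b y + I y) (hbi.add hI)]
        filter_upwards [h, ha0] with y h1 h2
        exact le_trans h2 h1
    _ ≤ ofReal (∫ y, b y ∂μ) := by
        rw [integral_add hbi hI]
        exact ofReal_le_ofReal lz
    _ = _ := ofReal_integral_eq_lintegral_ofReal hbi hb0

theorem Sbs.energy (g : Geo n d Ca Γ) (hE : Ell n d Γ A Cb) (h : Sbs n d Γ A x R U q k) (hF : Fn F k N)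
    {η : Euc n → ℝ} (hη : Sm η) (hc : HasCompactSupport η) (hs : tsupport η ⊆ ball x R)
    {P Q : ℝ → ℝ} (hP : Continuous P) (hQ : Continuous Q) {M : Set ℝ} (hM : ∀ᵐ y, y ∈ ball x R → U y ∈ M)
    (hPF : ∀ t ∈ M, P t ^ 2 ≤ deriv F t) (hFQ : ∀ t ∈ M, |F t| ≤ P t * Q t) :
    ∫⁻ y, nn(η y * P (U y)) * nn(q y) ∂(measW n d Γ) ≤ ofReal (4 * Cb ^ 4) *
      ∫⁻ y, nn(gradient η y) * nn(Q (U y)) ∂(measW n d Γ) := by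
  have hU := h.gd.U2
  have hq := h.gd.q2
  have hη' : Sm (fun y => η y * η y) := hη.mul hη
  have hc' : HasCompactSupport (fun y => η y * η y) := hc.mul_left
  have hs' : tsupport (fun y => η y * η y) ⊆ ball x R :=
    (closure_mono (Function.support_mul_subset_right η η)).trans hs
  have hpm := (pf_memLp hF hU hq hη' hc').1
  have hpfin := pf_fin g h hF hη' hc' hs'
  have ht := (h.h0 g hF hη' hc' hs').test g hE hq.1 hpm h.gd.qm hpfin h.gd.sol
  have hI := bl_int g hE hq.1 hpm h.gd.qm hpfin
  have hc1 := hE.c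
  have hPU : AEStronglyMeasurable (fun y => P (U y)) volume := hP.comp_aestronglyMeasurable hU.1
  have hQU : AEStronglyMeasurable (fun y => Q (U y)) volume := hQ.comp_aestronglyMeasurable hU.1
  have hgm : AEStronglyMeasurable (gradient η) volume := (gr_cont hη).aestronglyMeasurable
  set w := weightW n d Γ
  have hw : AEStronglyMeasurable w volume := (wW_meas n d Γ).aestronglyMeasurable
  have key := lint_cmp (μ := volume.restrict Γᶜ) (a := fun y => (2 * Cb)⁻¹ * (w y * ((η y * P (U y)) ^ 2 * ‖q y‖ ^ 2)))
    (b := fun y => 2 * Cb ^ 3 * (w y * (‖gradient η y‖ ^ 2 * Q (U y) ^ 2)))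
    (((hw.mul ((hgm.norm.pow 2).mul (hQU.pow 2))).const_mul _).restrict) ?_ ?_ hI ht.le ?_
  · have e1 : ∀ᵐ y ∂(volume.restrict Γᶜ), ofReal ((2 * Cb)⁻¹ * (w y * ((η y * P (U y)) ^ 2 * ‖q y‖ ^ 2))) =
        ofReal (2 * Cb)⁻¹ * (ofReal (w y) * (nn(η y * P (U y)) * nn(q y))) := by
      refine (ae_restrict_mem g.cl.measurableSet.compl).mono fun y hy => ?_
      rw [ofReal_mul pz, ofReal_mul (g.w_pos hy).le, ofReal_mul pz,
        Real.enorm_eq_ofReal_abs, ← ofReal_pow (abs_nonneg _), sq_abs, ← ofReal_norm,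
        ← ofReal_pow (norm_nonneg _)]
    have e2 : ∀ᵐ y ∂(volume.restrict Γᶜ), ofReal (2 * Cb ^ 3 * (w y * (‖gradient η y‖ ^ 2 * Q (U y) ^ 2))) =
        ofReal (2 * Cb ^ 3) * (ofReal (w y) * (nn(gradient η y) * nn(Q (U y)))) := by
      refine (ae_restrict_mem g.cl.measurableSet.compl).mono fun y hy => ?_
      rw [ofReal_mul (p := 2 * Cb ^ 3) pz, ofReal_mul (g.w_pos hy).le, ofReal_mul (p := ‖gradient η y‖ ^ 2) pz,
        Real.enorm_eq_ofReal_abs, ← ofReal_pow (abs_nonneg _), sq_abs, ← ofReal_norm,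
        ← ofReal_pow (norm_nonneg _)]
    have hΓ : (volume : Measure (Euc n)).restrict Γᶜ = volume := by
      rw [Measure.restrict_eq_self_of_ae_mem]; exact g.aeO
    rw [lintegral_congr_ae e1, lintegral_congr_ae e2, lintegral_const_mul' _ _ ofReal_ne_top,
      lintegral_const_mul' _ _ ofReal_ne_top, hΓ, ← lmU, ← lmU] at key
    · calc _ = ofReal (2 * Cb) * (ofReal (2 * Cb)⁻¹ * _) := by
            rw [← mul_assoc, ← ofReal_mul pz, mul_inv_cancel₀ pz,
              ofReal_one, one_mul]
        _ ≤ _ := mul_le_mul' le_rfl key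
        _ = _ := by
            rw [← mul_assoc, ← ofReal_mul pz]
            congr 2; ring
    · exact (hgm.enorm.pow_const 2).mul (hQU.enorm.pow_const 2)
    · exact ((hη.continuous.aestronglyMeasurable.mul hPU).enorm.pow_const 2).mul (hq.1.enorm.pow_const 2)
  · refine (ae_restrict_mem g.cl.measurableSet.compl).mono fun y hy => ?_
    have := (g.w_pos hy).le
    show 0 ≤ 2 * Cb ^ 3 * (weightW n d Γ y * (‖gradient η y‖ ^ 2 * Q (U y) ^ 2))
    positivity
  · refine (ae_restrict_mem g.cl.measurableSet.compl).mono fun y hy => ?_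
    have := (g.w_pos hy).le
    show 0 ≤ (2 * Cb)⁻¹ * (weightW n d Γ y * ((η y * P (U y)) ^ 2 * ‖q y‖ ^ 2))
    positivity
  · filter_upwards [ae_restrict_mem g.cl.measurableSet.compl, ae_restrict_of_ae hM] with y hy hMy
    have hw0 := g.w_pos hy
    by_cases hyt : y ∈ tsupport η
    · have hm := hMy (hs hyt)
      have h1 := hPF _ hm
      have h2 := hFQ _ hm
      obtain ⟨e1, e2⟩ := hE.e y hy
      have e1 := e1 (q y) (gradient η y)
      have e2 := e2 (q y)
      have hexp : ∑ i, A y (q y) i * pf (fun y => η y * η y) F U q y i =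
          2 * (η y * F (U y)) * (∑ i, A y (q y) i * gradient η y i) +
          η y ^ 2 * deriv F (U y) * ∑ i, A y (q y) i * q y i := by
        unfold pf
        rw [grad_mul (hη.differentiable (by simp) _) (hη.differentiable (by simp) _), Finset.mul_sum,
          Finset.mul_sum, ← Finset.sum_add_distrib]
        refine Finset.sum_congr rfl fun i _ => ?_
        simp; ring
      rw [hexp]
      set S1 := ∑ i, A y (q y) i * gradient η y i
      set S2 := ∑ i, A y (q y) i * q y i
      have a1 : -(2 * (|η y| * (P (U y) * Q (U y))) * (Cb * w y * ‖q y‖ * ‖gradient η y‖)) ≤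
          2 * (η y * F (U y)) * S1 := by
        have : |2 * (η y * F (U y)) * S1| ≤
            2 * (|η y| * (P (U y) * Q (U y))) * (Cb * w y * ‖q y‖ * ‖gradient η y‖) := by
          rw [abs_mul, abs_mul, abs_mul, abs_two]
          gcongr
          exact mul_nonneg zero_le_two (mul_nonneg (abs_nonneg _) ((abs_nonneg _).trans h2))
        exact (abs_le.1 this).1
      have hw0' : 0 < w y := hw0
      have a2 : η y ^ 2 * P (U y) ^ 2 * (Cb⁻¹ * w y * ‖q y‖ ^ 2) ≤ η y ^ 2 * deriv F (U y) * S2 := by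
        have : 0 ≤ deriv F (U y) := (sq_nonneg _).trans h1
        gcongr
      have a3 : 2 * (|η y| * (P (U y) * Q (U y))) * (Cb * w y * ‖q y‖ * ‖gradient η y‖) ≤
          (2 * Cb)⁻¹ * (w y * ((η y * P (U y)) ^ 2 * ‖q y‖ ^ 2)) +
          2 * Cb ^ 3 * (w y * (‖gradient η y‖ ^ 2 * Q (U y) ^ 2)) := by
        have := mul_nonneg (show 0 ≤ (2 * Cb)⁻¹ * w y by positivity)
          (sq_nonneg (|η y| * P (U y) * ‖q y‖ - 2 * Cb ^ 2 * (‖gradient η y‖ * Q (U y))))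
        have e : (2 * Cb)⁻¹ * w y * (|η y| * P (U y) * ‖q y‖ - 2 * Cb ^ 2 * (‖gradient η y‖ * Q (U y))) ^ 2 =
          (2 * Cb)⁻¹ * (w y * ((η y * P (U y)) ^ 2 * ‖q y‖ ^ 2)) +
          2 * Cb ^ 3 * (w y * (‖gradient η y‖ ^ 2 * Q (U y) ^ 2)) -
          2 * (|η y| * (P (U y) * Q (U y))) * (Cb * w y * ‖q y‖ * ‖gradient η y‖) := by
          rw [mul_pow (η y), ← sq_abs (η y)]
          field_simp
          ring
        linarith
      have a4 : η y ^ 2 * P (U y) ^ 2 * (Cb⁻¹ * w y * ‖q y‖ ^ 2) =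
        2 * ((2 * Cb)⁻¹ * (w y * ((η y * P (U y)) ^ 2 * ‖q y‖ ^ 2))) := by field_simp
      linarith
    · have hz : pf (fun y => η y * η y) F U q y = 0 := pf_out fun h' =>
        hyt (closure_mono (Function.support_mul_subset_right η η) h')
      simp only [hz, image_eq_zero_of_notMem_tsupport hyt, gr_out hyt]
      simp
end

section
variable {n : ℕ} {d Ca Cb : ℝ} {Γ : Set (Euc n)} {A : Euc n → Euc n →L[ℝ] Euc n}
  {x : Euc n} {R k N : ℝ} {U : Euc n → ℝ} {q : Euc n → Euc n} {F : ℝ → ℝ}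

/-- smooth positive part -/
def TT (s : ℝ) : ℝ := ∫ x in (0:ℝ)..s, Real.smoothTransition x

theorem stc : Continuous Real.smoothTransition := Real.smoothTransition.continuous

theorem TT_d (s : ℝ) : HasDerivAt TT (Real.smoothTransition s) s :=
  intervalIntegral.integral_hasDerivAt_right (stc.intervalIntegrable _ _)
    (stc.stronglyMeasurableAtFilter _ _) stc.continuousAt

theorem TT_dd : deriv TT = Real.smoothTransition := funext fun s => (TT_d s).deriv

theorem TT_sm : Sm TT := by
  rw [contDiff_infty_iff_deriv]
  exact ⟨fun s => (TT_d s).differentiableAt, by rw [TT_dd]; exact Real.smoothTransition.contDiff⟩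

theorem TT_z {s : ℝ} (hs : s ≤ 0) : TT s = 0 := by
  unfold TT
  rw [intervalIntegral.integral_congr (g := fun _ => (0:ℝ))]
  · simp
  · intro t ht
    rw [uIcc_of_ge hs] at ht
    exact Real.smoothTransition.zero_of_nonpos ht.2

theorem TT_mono : Monotone TT := monotone_of_deriv_nonneg (TT_sm.differentiable (by simp)) fun s => by
  rw [TT_dd]; exact Real.smoothTransition.nonneg s

theorem TT_nn (s : ℝ) : 0 ≤ TT s := by
  rcases le_total s 0 with h | h
  · rw [TT_z h]
  · rw [← TT_z le_rfl]; exact TT_mono h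

theorem TT_sub : Monotone fun s => s - TT s := by
  refine monotone_of_deriv_nonneg (differentiable_id.sub (TT_sm.differentiable (by simp))) fun s => ?_
  have := ((hasDerivAt_id' s).fun_sub (TT_d s)).deriv
  rw [this]
  linarith [Real.smoothTransition.le_one s]

theorem TT_le (s : ℝ) : TT s ≤ max s 0 := by
  rcases le_total s 0 with h | h
  · rw [TT_z h]; exact le_max_right _ _
  · have := TT_sub h
    simp only [TT_z le_rfl] at this
    rw [max_eq_left h]; linarith

theorem TT_ge (s : ℝ) : s - 1 ≤ TT s := by
  rcases le_total s 1 with h | h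
  · linarith [TT_nn s]
  · have hm : MonotoneOn (fun s => TT s - s) (Ici 1) := by
      refine monotoneOn_of_deriv_nonneg (convex_Ici _) ?_ ?_ ?_
      · exact (TT_sm.continuous.sub continuous_id).continuousOn
      · exact ((TT_sm.differentiable (by simp)).sub differentiable_id).differentiableOn
      · intro t ht
        rw [interior_Ici] at ht
        have := ((TT_d t).fun_sub (hasDerivAt_id' t)).deriv
        rw [this, Real.smoothTransition.one_of_one_le (le_of_lt ht)]
        simp
    have := hm self_mem_Ici h h
    simp only at this
    linarith [TT_nn 1]

theorem TTS (s : ℝ) : 0 ≤ TT s * deriv Real.smoothTransition s ∧ TT s * deriv Real.smoothTransition s ≤ LS := by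
  have h0 : 0 ≤ deriv Real.smoothTransition s := Real.smoothTransition.monotone.deriv_nonneg
  refine ⟨mul_nonneg (TT_nn s) h0, ?_⟩
  have h1 := (le_abs_self _).trans (LSd s)
  rcases le_or_gt s 1 with h | h
  · calc _ ≤ 1 * deriv Real.smoothTransition s :=
        mul_le_mul_of_nonneg_right ((TT_le s).trans (max_le h zero_le_one)) h0
      _ ≤ LS := by rw [one_mul]; exact h1
  · have : deriv Real.smoothTransition s = 0 := by
      rw [EventuallyEq.deriv_eq (f := fun _ => (1:ℝ)) ?_, deriv_const]
      filter_upwards [Ioi_mem_nhds h] with s hs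
      exact Real.smoothTransition.one_of_one_le (le_of_lt hs)
    rw [this, mul_zero]; linarith [LS1]

/-- truncation -/
def Ph (κ h t : ℝ) : ℝ := h * TT ((t - κ) / h)
/-- its derivative -/
def Pd (κ h t : ℝ) : ℝ := Real.smoothTransition ((t - κ) / h)

theorem aff_d (κ h t : ℝ) : HasDerivAt (fun t => (t - κ) / h) (1 / h) t :=
  ((hasDerivAt_id' t).sub_const κ).div_const h

theorem Ph_d (κ : ℝ) {h : ℝ} (hh : 0 < h) (t : ℝ) : HasDerivAt (Ph κ h) (Pd κ h t) t := by
  have := ((TT_d ((t - κ) / h)).comp t (aff_d κ h t)).const_mul h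
  exact this.congr_deriv (by unfold Pd; field_simp)

theorem Pd_d (κ : ℝ) {h : ℝ} (t : ℝ) :
    HasDerivAt (Pd κ h) (deriv Real.smoothTransition ((t - κ) / h) / h) t := by
  have h0 : DifferentiableAt ℝ Real.smoothTransition ((t - κ) / h) :=
    (Real.smoothTransition.contDiff (n := 1)).differentiable (by simp) _
  have := h0.hasDerivAt.comp t (aff_d κ h t)
  exact this.congr_deriv (by ring)

theorem Pd_sm (κ h : ℝ) : Sm (Pd κ h) :=
  Real.smoothTransition.contDiff.comp ((contDiff_id.sub contDiff_const).div_const _)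

theorem Ph_sm (κ h : ℝ) : Sm (Ph κ h) :=
  contDiff_const.mul (TT_sm.comp ((contDiff_id.sub contDiff_const).div_const _))

theorem Ph_nn (κ : ℝ) {h : ℝ} (hh : 0 < h) (t : ℝ) : 0 ≤ Ph κ h t := mul_nonneg hh.le (TT_nn _)

theorem Ph_le (κ : ℝ) {h : ℝ} (hh : 0 < h) (t : ℝ) : Ph κ h t ≤ max (t - κ) 0 := by
  calc Ph κ h t ≤ h * max ((t - κ) / h) 0 := mul_le_mul_of_nonneg_left (TT_le _) hh.le
    _ = _ := by rw [mul_max_of_nonneg _ _ hh.le, mul_zero, mul_div_cancel₀ _ hh.ne']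

theorem Ph_ge (κ : ℝ) {h : ℝ} (hh : 0 < h) (t : ℝ) : max (t - κ - h) 0 ≤ Ph κ h t := by
  refine max_le ?_ (Ph_nn κ hh t)
  have := mul_le_mul_of_nonneg_left (TT_ge ((t - κ) / h)) hh.le
  rw [mul_sub, mul_div_cancel₀ _ hh.ne', mul_one] at this
  exact this

theorem Ph_z {κ h : ℝ} (hh : 0 < h) {t : ℝ} (ht : t ≤ κ) : Ph κ h t = 0 := by
  unfold Ph; rw [TT_z (div_nonpos_of_nonpos_of_nonneg lz hh.le), mul_zero]

theorem Pd_01 (κ h t : ℝ) : 0 ≤ Pd κ h t ∧ Pd κ h t ≤ 1 :=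
  ⟨Real.smoothTransition.nonneg _, Real.smoothTransition.le_one _⟩

theorem Ph_fn {κ h : ℝ} (hh : 0 < h) (hk : k ≤ κ) : Fn (Ph κ h) k 1 where
  sm := Ph_sm κ h
  bd t := by rw [(Ph_d κ hh t).deriv, abs_of_nonneg (Pd_01 _ _ _).1]; exact (Pd_01 _ _ _).2
  z t ht := Ph_z hh (ht.trans hk)

theorem Gq_d (κ : ℝ) {h : ℝ} (hh : 0 < h) (t : ℝ) : HasDerivAt (fun t => Ph κ h t * Pd κ h t)
    (Pd κ h t ^ 2 + TT ((t - κ) / h) * deriv Real.smoothTransition ((t - κ) / h)) t := by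
  have := (Ph_d κ hh t).mul (Pd_d κ (h := h) t)
  exact this.congr_deriv (by unfold Ph; field_simp)

theorem Gq_fn {κ h : ℝ} (hh : 0 < h) (hk : k ≤ κ) : Fn (fun t => Ph κ h t * Pd κ h t) k (1 + LS) where
  sm := (Ph_sm κ h).mul (Pd_sm κ h)
  bd t := by
    have h1 := Pd_01 κ h t
    have h2 := TTS ((t - κ) / h)
    rw [(Gq_d κ hh t).deriv, abs_of_nonneg (add_nonneg (sq_nonneg _) h2.1)]
    nlinarith
  z t ht := by simp [Ph_z hh (ht.trans hk)]

theorem Sbs.cacc (g : Geo n d Ca Γ) (hE : Ell n d Γ A Cb) (h : Sbs n d Γ A x R U q k)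
    {η : Euc n → ℝ} (hη : Sm η) (hc : HasCompactSupport η) (hs : tsupport η ⊆ ball x R)
    {κ e : ℝ} (he : 0 < e) (hk : k ≤ κ) :
    ∫⁻ y, nn(pf η (Ph κ e) U q y) ∂(measW n d Γ) ≤ ofReal (2 + 8 * Cb ^ 4) *
      ∫⁻ y, nn(gradient η y) * nn(Ph κ e (U y)) ∂(measW n d Γ) := by
  have hen := h.energy g hE (Gq_fn he hk) hη hc hs (P := Pd κ e) (Q := Ph κ e) (Pd_sm κ e).continuous
    (Ph_sm κ e).continuous (M := univ) (by simp)
    (fun t _ => by rw [(Gq_d κ he t).deriv]; linarith [(TTS ((t - κ) / e)).1])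
    (fun t _ => by rw [abs_of_nonneg (mul_nonneg (Ph_nn κ he t) (Pd_01 κ e t).1), mul_comm])
  have hm : AEMeasurable (fun y => nn(gradient η y) * nn(Ph κ e (U y))) (measW n d Γ) :=
    (((gr_cont hη).enorm.measurable.pow_const 2).aemeasurable.mul
      (((Ph_sm κ e).continuous.comp_aestronglyMeasurable h.gd.U2.1).enorm.pow_const 2)).mono_ac mW_ac
  calc _ ≤ ∫⁻ y, (2 * (nn(gradient η y) * nn(Ph κ e (U y))) +
        2 * (nn(η y * Pd κ e (U y)) * nn(q y))) ∂(measW n d Γ) := by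
        refine lintegral_mono fun y => ?_
        refine (enorm_add_sq_le _ _).trans (le_of_eq ?_)
        rw [(Ph_d κ he _).deriv, smul_smul, enorm_smul, enorm_smul, mul_pow, mul_pow]
        ring
    _ = 2 * (∫⁻ y, nn(gradient η y) * nn(Ph κ e (U y)) ∂(measW n d Γ)) +
        2 * ∫⁻ y, nn(η y * Pd κ e (U y)) * nn(q y) ∂(measW n d Γ) := by
        rw [lintegral_add_left' (hm.const_mul 2), lintegral_const_mul' _ _ nz,
          lintegral_const_mul' _ _ nz]
    _ ≤ _ := add_le_add le_rfl (mul_le_mul' le_rfl hen)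
    _ = _ := by
        have := hE.c
        rw [ofReal_add nz pz,
          show 8 * Cb ^ 4 = 2 * (4 * Cb ^ 4) by ring, ofReal_mul (p := 2) nz,
          ofReal_ofNat]
        ring

/-- radial bump -/
theorem bumpb (x : Euc n) {a b : ℝ} (ha : 0 ≤ a) (hab : a < b) : ∃ η : Euc n → ℝ, Sm η ∧
    HasCompactSupport η ∧ (∀ y, 0 ≤ η y ∧ η y ≤ 1) ∧ (∀ y ∈ closedBall x a, η y = 1) ∧
    tsupport η ⊆ closedBall x b ∧ ∀ y, ‖gradient η y‖ ≤ 3 * LS / (b - a) := by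
  obtain ⟨χ, h1, h2, h3, h4, h5⟩ := cutoff ({x} : Set (Euc n)) hab
  have hs : tsupport (fun y => 1 - χ y) ⊆ closedBall x b := by
    refine closure_minimal (fun y hy => ?_) isClosed_closedBall
    by_contra hc
    rw [mem_closedBall, not_le] at hc
    exact hy (by show 1 - χ y = 0; rw [h4 y (by rw [infDist_singleton]; exact hc.le), sub_self])
  refine ⟨fun y => 1 - χ y, contDiff_const.sub h1, ?_, fun y => ⟨by linarith [(h2 y).2], by linarith [(h2 y).1]⟩,
    fun y hy => ?_, hs, fun y => ?_⟩
  · exact (isCompact_closedBall x b).of_isClosed_subset (isClosed_tsupport _) hs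
  · show 1 - χ y = 1
    rw [h3 y (by rw [infDist_singleton]; exact hy)]; simp
  · have : gradient (fun y => 1 - χ y) y = - gradient χ y := by
      unfold gradient
      rw [fderiv_const_sub, map_neg]
    rw [this, norm_neg]; exact h5 y

/-- Faber-Krahn type inequality on a ball -/
def FK (n : ℕ) (d : ℝ) (Γ : Set (Euc n)) (x : Euc n) (R V : ℝ) (K : ℝ≥0) : Prop :=
  ∀ φ : Euc n → ℝ, Sm φ → HasCompactSupport φ → tsupport φ ⊆ ball x R \ Γ →
  ∀ t, 0 < t → t ≤ R → ∀ Z, MeasurableSet Z → ∫⁻ y in Z, nn(φ y) ∂(measW n d Γ) ≤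
    K * (ofReal (t ^ 2) * (∫⁻ y, nn(gradient φ y) ∂(measW n d Γ)) +
      ofReal ((R / t) ^ n / V) * measW n d Γ Z * ∫⁻ y, nn(φ y) ∂(measW n d Γ))

theorem FK.abs {V : ℝ} {K : ℝ≥0} (hFK : FK n d Γ x R V K) {f : Euc n → ℝ} {p : Euc n → Euc n}
    (h : InH0 n d Γ (ball x R) f p) (hf : AEStronglyMeasurable f (measW n d Γ))
    (hp : AEStronglyMeasurable p (measW n d Γ)) (hfin : ∫⁻ y, nn(f y) ∂(measW n d Γ) < ⊤)
    {Z : Set (Euc n)} (hZ : MeasurableSet Z) (hfZ : ∀ᵐ y ∂(measW n d Γ), y ∉ Z → f y = 0) {t : ℝ} (ht : 0 < t)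
    (htR : t ≤ R) (hsm : 4 * (K * (ofReal ((R / t) ^ n / V) * measW n d Γ Z)) ≤ 1 / 2) :
    ∫⁻ y, nn(f y) ∂(measW n d Γ) ≤ 8 * K * ofReal (t ^ 2) * ∫⁻ y, nn(p y) ∂(measW n d Γ) := by
  set m := measW n d Γ
  set X := ofReal ((R / t) ^ n / V) * m Z
  set If := ∫⁻ y, nn(f y) ∂m with hIf
  set Ip := ∫⁻ y, nn(p y) ∂m
  have hIZ : If = ∫⁻ y in Z, nn(f y) ∂m := by
    rw [hIf, ← lintegral_indicator hZ]
    refine lintegral_congr_ae (hfZ.mono fun y hy => ?_)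
    by_cases h1 : y ∈ Z
    · simp [h1]
    · simp [h1, hy h1]
  have h1 : If ≤ 4 * K * ofReal (t ^ 2) * Ip + 1 / 2 * If := by
    refine ENNReal.le_of_forall_pos_le_add fun ε hε _ => ?_
    obtain ⟨εc, he, hk⟩ := enr_pick (K := 2 + 4 * K * ofReal (t ^ 2) + 1 / 2) (ε := ε)
      (by exact_mod_cast hε) (by finiteness)
    obtain ⟨φ, a1, a2, a3, a4, a5⟩ := h εc he
    have hφ := a1.continuous.aestronglyMeasurable (μ := m)
    have b1 : If ≤ 2 * (∫⁻ y in Z, nn(φ y) ∂m) + 2 * εc := by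
      rw [hIZ]
      calc _ ≤ ∫⁻ y in Z, (2 * nn(φ y) + 2 * nn(φ y - f y)) ∂m := by
            refine lintegral_mono fun y => ?_
            have := enorm_sub_sq_le (φ y) (φ y - f y)
            rwa [sub_sub_cancel] at this
        _ ≤ _ := by
            rw [lintegral_add_left' ((hφ.enorm.pow_const 2).const_mul 2).restrict, lintegral_const_mul' _ _ nz,
              lintegral_const_mul' _ _ nz]
            refine add_le_add le_rfl (mul_le_mul' le_rfl ?_)
            exact (lintegral_mono' Measure.restrict_le_self le_rfl).trans a4
    have b2 : ∫⁻ y, nn(φ y) ∂m ≤ 2 * If + 2 * εc := by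
      calc _ ≤ ∫⁻ y, (2 * nn(f y) + 2 * nn(φ y - f y)) ∂m := by
            refine lintegral_mono fun y => ?_
            have := enorm_add_sq_le (f y) (φ y - f y)
            rwa [add_sub_cancel] at this
        _ ≤ _ := by
            rw [lintegral_add_left' ((hf.enorm.pow_const 2).const_mul 2), lintegral_const_mul' _ _ nz,
              lintegral_const_mul' _ _ nz]
            exact add_le_add le_rfl (mul_le_mul' le_rfl a4)
    have b3 : ∫⁻ y, nn(gradient φ y) ∂m ≤ 2 * Ip + 2 * εc := by
      calc _ ≤ ∫⁻ y, (2 * nn(p y) + 2 * nn(gradient φ y - p y)) ∂m := by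
            refine lintegral_mono fun y => ?_
            have := enorm_add_sq_le (p y) (gradient φ y - p y)
            rwa [add_sub_cancel] at this
        _ ≤ _ := by
            rw [lintegral_add_left' ((hp.enorm.pow_const 2).const_mul 2), lintegral_const_mul' _ _ nz,
              lintegral_const_mul' _ _ nz]
            exact add_le_add le_rfl (mul_le_mul' le_rfl a5)
    have b4 := hFK φ a1 a2 a3 t ht htR Z hZ
    calc If ≤ 2 * (K * (ofReal (t ^ 2) * (2 * Ip + 2 * εc) + X * (2 * If + 2 * εc))) + 2 * εc := by
          refine b1.trans (add_le_add (mul_le_mul' le_rfl (b4.trans ?_)) le_rfl)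
          exact mul_le_mul' le_rfl (add_le_add (mul_le_mul' le_rfl b3) (mul_le_mul' le_rfl b2))
      _ = 4 * K * ofReal (t ^ 2) * Ip + 4 * (K * X) * If +
          (2 + 4 * K * ofReal (t ^ 2) + 4 * (K * X)) * εc := by ring
      _ ≤ 4 * K * ofReal (t ^ 2) * Ip + 1 / 2 * If + (2 + 4 * K * ofReal (t ^ 2) + 1 / 2) * εc := by
          gcongr
      _ ≤ _ := add_le_add le_rfl hk
  have h2 : If = 1 / 2 * If + 1 / 2 * If := by
    rw [← add_mul, ENNReal.div_add_div_same, one_add_one_eq_two, ENNReal.div_self nz nz, one_mul]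
  have hfin2 : 1 / 2 * If ≠ ⊤ := by finiteness
  have h3 : 1 / 2 * If ≤ 4 * K * ofReal (t ^ 2) * Ip := by
    refine (ENNReal.add_le_add_iff_right hfin2).1 ?_
    rw [← h2]; exact h1
  calc If = 2 * (1 / 2 * If) := by
        rw [← mul_assoc, one_div, ENNReal.mul_inv_cancel nz nz, one_mul]
    _ ≤ 2 * (4 * K * ofReal (t ^ 2) * Ip) := mul_le_mul' le_rfl h3
    _ = _ := by ring
end

section
variable {n : ℕ} {d Ca Cb : ℝ} {Γ : Set (Euc n)} {A : Euc n → Euc n →L[ℝ] Euc n}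
  {x : Euc n} {R k N : ℝ} {U : Euc n → ℝ} {q : Euc n → Euc n} {F : ℝ → ℝ}

theorem Sbs.mono (h : Sbs n d Γ A x R U q k) {R' k' : ℝ} (hR : R' ≤ R) (hk : k ≤ k') :
    Sbs n d Γ A x R' U q k' where
  gd := ⟨h.gd.U2, h.gd.q2, h.gd.qm, h.gd.gr, fun φ a b c =>
    h.gd.sol φ a b (c.trans (sdiff_subset_sdiff_left (ball_subset_ball hR)))⟩
  tr := by
    have := ae_mono (Measure.restrict_mono (inter_subset_inter_right _ (ball_subset_ball hR)) le_rfl) h.tr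
    exact Filter.Eventually.mono this fun z ⟨τ, h1, h2⟩ => ⟨τ, h1.trans hk, h2⟩

theorem en_mono {a b : ℝ} (ha : 0 ≤ a) (hab : a ≤ b) : nn(a) ≤ nn(b) := by
  refine pow_le_pow_left' ?_ 2
  rw [Real.enorm_eq_ofReal ha, Real.enorm_eq_ofReal (ha.trans hab)]
  exact ofReal_le_ofReal hab

theorem Sbs.hm (h : Sbs n d Γ A x R U q k) (κ : ℝ) :
    AEMeasurable (fun y => nn(max (U y - κ) 0)) (measW n d Γ) :=
  (((h.gd.U2.1.aemeasurable.sub_const κ).max aemeasurable_const).enorm.pow_const 2).mono_ac mW_ac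

theorem Sbs.step (g : Geo n d Ca Γ) (hE : Ell n d Γ A Cb) (h : Sbs n d Γ A x R U q k) {V : ℝ} (hV : 0 < V)
    {K : ℝ≥0} (hFK : FK n d Γ x R V K) {a b κ e t Y : ℝ} (ha : 0 < a) (hab : a < b) (hb : b ≤ R) (hκ : k ≤ κ)
    (he : 0 < e) (ht : 0 < t) (htR : t ≤ R) (hY0 : 0 ≤ Y)
    (hY : ∫⁻ y in ball x b, nn(max (U y - κ) 0) ∂(measW n d Γ) ≤ ofReal Y)
    (hs : 8 * K * ((R / t) ^ n / V) * (Y / e ^ 2) ≤ 1) :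
    ∫⁻ y in ball x a, nn(max (U y - (κ + 2 * e)) 0) ∂(measW n d Γ) ≤
      ofReal (8 * K * t ^ 2 * ((2 + 8 * Cb ^ 4) * ((6 * LS / (b - a)) ^ 2 * Y))) := by
  obtain ⟨η, h1, h2, h3, h4, h5, h6⟩ := bumpb x ha.le (show a < (a + b) / 2 by linarith)
  set m := measW n d Γ
  have hc1 := hE.c
  have hR : 0 < R := by linarith
  have hsb : tsupport η ⊆ ball x b := h5.trans (closedBall_subset_ball lz)
  have hsR : tsupport η ⊆ ball x R := hsb.trans (ball_subset_ball hb)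
  have hF : Fn (Ph (κ + e) e) k 1 := Ph_fn he lz
  have hle : ∀ y, Ph (κ + e) e (U y) ≤ max (U y - κ) 0 := fun y =>
    (Ph_le _ he _).trans (max_le_max lz le_rfl)
  have hin := h.h0 g hF h1 h2 hsR
  have hcac := h.cacc g hE h1 h2 hsR he (show k ≤ κ + e by linarith)
  set Z := toMeasurable m (ball x b ∩ {y | κ + e < U y})
  have hmZ : m Z ≤ ofReal (Y / e ^ 2) := by
    rw [measure_toMeasurable, inter_comm, ← Measure.restrict_apply' measurableSet_ball]
    have hch := mul_meas_ge_le_lintegral₀ ((h.hm κ).restrict (s := ball x b)) (nn(e))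
    have hsub : {y | κ + e < U y} ⊆ {y | nn(e) ≤ nn(max (U y - κ) 0)} := fun y hy => by
      have hy' : κ + e < U y := hy
      exact en_mono he.le ((by linarith : e ≤ U y - κ).trans (le_max_left _ _))
    have := (mul_le_mul' le_rfl (measure_mono hsub)).trans (hch.trans hY)
    rw [ofReal_div_of_pos pz, ENNReal.le_div_iff_mul_le (Or.inl pz) (Or.inl (by simp)), mul_comm]
    rwa [Real.enorm_eq_ofReal he.le, ← ofReal_pow he.le] at this
  have hfle : ∀ y, nn(η y * Ph (κ + e) e (U y)) ≤ (ball x b).indicator (fun y => nn(max (U y - κ) 0)) y := by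
    intro y
    by_cases hy : y ∈ ball x b
    · rw [indicator_of_mem hy]
      have hp := Ph_nn (κ + e) he (U y)
      refine en_mono (mul_nonneg (h3 y).1 hp) ?_
      nlinarith [hle y, (h3 y).2]
    · rw [image_eq_zero_of_notMem_tsupport fun hh => hy (hsb hh)]; simp
  have hfm : AEStronglyMeasurable (fun y => η y * Ph (κ + e) e (U y)) m :=
    (h1.continuous.aestronglyMeasurable.mul ((Ph_sm _ _).continuous.comp_aestronglyMeasurable h.gd.U2.1)).mono_ac mW_ac
  have hfi : ∫⁻ y, nn(η y * Ph (κ + e) e (U y)) ∂m < ⊤ := by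
    refine (lintegral_mono hfle).trans_lt ?_
    rw [lintegral_indicator measurableSet_ball]
    exact hY.trans_lt ofReal_lt_top
  have hfk := hFK.abs hin hfm ((pf_memLp hF h.gd.U2 h.gd.q2 h1 h2).1.mono_ac mW_ac) hfi
    (measurableSet_toMeasurable m (ball x b ∩ {y | κ + e < U y})) (Eventually.of_forall fun y hy => ?_) ht htR ?_
  · calc _ ≤ ∫⁻ y in ball x a, nn(η y * Ph (κ + e) e (U y)) ∂m := by
          refine setLIntegral_mono' measurableSet_ball fun y hy => ?_
          rw [h4 y (ball_subset_closedBall hy), one_mul]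
          refine en_mono (le_max_right _ _) (le_trans (max_le_max ?_ le_rfl) (Ph_ge _ he _))
          linarith
      _ ≤ ∫⁻ y, nn(η y * Ph (κ + e) e (U y)) ∂m := lintegral_mono' Measure.restrict_le_self le_rfl
      _ ≤ _ := hfk
      _ ≤ 8 * K * ofReal (t ^ 2) * (ofReal (2 + 8 * Cb ^ 4) *
          (ofReal ((6 * LS / (b - a)) ^ 2) * ofReal Y)) := by
          refine mul_le_mul' le_rfl (hcac.trans (mul_le_mul' le_rfl ?_))
          calc _ ≤ ∫⁻ y, (ball x b).indicator (fun y => ofReal ((6 * LS / (b - a)) ^ 2) *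
                nn(max (U y - κ) 0)) y ∂m := by
                refine lintegral_mono fun y => ?_
                by_cases hy : y ∈ ball x b
                · rw [indicator_of_mem hy]
                  refine mul_le_mul' ?_ (en_mono (Ph_nn _ he _) (hle y))
                  rw [← ofReal_norm, ← ofReal_pow (norm_nonneg _)]
                  refine ofReal_le_ofReal (pow_le_pow_left₀ (norm_nonneg _) ((h6 y).trans (le_of_eq ?_)) 2)
                  rw [div_eq_div_iff lz lz]; ring
                · rw [gr_out fun hh => hy (hsb hh)]; simp
            _ ≤ _ := by
                rw [lintegral_indicator measurableSet_ball, lintegral_const_mul' _ _ ofReal_ne_top]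
                exact mul_le_mul' le_rfl hY
      _ = _ := by
          rw [← ofReal_mul pz, ← ofReal_mul pz,
            ofReal_mul (p := 8 * K * t ^ 2) pz, ofReal_mul (p := 8 * K) pz,
            ofReal_mul (p := 8) pz, ofReal_coe_nnreal, ofReal_ofNat]
  · by_cases hyt : y ∈ tsupport η
    · have hy2 : ¬ κ + e < U y := fun hh => hy (subset_toMeasurable _ _ ⟨hsb hyt, hh⟩)
      rw [Ph_z he (not_lt.1 hy2), mul_zero]
    · rw [image_eq_zero_of_notMem_tsupport hyt, zero_mul]
  · calc _ ≤ 4 * (ofReal K * (ofReal ((R / t) ^ n / V) * ofReal (Y / e ^ 2))) := by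
          rw [ofReal_coe_nnreal]
          gcongr
      _ = ofReal (4 * (K * (((R / t) ^ n / V) * (Y / e ^ 2)))) := by
          rw [ofReal_mul (p := 4) pz, ofReal_mul (p := K) pz,
            ofReal_mul (p := (R / t) ^ n / V) pz, ofReal_ofNat]
      _ ≤ ofReal (1 / 2) := ofReal_le_ofReal lz
      _ = 1 / 2 := by rw [ofReal_div_of_pos nz]; simp

theorem dg1 (n : ℕ) (K : ℝ≥0) (Cb : ℝ) (hC : 1 ≤ Cb) : ∃ ca : ℝ, 0 < ca ∧ ∀ (d Ca : ℝ) (Γ : Set (Euc n))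
    (A : Euc n → Euc n →L[ℝ] Euc n) (x : Euc n) (R V k : ℝ) (U : Euc n → ℝ) (q : Euc n → Euc n),
    Geo n d Ca Γ → Ell n d Γ A Cb → 0 < R → 0 < V → FK n d Γ x R V K → Sbs n d Γ A x R U q k →
    ∀ H, 0 < H → ∫⁻ y in ball x R, nn(max (U y - k) 0) ∂(measW n d Γ) ≤ ofReal (ca * H ^ 2 * V) →
    ∀ᵐ y, y ∈ ball x (R / 2) → U y ≤ k + H := by
  have hLS := LS1
  set Cc := 128 * K * ((2 + 8 * Cb ^ 4) * (6 * LS) ^ 2) with hCc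
  have hCc0 : 0 ≤ Cc := by positivity
  set ε := 1 / (1 + Cc * 2 ^ (n + 2)) with hε
  have hε0 : 0 < ε := by positivity
  have hε1 : ε ≤ 1 := by rw [hε, div_le_one pz]; linarith [show 0 ≤ Cc * 2 ^ (n + 2) by positivity]
  have hεC : Cc * ε ^ 2 ≤ 1 / 2 ^ (n + 2) := by
    have h1 : Cc * 2 ^ (n+2) * ε ≤ 1 := by
      rw [hε, mul_one_div, div_le_one pz]; linarith
    rw [le_div_iff₀ pz]
    nlinarith [show 0 ≤ Cc * 2 ^ (n+2) * ε by positivity]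
  refine ⟨ε ^ n / (128 * (K + 1)), by positivity, ?_⟩
  set ca := ε ^ n / (128 * ((K:ℝ) + 1)) with hca
  have hc0 : 0 < ca := by positivity
  intro d Ca Γ A x R V k U q g hE hR hV hFK h H hH h0
  set θ : ℝ := 1 / 2 ^ (n + 2) with hθ
  have hθ0 : 0 < θ := by positivity
  set p : ℕ → ℝ := fun j => (1 / 2) ^ j with hp
  have hp0 : ∀ j, 0 < p j := fun j => by positivity
  have hp1 : ∀ j, p (j + 1) = p j / 2 := fun j => by simp only [hp, pow_succ]; ring
  have key : ∀ j : ℕ, ∫⁻ y in ball x (R * (1 / 2 + p j / 2)), nn(max (U y - (k + H * (1 - p j))) 0)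
      ∂(measW n d Γ) ≤ ofReal (ca * θ ^ j * H ^ 2 * V) := by
    intro j
    induction j with
    | zero => simpa [hp, ← two_mul] using h0
    | succ j ih =>
      have hpj := hp0 j
      have hpj1 : p j ≤ 1 := pow_le_one₀ nz nz
      have hst := h.step g hE hV hFK (a := R * (1 / 2 + p (j + 1) / 2)) (b := R * (1 / 2 + p j / 2))
        (κ := k + H * (1 - p j)) (e := H * p j / 4) (t := R * ε * p j) (Y := ca * θ ^ j * H ^ 2 * V)
        (by rw [hp1]; positivity) (by rw [hp1]; gcongr; linarith) (by nlinarith)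
        (by nlinarith) pz pz
        (by rw [mul_assoc]; nlinarith [mul_le_one₀ hε1 hpj.le hpj1]) pz ih ?_
      · have e1 : k + H * (1 - p j) + 2 * (H * p j / 4) = k + H * (1 - p (j + 1)) := by rw [hp1]; ring
        rw [e1] at hst
        refine hst.trans (ofReal_le_ofReal ?_)
        have e2 : R * (1 / 2 + p j / 2) - R * (1 / 2 + p (j + 1) / 2) = R * p j / 4 := by rw [hp1]; ring
        rw [e2]
        have e3 : 8 * K * (R * ε * p j) ^ 2 * ((2 + 8 * Cb ^ 4) * ((6 * LS / (R * p j / 4)) ^ 2 *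
            (ca * θ ^ j * H ^ 2 * V))) = (Cc * ε ^ 2) * (ca * θ ^ j * H ^ 2 * V) := by
          rw [hCc]; field_simp; ring
        rw [e3]
        calc _ ≤ θ * (ca * θ ^ j * H ^ 2 * V) := mul_le_mul_of_nonneg_right hεC pz
          _ = _ := by rw [pow_succ]; ring
      · have e4 : θ ^ j = (p j) ^ n * p j ^ 2 := by
          simp only [hp, hθ]
          rw [← pow_mul, ← pow_mul, ← pow_add, div_pow, div_pow, one_pow, one_pow, ← pow_mul]
          congr 2; ring
        have e5 : 8 * K * ((R / (R * ε * p j)) ^ n / V) * (ca * θ ^ j * H ^ 2 * V / (H * p j / 4) ^ 2) =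
            128 * K * ca / ε ^ n := by
          rw [e4, mul_assoc R, ← div_div R R, div_self hR.ne', div_pow, one_pow, mul_pow]; field_simp; ring
        rw [e5, hca, div_le_one pz, mul_div_assoc', div_le_iff₀ pz]
        nlinarith [show 0 < ε ^ n by positivity]
  have hlim : ∫⁻ y in ball x (R / 2), nn(max (U y - (k + H)) 0) ∂(measW n d Γ) = 0 := by
    refine le_antisymm ?_ zero_le
    have ht : Tendsto (fun j : ℕ => ofReal (ca * θ ^ j * H ^ 2 * V)) atTop (𝓝 0) := by
      rw [← ofReal_zero]
      refine ENNReal.tendsto_ofReal ?_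
      have hl : θ < 1 := by
        rw [hθ, div_lt_one pz]; exact one_lt_pow₀ nz (by omega)
      have := (((tendsto_pow_atTop_nhds_zero_of_lt_one hθ0.le hl).const_mul ca).mul_const (H ^ 2)).mul_const V
      simpa using this
    refine ge_of_tendsto ht (Eventually.of_forall fun j => le_trans ?_ (key j))
    have hpj := hp0 j
    calc _ ≤ ∫⁻ y in ball x (R / 2), nn(max (U y - (k + H * (1 - p j))) 0) ∂(measW n d Γ) := by
          refine lintegral_mono fun y => en_mono (le_max_right _ _) (max_le_max ?_ le_rfl)
          nlinarith
      _ ≤ _ := lintegral_mono_set (ball_subset_ball (by nlinarith))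
  rw [lintegral_eq_zero_iff' (h.hm _).restrict] at hlim
  have h2 := g.ac.ae_le ((ae_restrict_iff' measurableSet_ball).1 hlim)
  filter_upwards [h2] with y hy hyb
  have := hy hyb
  simp only [Pi.zero_apply, ne_eq, OfNat.ofNat_ne_zero, not_false_eq_true, pow_eq_zero_iff, enorm_eq_zero] at this
  have h3 := le_max_left (U y - (k + H)) 0
  linarith
end

section
variable {n : ℕ} {d Ca Cb : ℝ} {Γ : Set (Euc n)} {A : Euc n → Euc n →L[ℝ] Euc n}
  {x : Euc n} {R k N : ℝ} {U : Euc n → ℝ} {q : Euc n → Euc n} {F : ℝ → ℝ}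

theorem Geo.w_cmp (g : Geo n d Ca Γ) {y y' : Euc n} {t : ℝ} (ht : 0 < t) (hy : 2 * t ≤ infDist y Γ)
    (h : dist y y' ≤ t) : ofReal (weightW n d Γ y) ≤
      ofReal (2 ^ n) * ofReal (weightW n d Γ y') := by
  rw [← ofReal_mul pz]
  apply ofReal_le_ofReal
  have h1 := infDist_le_infDist_add_dist (s := Γ) (x := y) (y := y')
  have h2 := infDist_le_infDist_add_dist (s := Γ) (x := y') (y := y)
  rw [dist_comm] at h2
  have hy' : y' ∉ Γ := (g.cl.notMem_iff_infDist_pos g.ne).2 lz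
  have h3 := g.w_ge hy' (ρ := 2 * infDist y Γ) lz
  have h0 : 0 ≤ infDist y Γ := by linarith
  rw [Real.mul_rpow nz h0] at h3
  have h4 : (2:ℝ) ^ n * 2 ^ (d + 1 - (n:ℝ)) = 2 ^ (d+1) := by
    rw [← Real.rpow_natCast, ← Real.rpow_add nz]; congr 1; ring
  have h5 : (1:ℝ) ≤ 2 ^ (d+1) := Real.one_le_rpow nz (by linarith [g.hd])
  have h6 : 0 ≤ weightW n d Γ y := Real.rpow_nonneg h0 _
  calc weightW n d Γ y ≤ 2 ^ (d+1) * weightW n d Γ y := by nlinarith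
    _ = 2 ^ n * (2 ^ (d + 1 - (n:ℝ)) * weightW n d Γ y) := by rw [← h4]; ring
    _ ≤ _ := by gcongr; exact h3

theorem Geo.shift (g : Geo n d Ca Γ) {φ : Euc n → ℝ} (hφ : Sm φ) {t : ℝ} (ht : 0 < t)
    {S : Set (Euc n)} (hS : MeasurableSet S) (hd : ∀ y ∈ S, 2 * t ≤ infDist y Γ) {h : Euc n} (hh : ‖h‖ ≤ t) :
    ∫⁻ y in S, nn(φ (y + h) - φ y) ∂(measW n d Γ) ≤
      ofReal (2 * t ^ 2) * (ofReal (2 ^ n) * ∫⁻ y, nn(gradient φ y) ∂(measW n d Γ)) := by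
  have hφ1 : ContDiff ℝ 1 φ := hφ.of_le (by exact_mod_cast le_top)
  set W : Euc n → ℝ≥0∞ := fun y => ofReal (weightW n d Γ y) with hW
  have hWm : Measurable W := wW_em
  set G : Euc n → ℝ≥0∞ := fun y => nn(fderiv ℝ φ y)
  have hGc : Continuous G := (ENNReal.continuous_pow 2).comp (hφ1.continuous_fderiv one_ne_zero).enorm
  simp_rw [ngr']
  rw [lmU hGc.measurable.aemeasurable, lmW (by
    have := hφ.continuous
    exact ((ENNReal.continuous_pow 2).comp (f := fun y => ‖φ (y + h) - φ y‖ₑ) (by fun_prop)).measurable.aemeasurable) _ hS]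
  have e0 : ∀ (y : Euc n) (τ : ℝ), (y - h) + τ • ((y + h) - (y - h)) = y + (2 * τ - 1) • h := fun y τ => by module
  have hc2 : Measurable (Function.uncurry fun (y : Euc n) (τ : ℝ) => W (y + (2 * τ - 1) • h) * G (y + (2 * τ - 1) • h)) := by
    have : Measurable fun p : Euc n × ℝ => p.1 + (2 * p.2 - 1) • h := (by fun_prop : Continuous _).measurable
    exact (hWm.comp this).mul (hGc.measurable.comp this)
  calc _ ≤ ∫⁻ y in S, ofReal (2 * t ^ 2) * ∫⁻ τ in Ioc (1/2:ℝ) 1, ofReal (2 ^ n) *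
        (W (y + (2 * τ - 1) • h) * G (y + (2 * τ - 1) • h)) := by
        refine setLIntegral_mono' hS fun y hy => ?_
        have h1 := poinc_pt hφ1 (y - h) (y + h) (R := t) (by
          rw [dist_eq_norm, show y - h - (y + h) = -(2:ℝ) • h by module, norm_smul]; simp; linarith)
        rw [e0, show (2 * (1/2:ℝ) - 1) • h = 0 by norm_num, add_zero] at h1
        simp_rw [e0] at h1
        refine (mul_le_mul' le_rfl h1).trans ?_
        rw [mul_left_comm]
        refine mul_le_mul' le_rfl ?_
        rw [← lintegral_const_mul' _ _ ofReal_ne_top]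
        refine setLIntegral_mono' measurableSet_Ioc fun τ hτ => ?_
        rw [← mul_assoc]
        refine mul_le_mul' (g.w_cmp ht (hd y hy) ?_) le_rfl
        rw [dist_eq_norm, sub_add_cancel_left, norm_neg, norm_smul]
        calc _ ≤ 1 * ‖h‖ := by
              gcongr; rw [Real.norm_eq_abs, abs_le]; constructor <;> linarith [hτ.1, hτ.2]
          _ ≤ t := by linarith
    _ ≤ ofReal (2 * t ^ 2) * (ofReal (2 ^ n) * ∫⁻ y, ∫⁻ τ in Ioc (1/2:ℝ) 1, 
        (W (y + (2 * τ - 1) • h) * G (y + (2 * τ - 1) • h))) := by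
        simp_rw [lintegral_const_mul' _ _ ofReal_ne_top]
        exact mul_le_mul' le_rfl (mul_le_mul' le_rfl (setLIntegral_le_lintegral _ _))
    _ ≤ _ := by
        refine mul_le_mul' le_rfl (mul_le_mul' le_rfl ?_)
        rw [lintegral_lintegral_swap hc2.aemeasurable]
        have : ∀ τ : ℝ, ∫⁻ y, (W (y + (2 * τ - 1) • h) * G (y + (2 * τ - 1) • h)) = ∫⁻ y, W y * G y := fun τ =>
          lintegral_add_right_eq_self (fun y => W y * G y) _
        simp_rw [this]
        rw [lintegral_const, Measure.restrict_apply MeasurableSet.univ, univ_inter, Real.volume_Ioc]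
        refine mul_le_of_le_one_right zero_le ?_
        rw [ofReal_le_one]; norm_num

theorem Geo.bulk (g : Geo n d Ca Γ) {φ : Euc n → ℝ} (hφ : Sm φ) {t : ℝ} (ht : 0 < t)
    {S : Set (Euc n)} (hS : MeasurableSet S) (hd : ∀ y ∈ S, 2 * t ≤ infDist y Γ) :
    volume (ball (0:Euc n) t) * ∫⁻ y in S, nn(φ y) ∂(measW n d Γ) ≤
      volume (ball (0:Euc n) t) * (2 * (ofReal (2 * t ^ 2) * (ofReal (2 ^ n) *
        ∫⁻ y, nn(gradient φ y) ∂(measW n d Γ)))) +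
      2 * (ofReal (2 ^ n) * (∫⁻ y, nn(φ y) ∂(measW n d Γ)) * volume S) := by
  have hc := hφ.continuous
  have hc2 : Continuous fun p : Euc n × Euc n => nn(φ (p.2 + p.1)) := by
    exact (ENNReal.continuous_pow 2).comp (f := fun p : Euc n × Euc n => ‖φ (p.2 + p.1)‖ₑ) (by fun_prop)
  have hc3 : Continuous fun y => nn(φ y) := (ENNReal.continuous_pow 2).comp hc.enorm
  set W : Euc n → ℝ≥0∞ := fun y => ofReal (weightW n d Γ y) with hW
  have hWm : Measurable W := wW_em
  calc _ = ∫⁻ h in ball (0:Euc n) t, ∫⁻ y in S, nn(φ y) ∂(measW n d Γ) := by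
        rw [lintegral_const, Measure.restrict_apply MeasurableSet.univ, univ_inter, mul_comm]
    _ ≤ ∫⁻ h in ball (0:Euc n) t, (2 * (ofReal (2 * t ^ 2) * (ofReal (2 ^ n) *
        ∫⁻ y, nn(gradient φ y) ∂(measW n d Γ))) + 2 * ∫⁻ y in S, W y * nn(φ (y + h))) := by
        refine setLIntegral_mono' measurableSet_ball fun h hh => ?_
        have hc4 : Measurable fun y => nn(φ (y + h)) := (hc2.comp (Continuous.prodMk_right h)).measurable
        rw [hW, ← lmW (f := fun y => nn(φ (y + h))) hc4.aemeasurable _ hS]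
        have h1 := g.shift hφ ht hS hd (h := h) (by simpa using (mem_ball.1 hh).le)
        refine le_trans ?_ (add_le_add (mul_le_mul' le_rfl h1) le_rfl)
        rw [← lintegral_const_mul' _ _ ENNReal.ofNat_ne_top, ← lintegral_const_mul' _ _ ENNReal.ofNat_ne_top,
          ← lintegral_add_right _ (hc4.const_mul 2)]
        refine lintegral_mono fun y => ?_
        have := enorm_sub_sq_le (φ (y + h) - φ y) (φ (y + h))
        rwa [sub_sub_cancel_left, enorm_neg] at this
    _ = volume (ball (0:Euc n) t) * (2 * (ofReal (2 * t ^ 2) * (ofReal (2 ^ n) *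
        ∫⁻ y, nn(gradient φ y) ∂(measW n d Γ)))) +
        2 * ∫⁻ y in S, W y * ∫⁻ h in ball (0:Euc n) t, nn(φ (y + h)) := by
        rw [lintegral_add_left measurable_const, lintegral_const, Measure.restrict_apply MeasurableSet.univ, univ_inter,
          mul_comm, lintegral_const_mul' _ _ ENNReal.ofNat_ne_top, lintegral_lintegral_swap]
        · have hWt : ∀ y, W y ≠ ⊤ := fun y => ofReal_ne_top
          simp_rw [lintegral_const_mul' _ _ (hWt _)]
        · exact ((hWm.comp measurable_snd).mul hc2.measurable).aemeasurable
    _ ≤ _ := by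
        refine add_le_add le_rfl (mul_le_mul' le_rfl ?_)
        rw [← setLIntegral_const]
        refine setLIntegral_mono' hS fun y hy => ?_
        rw [lmU hc3.measurable.aemeasurable, ← lintegral_const_mul' _ _ ofReal_ne_top,
          ← lintegral_const_mul' _ _ ofReal_ne_top,
          ← lintegral_add_left_eq_self (μ := volume) (fun z => ofReal (2 ^ n) * (W z * nn(φ z))) y]
        refine le_trans (setLIntegral_mono' measurableSet_ball fun h hh => ?_) (setLIntegral_le_lintegral _ _)
        rw [← mul_assoc]
        refine mul_le_mul' (g.w_cmp ht (hd y hy) ?_) le_rfl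
        simpa using (mem_ball.1 hh).le

def KB (n : ℕ) : ℝ≥0 := 2 ^ (n + 2) + 2 ^ (n + 1) * (omn n)⁻¹

theorem Geo.bulk2 (g : Geo n d Ca Γ) {φ : Euc n → ℝ} (hφ : Sm φ) {t : ℝ} (ht : 0 < t)
    {S : Set (Euc n)} (hS : MeasurableSet S) (hd : ∀ y ∈ S, 2 * t ≤ infDist y Γ) {wa : ℝ} (hw : 0 < wa)
    (hl : ∀ y ∈ S, wa ≤ weightW n d Γ y) :
    ∫⁻ y in S, nn(φ y) ∂(measW n d Γ) ≤
      KB n * (ofReal (t ^ 2) * (∫⁻ y, nn(gradient φ y) ∂(measW n d Γ)) +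
      ofReal (1 / (t ^ n * wa)) * measW n d Γ S * ∫⁻ y, nn(φ y) ∂(measW n d Γ)) := by
  have h := g.bulk hφ ht hS hd
  set G := ∫⁻ y, nn(gradient φ y) ∂(measW n d Γ)
  set I := ∫⁻ y, nn(φ y) ∂(measW n d Γ)
  set J := ∫⁻ y in S, nn(φ y) ∂(measW n d Γ)
  rw [volb _ ht] at h
  have ho : (omn n : ℝ≥0∞) * ((omn n)⁻¹ : ℝ≥0) = 1 := by
    rw [← ENNReal.coe_mul, mul_inv_cancel₀ (omn_pos n).ne']; simp
  have htn : ofReal (t ^ n)⁻¹ * ofReal (t ^ n) = 1 := by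
    rw [← ofReal_mul pz, inv_mul_cancel₀ pz]; simp
  have hv : volume S ≤ ofReal wa⁻¹ * measW n d Γ S := by
    apply ofr_cancel hw
    rw [measW, withDensity_apply _ hS, ← setLIntegral_const]
    exact setLIntegral_mono' hS fun y hy => ofReal_le_ofReal (hl y hy)
  set a := ofReal (t ^ n)⁻¹
  set b : ℝ≥0∞ := (((omn n)⁻¹ : ℝ≥0) : ℝ≥0∞) with hb
  set c := ofReal (t ^ n)
  set o : ℝ≥0∞ := (omn n : ℝ≥0∞)
  have e : (1:ℝ≥0∞) = (a * c) * (o * b) := by rw [htn, ho, one_mul]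
  have e2 : ofReal (1 / (t ^ n * wa)) = a * ofReal wa⁻¹ := by
    rw [← ofReal_mul pz]; congr 1; field_simp
  have e3 : ofReal (2 ^ n) = 2 ^ n := by rw [ofReal_pow nz]; simp
  have e4 : ofReal (2 * t ^ 2) = 2 * ofReal (t ^ 2) := by
    rw [ofReal_mul nz]; simp
  have e5 : (KB n : ℝ≥0∞) = 2 ^ (n + 2) + 2 ^ (n + 1) * b := by rw [KB, hb]; push_cast; rfl
  calc J = a * b * (o * c * J) := by
        rw [show a * b * (o * c * J) = (a * c) * (o * b) * J by ring, ← e, one_mul]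
    _ ≤ a * b * (o * c * (2 * (ofReal (2 * t ^ 2) * (ofReal (2 ^ n) * G))) +
          2 * (ofReal (2 ^ n) * I * (ofReal wa⁻¹ * measW n d Γ S))) :=
        mul_le_mul' le_rfl (h.trans (add_le_add le_rfl (mul_le_mul' le_rfl (mul_le_mul' le_rfl hv))))
    _ = ((a * c) * (o * b)) * (2 ^ (n + 2) * (ofReal (t ^ 2) * G)) +
          2 ^ (n + 1) * b * (a * ofReal wa⁻¹ * measW n d Γ S * I) := by rw [e3, e4]; ring
    _ ≤ _ := by
        rw [← e, one_mul, e2, e5, mul_add]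
        exact add_le_add (mul_le_mul' le_self_add le_rfl) (mul_le_mul' le_add_self le_rfl)

theorem Geo.fki (g : Geo n d Ca Γ) (hR : 0 < R) {wa : ℝ} (hw : 0 < wa)
    (hl : ∀ y ∈ ball x R, wa ≤ weightW n d Γ y) (hd : ∀ y ∈ ball x R, 2 * R ≤ infDist y Γ) :
    FK n d Γ x R (R ^ n * wa) (KB n) := by
  intro φ hφ hc hs t ht htR Z hZ
  have h := g.bulk2 hφ ht (hZ.inter measurableSet_ball) (fun y hy => by linarith [hd y hy.2]) hw fun y hy => hl y hy.2
  have e : ∫⁻ y in Z, nn(φ y) ∂(measW n d Γ) = ∫⁻ y in Z ∩ ball x R, nn(φ y) ∂(measW n d Γ) := by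
    rw [← lintegral_indicator hZ, ← lintegral_indicator (hZ.inter measurableSet_ball)]
    refine lintegral_congr fun y => ?_
    by_cases hy : y ∈ ball x R
    · by_cases hz : y ∈ Z <;> simp [hz, hy]
    · have : φ y = 0 := image_eq_zero_of_notMem_tsupport fun h => hy (hs h).1
      by_cases hz : y ∈ Z <;> simp [hz, hy, this]
  rw [e]
  refine h.trans (mul_le_mul' le_rfl (add_le_add le_rfl (mul_le_mul' (mul_le_mul' (le_of_eq ?_) (measure_mono inter_subset_left)) le_rfl)))
  congr 1; rw [div_pow]; field_simp

theorem tr_zero {φ : Euc n → ℝ} {z : Euc n} (h : z ∉ tsupport φ) : HasTraceAt φ z 0 := by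
  have h1 : φ =ᶠ[𝓝 z] 0 := notMem_tsupport_iff_eventuallyEq.1 h
  obtain ⟨ε, he, h2⟩ := Metric.eventually_nhds_iff_ball.1 h1
  refine tendsto_const_nhds.congr' ?_
  filter_upwards [Ioo_mem_nhdsGT he] with ρ hρ
  symm
  have : ∫ y in ball z ρ, φ y = 0 := by
    rw [setIntegral_congr_fun (g := fun _ => (0:ℝ)) measurableSet_ball]
    · simp
    · exact fun y hy => h2 y (ball_subset_ball hρ.2.le hy)
  rw [setAverage_eq, this, smul_zero]

theorem Geo.tlay (n : ℕ) (d Ca : ℝ) (hdn : d < (n:ℝ) - 1) : ∃ C : ℝ≥0, ∀ Γ : Set (Euc n), Geo n d Ca Γ →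
    ∀ φ : Euc n → ℝ, Sm φ → HasCompactSupport φ → tsupport φ ⊆ Γᶜ → ∀ x R ρ, 0 < ρ →
    ∫⁻ y in {y | infDist y Γ < ρ} ∩ ball x R, nn(φ y) ∂(measW n d Γ) ≤
      C * (ofReal (ρ ^ 2) * ∫⁻ y in ball x (R + 4 * ρ), nn(gradient φ y) ∂(measW n d Γ)) := by
  obtain ⟨C, hC⟩ := Geo.lay2 n d Ca hdn
  refine ⟨2 * C, fun Γ g φ hφ hc hs x R ρ hρ => ?_⟩
  set m := measW n d Γ
  set L : Set (Euc n) := {y | infDist y Γ < ρ}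
  have hlay : ∀ ψ : Euc n → ℝ, Sm ψ → HasCompactSupport ψ → tsupport ψ ⊆ Γᶜ →
      ∫⁻ y in L ∩ ball x R, nn(max (ψ y - 0) 0) ∂m ≤
        C * ofReal (ρ ^ 2) * ∫⁻ y in ball x (R + 4 * ρ), nn(gradient ψ y) ∂m := fun ψ h1 h2 h3 => by
    refine (hC Γ g ψ (gradient ψ) h1.continuous.locallyIntegrable
      ((gr_cont h1).memLp_of_hasCompactSupport (gr_cs h2))
      (dg_iff.2 fun χ a b _ => ibp h1 a b) x R ρ 0 hρ ?_).trans
      (mul_le_mul' le_rfl (lintegral_mono_set inter_subset_right))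
    refine (ae_restrict_iff' (g.cl.measurableSet.inter measurableSet_ball)).2 (ae_of_all _ fun z hz => ⟨0, le_rfl, tr_zero fun h => (h3 h) hz.1⟩)
  have hn1 := hlay φ hφ hc hs
  have ets : tsupport (fun y => -φ y) = tsupport φ := by
    unfold tsupport; congr 1; ext y; simp
  have hn2 := hlay (fun y => -φ y) hφ.neg (by rw [HasCompactSupport, ets]; exact hc) (by rw [ets]; exact hs)
  have eg : ∀ y, ‖gradient (fun y => -φ y) y‖ₑ = ‖gradient φ y‖ₑ := fun y => by
    rw [ngr', ngr', fderiv_fun_neg, enorm_neg]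
  simp_rw [eg] at hn2
  have hmm : Measurable fun y => nn(max (φ y - 0) 0) :=
    ((ENNReal.continuous_pow 2).comp ((hφ.continuous.sub continuous_const).max continuous_const).enorm).measurable
  calc _ ≤ ∫⁻ y in L ∩ ball x R, (nn(max (φ y - 0) 0) + nn(max (-φ y - 0) 0)) ∂m := by
          refine lintegral_mono fun y => ?_
          rcases le_total 0 (φ y) with h | h <;> simp [h]
    _ ≤ _ := by
          rw [lintegral_add_left hmm]
          refine (add_le_add hn1 hn2).trans (le_of_eq ?_)
          push_cast; ring

theorem Geo.fkb (n : ℕ) (d Ca : ℝ) (hdn : d < (n:ℝ) - 1) : ∃ K : ℝ≥0, ∀ Γ : Set (Euc n), Geo n d Ca Γ →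
    ∀ x ∈ Γ, ∀ R, 0 < R → FK n d Γ x R (R ^ (d + 1)) K := by
  obtain ⟨C, hC⟩ := Geo.tlay n d Ca hdn
  refine ⟨4 * C + KB n, fun Γ g x hx R hR φ hφ hc hs t ht htR Z hZ => ?_⟩
  set m := measW n d Γ
  set G := ∫⁻ y, nn(gradient φ y) ∂m
  set I := ∫⁻ y, nn(φ y) ∂m
  set L : Set (Euc n) := {y | infDist y Γ < 2 * t}
  have hL : MeasurableSet L := measurableSet_lt (by fun_prop) measurable_const
  set S := Z ∩ (ball x R ∩ Lᶜ)
  have hS : MeasurableSet S := hZ.inter (measurableSet_ball.inter hL.compl)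
  have hlow : ∫⁻ y in L ∩ ball x R, nn(φ y) ∂m ≤ 4 * C * (ofReal (t ^ 2) * G) := by
    refine (hC Γ g φ hφ hc (fun y hy => (hs hy).2) x R (2 * t) pz).trans ?_
    rw [mul_pow, ofReal_mul pz, show ofReal ((2:ℝ) ^ 2) = 4 by norm_num]
    calc _ ≤ C * (4 * ofReal (t ^ 2) * G) :=
          mul_le_mul' le_rfl (mul_le_mul' le_rfl (setLIntegral_le_lintegral _ _))
      _ = _ := by ring
  have hup := g.bulk2 hφ ht hS (fun y hy => not_lt.1 hy.2.2) (wa := R ^ (d + 1 - (n:ℝ))) pz (fun y hy => by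
    refine g.w_ge ((g.cl.notMem_iff_infDist_pos g.ne).2 ?_) ?_
    · have : 2 * t ≤ infDist y Γ := not_lt.1 hy.2.2
      linarith
    · exact (infDist_le_dist_of_mem hx).trans (mem_ball.1 hy.2.1).le)
  have e6 : 1 / (t ^ n * R ^ (d + 1 - (n:ℝ))) = (R / t) ^ n / R ^ (d + 1) := by
    have : R ^ (d + 1 - (n:ℝ)) = R ^ (d + 1) / R ^ n := by
      rw [Real.rpow_sub hR, Real.rpow_natCast]
    rw [this, div_pow]; field_simp
  rw [e6] at hup
  have hsp : ∫⁻ y in Z, nn(φ y) ∂m ≤ (∫⁻ y in L ∩ ball x R, nn(φ y) ∂m) + ∫⁻ y in S, nn(φ y) ∂m := by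
    refine le_trans ?_ (lintegral_union_le (μ := m) (fun y => nn(φ y)) (L ∩ ball x R) S)
    rw [← lintegral_indicator hZ, ← lintegral_indicator ((hL.inter measurableSet_ball).union hS)]
    refine lintegral_mono fun y => ?_
    by_cases hz : y ∈ Z
    · by_cases hy : y ∈ ball x R
      · have : y ∈ (L ∩ ball x R) ∪ S := by
          by_cases hl : y ∈ L
          · exact Or.inl ⟨hl, hy⟩
          · exact Or.inr ⟨hz, hy, hl⟩
        rw [indicator_of_mem hz, indicator_of_mem this]
      · have : φ y = 0 := image_eq_zero_of_notMem_tsupport fun h => hy (hs h).1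
        simp [hz, this]
    · rw [indicator_of_notMem hz]; exact zero_le
  refine hsp.trans ((add_le_add hlow hup).trans ?_)
  push_cast
  rw [add_mul]
  refine add_le_add (mul_le_mul' le_rfl le_self_add) (mul_le_mul' le_rfl (add_le_add le_rfl
    (mul_le_mul' (mul_le_mul' le_rfl (measure_mono inter_subset_left)) le_rfl)))
end

section

theorem logfn0 {l : ℝ} (hl : 0 < l) (hl2 : l ≤ 1 / 8) : ∃ (g H : ℝ → ℝ) (N : ℝ), Sm g ∧
    Sm H ∧ (∀ t, HasDerivAt g (H t) t) ∧ (∀ t, |H t| ≤ N) ∧ (∀ t, |deriv H t| ≤ N) ∧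
    (∀ t ≤ 0, g t = 0) ∧ (∀ t ≤ 0, H t = 0) ∧ (∀ t, 0 ≤ H t) ∧ (∀ t ≤ 1, H t ^ 2 ≤ deriv H t) ∧
    ∀ t, 1 - l ≤ t → t ≤ 1 → Real.log (1 / (4 * l)) ≤ g t := by
  set S := Real.smoothTransition
  have hSs : Sm S := Real.smoothTransition.contDiff
  set H : ℝ → ℝ := fun t => S (2 * t) * (1 - S (2 * (t - 1) / l)) / (1 + l - t) with hH
  have H0 : ∀ t ≤ 0, H t = 0 := fun t ht => by
    simp only [hH, S]; rw [Real.smoothTransition.zero_of_nonpos lz]; simp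
  have H2 : ∀ t, 1 + l / 2 ≤ t → H t = 0 := fun t ht => by
    simp only [hH, S]; rw [Real.smoothTransition.one_of_one_le (x := 2 * (t - 1) / l) (by rw [le_div_iff₀ hl]; linarith)]; simp
  have H1 : ∀ t, t ≤ 1 → H t = S (2 * t) * (1 + l - t)⁻¹ := fun t ht => by
    simp only [hH, S]
    rw [Real.smoothTransition.zero_of_nonpos (x := 2 * (t - 1) / l) (div_nonpos_of_nonpos_of_nonneg lz hl.le)]
    rw [sub_zero, mul_one, div_eq_mul_inv]
  have Hs : Sm H := by
    rw [contDiff_iff_contDiffAt]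
    intro t
    by_cases ht : t < 1 + l
    · refine ContDiffAt.div ?_ (by fun_prop) lz
      exact ((hSs.comp (by fun_prop)).mul (contDiff_const.sub (hSs.comp (by fun_prop)))).contDiffAt
    · have : H =ᶠ[𝓝 t] fun _ => 0 := by
        filter_upwards [lt_mem_nhds (show 1 + l / 2 < t by linarith)] with s hs using H2 s hs.le
      exact (contDiffAt_const).congr_of_eventuallyEq this
  have Hc : HasCompactSupport H := by
    refine HasCompactSupport.intro (K := Icc 0 (1 + l / 2)) isCompact_Icc fun t ht => ?_
    by_contra h
    exact ht ⟨le_of_not_gt fun h' => h (H0 t h'.le), le_of_not_gt fun h' => h (H2 t h'.le)⟩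
  have Hn : ∀ t, 0 ≤ H t := fun t => by
    by_cases ht : t ≤ 1 + l / 2
    · simp only [hH]
      have := Real.smoothTransition.nonneg (2 * t)
      have := Real.smoothTransition.le_one (2 * (t - 1) / l)
      exact div_nonneg (mul_nonneg ‹_› (by simp only [S]; linarith)) lz
    · rw [H2 t lz]
  obtain ⟨Nb, hNb⟩ := Hc.exists_bound_of_continuous Hs.continuous
  obtain ⟨Nc, hNc⟩ := Hc.deriv.exists_bound_of_continuous (Hs.continuous_deriv (by simp))
  set g : ℝ → ℝ := fun t => ∫ s in (0:ℝ)..t, H s with hg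
  have gd : ∀ t, HasDerivAt g (H t) t := fun t =>
    intervalIntegral.integral_hasDerivAt_right (Hs.continuous.intervalIntegrable _ _)
      (Hs.continuous.stronglyMeasurableAtFilter _ _) Hs.continuous.continuousAt
  have gs : Sm g := by
    have e : deriv g = H := funext fun t => (gd t).deriv
    exact contDiff_infty_iff_deriv.2 ⟨fun t => (gd t).differentiableAt, by rw [e]; exact Hs⟩
  have g0 : ∀ t ≤ 0, g t = 0 := fun t ht => by
    simp only [hg]
    rw [intervalIntegral.integral_symm, intervalIntegral.integral_of_le ht,
      setIntegral_congr_fun (g := fun _ => (0:ℝ)) measurableSet_Ioc fun s hs => H0 s hs.2]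
    simp
  have Hd : ∀ t ≤ 1, H t ^ 2 ≤ deriv H t := fun t ht => by
    have h1 : ∀ s < 1, H s ^ 2 ≤ deriv H s := fun s hs => by
      have e : H =ᶠ[𝓝 s] fun t => S (2 * t) * (1 + l - t)⁻¹ := by
        filter_upwards [gt_mem_nhds hs] with r hr using H1 r (le_of_lt hr)
      have hp : 0 < 1 + l - s := by linarith
      have d1 : HasDerivAt (fun t : ℝ => (1 + l - t)⁻¹) ((1 + l - s)⁻¹ ^ 2) s := by
        have := (((hasDerivAt_id s).const_sub (1 + l))).inv (by simpa using hp.ne')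
        refine HasDerivAt.congr_deriv this ?_
        simp only [id]; field_simp
      have d2 : HasDerivAt (fun t : ℝ => S (2 * t)) (deriv S (2 * s) * 2) s :=
        HasDerivAt.comp s ((hSs.differentiable (by simp)).differentiableAt.hasDerivAt)
          (by simpa using (hasDerivAt_id s).const_mul 2)
      have hmono : 0 ≤ deriv S (2 * s) := by
        exact Real.smoothTransition.monotone.deriv_nonneg
      rw [e.deriv_eq, (d2.fun_mul d1).deriv, H1 s hs.le]
      have h0 := Real.smoothTransition.nonneg (2 * s)
      have h2 := Real.smoothTransition.le_one (2 * s)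
      have hi : 0 < (1 + l - s)⁻¹ := by positivity
      have : (S (2 * s)) ^ 2 ≤ S (2 * s) := by simp only [S]; nlinarith
      nlinarith [mul_nonneg hmono hi.le, mul_le_mul_of_nonneg_right this (sq_nonneg (1 + l - s)⁻¹)]
    have : t ∈ closure (Iio (1:ℝ)) := by rw [closure_Iio]; exact ht
    exact le_on_closure (f := fun t => H t ^ 2) (g := deriv H) (s := Iio 1) h1
      (by have := Hs.continuous; fun_prop) (Hs.continuous_deriv (by simp)).continuousOn this
  refine ⟨g, H, max Nb Nc, gs, Hs, gd, fun t => (hNb t).trans (le_max_left _ _),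
    fun t => (hNc t).trans (le_max_right _ _), g0, H0, Hn, Hd, fun t h1 h2 => ?_⟩
  have gmono : Monotone g := monotone_of_deriv_nonneg (gs.differentiable (by simp)) fun t => by
    rw [(gd t).deriv]; exact Hn t
  have gh : 0 ≤ g (1/2) := by have := gmono (show (0:ℝ) ≤ 1/2 by norm_num); rwa [g0 0 le_rfl] at this
  have hL : ∀ s ≤ 1, HasDerivAt (fun t => g t + Real.log (1 + l - t)) (H s - (1 + l - s)⁻¹) s := fun s hs => by
    have := (((hasDerivAt_id s).const_sub (1 + l))).log (by simp; linarith)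
    refine ((gd s).add this).congr_deriv ?_
    simp only [id]; ring
  have mo : MonotoneOn (fun t => g t + Real.log (1 + l - t)) (Icc (1/2) 1) := by
    refine monotoneOn_of_deriv_nonneg (convex_Icc _ _) (fun s hs => (hL s hs.2).continuousAt.continuousWithinAt)
      (fun s hs => ?_) fun s hs => ?_
    · rw [interior_Icc] at hs; exact (hL s hs.2.le).differentiableAt.differentiableWithinAt
    · rw [interior_Icc] at hs
      rw [(hL s hs.2.le).deriv, H1 s hs.2.le]
      simp only [S]; rw [Real.smoothTransition.one_of_one_le (by linarith [hs.1])]; simp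
  have h3 := mo ⟨le_rfl, by norm_num⟩ ⟨by linarith, h2⟩ (show 1/2 ≤ t by linarith)
  simp only at h3
  have h4 : Real.log (1 / 2) ≤ Real.log (1 + l - 1/2) := Real.log_le_log nz lz
  have h5 : Real.log (1 + l - t) ≤ Real.log (2 * l) := Real.log_le_log lz lz
  have h6 : Real.log (1 / (4 * l)) = Real.log (1 / 2) - Real.log (2 * l) := by
    rw [← Real.log_div nz pz]; congr 1; field_simp; norm_num
  linarith

theorem logfn {l : ℝ} (hl : 0 < l) (hl2 : l ≤ 1 / 8) (k : ℝ) {D : ℝ} (hD : 0 < D) : ∃ (G F : ℝ → ℝ) (N N' : ℝ),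
    Fn G k N ∧ Fn F k N' ∧ deriv G = F ∧ (∀ t, 0 ≤ F t) ∧ (∀ t ≤ k + D, F t ^ 2 ≤ deriv F t) ∧
    ∀ t, k + (1 - l) * D ≤ t → t ≤ k + D → Real.log (1 / (4 * l)) ≤ G t := by
  obtain ⟨g, H, N, gs, Hs, gd, b1, b2, g0, H0, Hn, Hd, gl⟩ := logfn0 hl hl2
  have ha : ∀ t, HasDerivAt (fun t => (t - k) / D) (1 / D) t := fun t =>
    ((hasDerivAt_id t).sub_const k).div_const D
  have d1 : ∀ t, HasDerivAt (fun t => g ((t - k) / D)) (H ((t - k) / D) / D) t := fun t =>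
    ((gd _).comp t (ha t)).congr_deriv (by ring)
  have d2 : ∀ t, HasDerivAt (fun t => H ((t - k) / D) / D) (deriv H ((t - k) / D) / D / D) t := fun t =>
    (((((Hs.differentiable (by simp)).differentiableAt.hasDerivAt).comp t (ha t))).div_const D).congr_deriv (by ring)
  have hz : ∀ t ≤ k, (t - k) / D ≤ 0 := fun t ht => div_nonpos_of_nonpos_of_nonneg lz hD.le
  refine ⟨fun t => g ((t - k) / D), fun t => H ((t - k) / D) / D, N / D, N / D / D,
    ⟨gs.comp (by fun_prop), fun t => ?_, fun t ht => g0 _ (hz t ht)⟩,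
    ⟨(Hs.comp (by fun_prop)).div_const D, fun t => ?_, fun t ht => by rw [H0 _ (hz t ht), zero_div]⟩,
    funext fun t => (d1 t).deriv, fun t => div_nonneg (Hn _) hD.le, fun t ht => ?_, fun t h1 h2 => ?_⟩
  · rw [(d1 t).deriv, abs_div, abs_of_pos hD]; gcongr; exact b1 _
  · rw [(d2 t).deriv, abs_div, abs_div, abs_of_pos hD]; gcongr; exact b2 _
  · rw [(d2 t).deriv, div_pow, sq D, ← div_div]
    gcongr; exact Hd _ (by rw [div_le_one hD]; linarith)
  · exact gl _ (by rw [le_div_iff₀ hD]; linarith) (by rw [div_le_one hD]; linarith)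
end

section
variable {n : ℕ} {d Ca Cb : ℝ} {Γ : Set (Euc n)} {A : Euc n → Euc n →L[ℝ] Euc n}
  {x : Euc n} {R k N : ℝ} {U : Euc n → ℝ} {q : Euc n → Euc n} {F : ℝ → ℝ}

def PoiH (n : ℕ) (d : ℝ) (Γ : Set (Euc n)) (x : Euc n) (a : ℝ) (U : Euc n → ℝ) (q : Euc n → Euc n) (k : ℝ)
    (Cp : ℝ≥0) : Prop :=
  ∀ (G : ℝ → ℝ) (N : ℝ), Fn G k N → ∫⁻ y in ball x a, nn(G (U y)) ∂(measW n d Γ) ≤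
    Cp * (ofReal (a ^ 2) * ∫⁻ y in ball x (5 * a), nn(deriv G (U y)) * nn(q y) ∂(measW n d Γ))

theorem poi_b (n : ℕ) (d Ca : ℝ) (hdn : d < (n:ℝ) - 1) : ∃ Cp : ℝ≥0, ∀ (Γ : Set (Euc n))
    (A : Euc n → Euc n →L[ℝ] Euc n) (x : Euc n) (a k : ℝ) (U : Euc n → ℝ) (q : Euc n → Euc n), Geo n d Ca Γ →
    x ∈ Γ → 0 < a → Sbs n d Γ A x (10 * a) U q k → PoiH n d Γ x a U q k Cp := by
  obtain ⟨C, hC⟩ := Geo.tlay n d Ca hdn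
  refine ⟨4 * C, fun Γ A x a k U q g hx ha h G N hG => ?_⟩
  set m := measW n d Γ
  obtain ⟨η, e1, e2, e3, e4, e5, e6⟩ := bumpb x (a := 5 * a) (b := 6 * a) pz lz
  have hI := h.h0 g hG e1 e2 (e5.trans (closedBall_subset_ball lz))
  set f := fun y => η y * G (U y)
  set p := pf η G U q
  have hp : AEStronglyMeasurable p m := (pf_memLp hG h.gd.U2 h.gd.q2 e1 e2).1.mono_ac mW_ac
  have c1 : ∫⁻ y in ball x a, nn(G (U y)) ∂m = ∫⁻ y in ball x a, nn(f y) ∂m := by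
    refine setLIntegral_congr_fun measurableSet_ball fun y hy => ?_
    simp only [f]
    rw [e4 y (ball_subset_closedBall (ball_subset_ball lz hy)), one_mul]
  have c2 : ∫⁻ y in ball x (5 * a), nn(deriv G (U y)) * nn(q y) ∂m = ∫⁻ y in ball x (5 * a), nn(p y) ∂m := by
    refine setLIntegral_congr_fun measurableSet_ball fun y hy => ?_
    have hc : η =ᶠ[𝓝 y] fun _ => (1:ℝ) := by
      filter_upwards [isOpen_ball.mem_nhds hy] with z hz using e4 z (ball_subset_closedBall hz)
    simp only [p, pf]
    rw [gr_const hc, e4 y (ball_subset_closedBall hy), smul_zero, zero_add, one_smul, enorm_smul, mul_pow]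
  rw [c1, c2]
  set Ip := ∫⁻ y in ball x (5 * a), nn(p y) ∂m
  refine ENNReal.le_of_forall_pos_le_add fun ε hε _ => ?_
  obtain ⟨εc, he, hk⟩ := enr_pick (K := 4 * C * ofReal (a ^ 2) + 2) (ε := ε)
      (by exact_mod_cast hε) (by finiteness)
  obtain ⟨φ, a1, a2, a3, a4, a5⟩ := hI εc he
  have hφ := a1.continuous.aestronglyMeasurable (μ := m)
  have b1 : ∫⁻ y in ball x a, nn(f y) ∂m ≤ 2 * (∫⁻ y in ball x a, nn(φ y) ∂m) + 2 * εc := by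
    calc _ ≤ ∫⁻ y in ball x a, (2 * nn(φ y) + 2 * nn(φ y - f y)) ∂m := by
          refine lintegral_mono fun y => ?_
          have := enorm_sub_sq_le (φ y) (φ y - f y)
          rwa [sub_sub_cancel] at this
      _ ≤ _ := by
          rw [lintegral_add_left' ((hφ.enorm.pow_const 2).const_mul 2).restrict, lintegral_const_mul' _ _ nz,
            lintegral_const_mul' _ _ nz]
          exact add_le_add le_rfl (mul_le_mul' le_rfl ((lintegral_mono' Measure.restrict_le_self le_rfl).trans a4))
  have b3 : ∫⁻ y in ball x (5 * a), nn(gradient φ y) ∂m ≤ 2 * Ip + 2 * εc := by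
    calc _ ≤ ∫⁻ y in ball x (5 * a), (2 * nn(p y) + 2 * nn(gradient φ y - p y)) ∂m := by
          refine lintegral_mono fun y => ?_
          have := enorm_add_sq_le (p y) (gradient φ y - p y)
          rwa [add_sub_cancel] at this
      _ ≤ _ := by
          rw [lintegral_add_left' ((hp.enorm.pow_const 2).const_mul 2).restrict, lintegral_const_mul' _ _ nz,
            lintegral_const_mul' _ _ nz]
          exact add_le_add le_rfl (mul_le_mul' le_rfl ((lintegral_mono' Measure.restrict_le_self le_rfl).trans a5))
  have b4 := hC Γ g φ a1 a2 (fun y hy => (a3 hy).2) x a a ha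
  have e7 : {y | infDist y Γ < a} ∩ ball x a = ball x a :=
    inter_eq_right.2 fun y hy => (infDist_le_dist_of_mem hx).trans_lt (mem_ball.1 hy)
  rw [e7, show a + 4 * a = 5 * a by ring] at b4
  calc _ ≤ 2 * (C * (ofReal (a ^ 2) * (2 * Ip + 2 * εc))) + 2 * εc :=
        b1.trans (add_le_add (mul_le_mul' le_rfl (b4.trans (mul_le_mul' le_rfl (mul_le_mul' le_rfl b3)))) le_rfl)
    _ = (4 * C : ℝ≥0) * (ofReal (a ^ 2) * Ip) + (4 * C * ofReal (a ^ 2) + 2) * εc := by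
        push_cast; ring
    _ ≤ _ := add_le_add le_rfl hk

theorem poi_i (h : Sbs n d Γ A x R U q k) {a wa : ℝ} (ha : 0 < a) (hw : 0 < wa)
    (hl : ∀ y ∈ ball x a, wa ≤ weightW n d Γ y) (hu : ∀ y ∈ ball x a, weightW n d Γ y ≤ 2 ^ n * wa)
    (hh : volume (ball x a) ≤ 2 * volume (ball x a ∩ {y | U y ≤ k})) :
    PoiH n d Γ x a U q k (2 ^ (2 * n + 4)) := by
  intro G N hG
  set B := ball x a
  have hP := poinc (hG.li h.gd.U2) (hG.mq h.gd.U2 h.gd.q2) (chain isOpen_univ (h.gd.U2.locallyIntegrable nz)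
    h.gd.q2 h.gd.gr hG.sm (Or.inr h.gd.U2) hG.bd) x ha
  have hGm : AEMeasurable fun y => nn(G (U y)) :=
    (hG.sm.continuous.comp_aestronglyMeasurable h.gd.U2.1).enorm.pow_const 2
  set I := ∫⁻ y in B, nn(G (U y)) with hI
  set J := ∫⁻ y in B, nn(deriv G (U y) • q y)
  have vt : volume B ≠ ⊤ := measure_ball_lt_top.ne
  have v0 : volume B ≠ 0 := (measure_ball_pos _ _ ha).ne'
  have s1 : volume B * I ≤ 2 * (ofReal (2 ^ (n + 3) * a ^ 2) * volume B * J) := by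
    calc _ ≤ 2 * volume (B ∩ {y | U y ≤ k}) * I := mul_le_mul' hh le_rfl
      _ = 2 * ∫⁻ y in B, volume (B ∩ {y | U y ≤ k}) * nn(G (U y)) := by
          rw [lintegral_const_mul' _ _ (measure_ne_top_of_subset inter_subset_left vt), mul_assoc]
      _ ≤ _ := by
          refine mul_le_mul' le_rfl (le_trans (lintegral_mono fun y => ?_) hP)
          rw [mul_comm, ← setLIntegral_const]
          have hnm : NullMeasurableSet {y | U y ≤ k} := nullMeasurableSet_le h.gd.U2.1.aemeasurable aemeasurable_const
          calc _ ≤ ∫⁻ y' in B ∩ {y | U y ≤ k}, nn(G (U y) - G (U y')) := by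
                refine lintegral_mono_ae ?_
                refine (ae_restrict_iff'₀ (measurableSet_ball.nullMeasurableSet.inter hnm)).2 (ae_of_all _ fun y' hy' => ?_)
                have hz : U y' ≤ k := hy'.2
                rw [hG.z _ hz, sub_zero]
            _ ≤ _ := lintegral_mono_set inter_subset_left
  have s2 : I ≤ ofReal (2 ^ (n + 4) * a ^ 2) * J := by
    rw [← ENNReal.mul_le_mul_iff_right v0 vt]
    refine s1.trans (le_of_eq ?_)
    rw [show (2:ℝ) ^ (n+4) * a ^ 2 = 2 * (2 ^ (n+3) * a ^ 2) by ring, ofReal_mul (p := 2) nz,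
      ofReal_ofNat]; ring
  have hJm : AEMeasurable fun y => nn(deriv G (U y)) * nn(q y) := by
    have := (hG.mq h.gd.U2 h.gd.q2).1.enorm.pow_const 2
    simpa only [enorm_smul, mul_pow] using this
  calc _ ≤ ofReal (2 ^ n * wa) * I := by
        rw [lmW hGm _ measurableSet_ball, hI, ← lintegral_const_mul' _ _ ofReal_ne_top]
        exact setLIntegral_mono' measurableSet_ball fun y hy => mul_le_mul' (ofReal_le_ofReal (hu y hy)) le_rfl
    _ ≤ ofReal (2 ^ n * wa) * (ofReal (2 ^ (n + 4) * a ^ 2) * J) := mul_le_mul' le_rfl s2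
    _ = ((2 ^ (2 * n + 4) : ℝ≥0) : ℝ≥0∞) * (ofReal (a ^ 2) * (ofReal wa * J)) := by
        rw [ofReal_mul pz, ofReal_mul (p := 2 ^ (n+4)) pz,
          ofReal_pow nz, ofReal_pow (p := 2) nz, ofReal_ofNat]
        push_cast; ring
    _ ≤ _ := by
        refine mul_le_mul' le_rfl (mul_le_mul' le_rfl ?_)
        refine le_trans ?_ (lintegral_mono_set (ball_subset_ball (by linarith : a ≤ 5 * a)))
        rw [lmW hJm _ measurableSet_ball, ← lintegral_const_mul' _ _ ofReal_ne_top]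
        refine setLIntegral_mono' measurableSet_ball fun y hy => mul_le_mul' (ofReal_le_ofReal (hl y hy)) ?_
        rw [enorm_smul, mul_pow]

theorem dg2 (n : ℕ) (K Cp Cm : ℝ≥0) (Cb : ℝ) (hC : 1 ≤ Cb) : ∃ l : ℝ, 0 < l ∧ l ≤ 1 / 8 ∧ ∀ (d Ca : ℝ) (Γ : Set (Euc n))
    (A : Euc n → Euc n →L[ℝ] Euc n) (x : Euc n) (a V k D : ℝ) (U : Euc n → ℝ) (q : Euc n → Euc n),
    Geo n d Ca Γ → Ell n d Γ A Cb → 0 < a → 0 < V → FK n d Γ x a V K → Sbs n d Γ A x (10 * a) U q k →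
    measW n d Γ (ball x (10 * a)) ≤ Cm * ofReal V → PoiH n d Γ x a U q k Cp → 0 < D →
    (∀ᵐ y, y ∈ ball x (10 * a) → U y ≤ k + D) → ∀ᵐ y, y ∈ ball x (a / 2) → U y ≤ k + (1 - l / 2) * D := by
  obtain ⟨ca, hca, h1⟩ := dg1 n K Cb hC
  set C2 : ℝ := Cp * (4 * Cb ^ 4) * (3 * LS / 4) ^ 2 * Cm
  have hC2 : 0 ≤ C2 := by positivity
  set b := 1 + 4 * C2 / ca with hb
  have hb1 : 1 ≤ b := by rw [hb]; have : 0 ≤ 4 * C2 / ca := by positivity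
                         linarith
  have hbC : C2 ≤ ca / 4 * b ^ 2 := by
    have : 4 * C2 / ca ≤ b ^ 2 := by nlinarith
    rw [div_le_iff₀ hca] at this; linarith
  set l := Real.exp (-b) / 8 with hl
  have hl0 : 0 < l := by positivity
  have hl8 : l ≤ 1 / 8 := by
    rw [hl]; have := Real.exp_le_one_iff.2 (show -b ≤ 0 by linarith)
    linarith
  have hlog : b ≤ Real.log (1 / (4 * l)) := by
    rw [Real.le_log_iff_exp_le pz, hl, Real.exp_neg]
    have := Real.exp_pos b
    rw [show 1 / (4 * ((Real.exp b)⁻¹ / 8)) = 2 * Real.exp b by field_simp; norm_num]; linarith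
  refine ⟨l, hl0, hl8, fun d Ca Γ A x a V k D U q g hE ha hV hFK h hm hP hD hU => ?_⟩
  obtain ⟨G, F, N, N', f1, f2, f3, f4, f5, f6⟩ := logfn hl0 hl8 k hD
  obtain ⟨η, e1, e2, e3, e4, e5, e6⟩ := bumpb x (a := 5 * a) (b := 9 * a) pz lz
  have hsub : closedBall x (9 * a) ⊆ ball x (10 * a) := closedBall_subset_ball lz
  have hen := h.energy g hE f2 e1 e2 (e5.trans hsub) f2.sm.continuous continuous_const (Q := fun _ => (1:ℝ)) (M := Iic (k + D))
    hU (fun t ht => f5 t ht) (fun t _ => by rw [abs_of_nonneg (f4 t), mul_one])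
  have hP1 := hP G N f1
  set m := measW n d Γ
  have hG : ∫⁻ y in ball x a, nn(G (U y)) ∂m ≤ ofReal (C2 * V) := by
    calc _ ≤ Cp * (ofReal (a ^ 2) * ∫⁻ y, nn(η y * F (U y)) * nn(q y) ∂m) := by
          refine hP1.trans (mul_le_mul' le_rfl (mul_le_mul' le_rfl ?_))
          refine (setLIntegral_mono' measurableSet_ball fun y hy => ?_).trans (setLIntegral_le_lintegral _ _)
          rw [e4 y (ball_subset_closedBall hy), one_mul, f3]
      _ ≤ Cp * (ofReal (a ^ 2) * (ofReal (4 * Cb ^ 4) *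
          (ofReal ((3 * LS / (4 * a)) ^ 2) * (Cm * ofReal V)))) := by
          refine mul_le_mul' le_rfl (mul_le_mul' le_rfl (hen.trans (mul_le_mul' le_rfl ?_)))
          refine le_trans ?_ (mul_le_mul' le_rfl hm)
          rw [← setLIntegral_const, ← lintegral_indicator measurableSet_ball]
          refine lintegral_mono fun y => ?_
          by_cases hy : y ∈ ball x (10 * a)
          · rw [indicator_of_mem hy, enorm_one, one_pow, mul_one, ofReal_pow (by have := LS1; positivity)]
            refine pow_le_pow_left' ?_ 2
            rw [← ofReal_norm]
            refine ofReal_le_ofReal ((e6 y).trans (le_of_eq ?_))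
            congr 1; ring
          · rw [gr_out fun h => hy (hsub (e5 h))]; simp
      _ = _ := by
          rw [← ofReal_coe_nnreal (p := Cp), ← ofReal_coe_nnreal (p := Cm),
            ← ofReal_mul pz, ← ofReal_mul pz,
            ← ofReal_mul pz, ← ofReal_mul pz, ← ofReal_mul pz]
          congr 1; simp only [C2]; field_simp
  have hfin : ∫⁻ y in ball x a, nn(max (U y - (k + (1 - l) * D)) 0) ∂m ≤ ofReal (ca * (l * D / 2) ^ 2 * V) := by
    calc _ ≤ ∫⁻ y in ball x a, ofReal ((l * D / b) ^ 2) * nn(G (U y)) ∂m := by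
          refine lintegral_mono_ae ((ae_restrict_iff' measurableSet_ball).2 ?_)
          have hU' : ∀ᵐ y ∂m, y ∈ ball x (10 * a) → U y ≤ k + D := mW_ac.ae_le hU
          filter_upwards [hU'] with y hy hya
          have hy := hy (ball_subset_ball lz hya)
          rcases le_total (U y) (k + (1 - l) * D) with h3 | h3
          · rw [max_eq_right lz]; simp
          · have h4 := f6 _ h3 hy
            rw [max_eq_left lz, ofReal_pow pz, ← mul_pow,
              ← Real.enorm_eq_ofReal pz, ← enorm_mul]
            refine en_mono lz ?_
            have : b ≤ G (U y) := hlog.trans h4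
            calc _ ≤ l * D / b * b := by field_simp; linarith
              _ ≤ _ := by gcongr
      _ ≤ ofReal ((l * D / b) ^ 2) * ofReal (C2 * V) := by
          rw [lintegral_const_mul' _ _ ofReal_ne_top]; exact mul_le_mul' le_rfl hG
      _ ≤ _ := by
          rw [← ofReal_mul pz]
          refine ofReal_le_ofReal ?_
          calc _ ≤ (l * D / b) ^ 2 * (ca / 4 * b ^ 2 * V) := by gcongr
            _ = _ := by field_simp; norm_num
  have := h1 d Ca Γ A x a V (k + (1 - l) * D) U q g hE ha hV hFK (h.mono lz (by nlinarith)) (l * D / 2)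
    pz hfin
  filter_upwards [this] with y hy hya
  have := hy hya
  linarith
end

section
variable {n : ℕ} {d Ca Cb : ℝ} {Γ : Set (Euc n)} {A : Euc n → Euc n →L[ℝ] Euc n} {x : Euc n} {R k : ℝ}
  {U : Euc n → ℝ} {q : Euc n → Euc n} {O : Set (Euc n)}

theorem Good.neg (h : Good n d Γ A O U q) : Good n d Γ A O (fun y => -U y) (fun y => -q y) where
  U2 := h.U2.neg
  q2 := h.q2.neg
  qm := by simpa using h.qm
  gr := fun φ a b c => by
    have := h.gr φ a b c
    simp only [neg_smul, smul_neg, integral_neg]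
    rw [this]
  sol := fun φ a b c => by
    have := h.sol φ a b c
    simp only [map_neg, PiLp.neg_apply, neg_mul, Finset.sum_neg_distrib, integral_neg]
    rw [this, neg_zero]

theorem Good.mono (h : Good n d Γ A O U q) {O' : Set (Euc n)} (ho : O' ⊆ O) : Good n d Γ A O' U q :=
  ⟨h.U2, h.q2, h.qm, h.gr, fun φ a b c => h.sol φ a b (c.trans ho)⟩

theorem HasTraceAt.neg {t : ℝ} {z : Euc n} (h : HasTraceAt U z t) : HasTraceAt (fun y => -U y) z (-t) := by
  have := Tendsto.neg h
  refine this.congr fun ρ => ?_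
  rw [average_eq, average_eq, integral_neg, smul_neg]

theorem step_b (n : ℕ) (d Ca Cb : ℝ) (hdn : d < (n:ℝ) - 1) (hCb : 1 ≤ Cb) : ∃ θ : ℝ, 1 / 2 ≤ θ ∧ θ < 1 ∧
    ∀ (Γ : Set (Euc n)) (A : Euc n → Euc n →L[ℝ] Euc n) (x : Euc n) (R k D : ℝ) (U : Euc n → ℝ) (q : Euc n → Euc n),
    Geo n d Ca Γ → Ell n d Γ A Cb → x ∈ Γ → 0 < R → Sbs n d Γ A x R U q k → 0 < D →
    (∀ᵐ y, y ∈ ball x R → U y ≤ k + D) → ∀ᵐ y, y ∈ ball x (R / 20) → U y ≤ k + θ * D := by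
  obtain ⟨K, hK⟩ := Geo.fkb n d Ca hdn
  obtain ⟨Cp, hCp⟩ := poi_b n d Ca hdn
  obtain ⟨Cm, hCm⟩ := Geo.mball n d Ca hdn
  obtain ⟨l, l0, l1, hl⟩ := dg2 n K Cp (Cm * Real.toNNReal (10 ^ (d + 1))) Cb hCb
  refine ⟨1 - l / 2, by linarith, by linarith, fun Γ A x R k D U q g hE hx hR h hD hU => ?_⟩
  have e : 10 * (R / 10) = R := by ring
  have := hl d Ca Γ A x (R / 10) ((R / 10) ^ (d + 1)) k D U q g hE pz pz
    (hK Γ g x hx _ pz) (by rwa [e]) ?_ (hCp Γ A x _ k U q g hx pz (by rwa [e])) hD (by rwa [e])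
  · convert this using 5
    ring
  · rw [e]
    refine (hCm Γ g x hx R hR).trans (le_of_eq ?_)
    rw [ENNReal.coe_mul, mul_assoc]
    congr 1
    change _ = ofReal _ * _
    rw [← ofReal_mul pz, ← Real.mul_rpow pz pz, e]

theorem dcy (n : ℕ) (d Ca Cb : ℝ) (hdn : d < (n:ℝ) - 1) (hCb : 1 ≤ Cb) : ∃ α : ℝ, 0 < α ∧ α ≤ 1 ∧
    ∀ (Γ : Set (Euc n)) (A : Euc n → Euc n →L[ℝ] Euc n) (x : Euc n) (R k D : ℝ) (U : Euc n → ℝ) (q : Euc n → Euc n),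
    Geo n d Ca Γ → Ell n d Γ A Cb → x ∈ Γ → 0 < R → Sbs n d Γ A x R U q k → 0 < D →
    (∀ᵐ y, y ∈ ball x R → U y ≤ k + D) → ∀ s, 0 < s → s ≤ R →
    ∀ᵐ y, y ∈ ball x s → U y ≤ k + 2 * (s / R) ^ α * D := by
  obtain ⟨θ, t0, t1, ht⟩ := step_b n d Ca Cb hdn hCb
  have hα : (1 / 20 : ℝ) ^ (Real.logb (1 / 20) θ) = θ := Real.rpow_logb nz nz lz
  have hp : 0 < Real.logb (1 / 20) θ := Real.logb_pos_of_base_lt_one nz nz lz t1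
  set α := Real.logb (1 / 20) θ
  refine ⟨α, hp, ?_, fun Γ A x R k D U q g hE hx hR h hD hU s hs hsR => ?_⟩
  · by_contra hc
    push Not at hc
    have := Real.rpow_lt_rpow_of_exponent_gt (x := (1 / 20 : ℝ)) nz nz hc
    rw [hα, Real.rpow_one] at this
    linarith
  have it : ∀ j : ℕ, ∀ᵐ y, y ∈ ball x (R * (1 / 20) ^ j) → U y ≤ k + θ ^ j * D := by
    intro j
    induction j with
    | zero => simpa using hU
    | succ j ih =>
      have hj : R * (1 / 20) ^ j ≤ R := mul_le_of_le_one_right hR.le (pow_le_one₀ nz nz)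
      have := ht Γ A x (R * (1 / 20) ^ j) k (θ ^ j * D) U q g hE hx pz (h.mono hj le_rfl)
        pz ih
      convert this using 5 <;> ring
  obtain ⟨j, hj1, hj2⟩ := exists_nat_pow_near_of_lt_one (x := s / R) (y := (1 / 20 : ℝ)) pz
    ((div_le_one hR).2 hsR) nz nz
  filter_upwards [it j] with y hy hys
  have hsj : s ≤ R * (1 / 20) ^ j := by
    rw [div_le_iff₀ hR] at hj2; linarith
  refine (hy (ball_subset_ball hsj hys)).trans ?_
  have h1 : θ ^ (j + 1) ≤ (s / R) ^ α := by
    calc θ ^ (j + 1) = ((1 / 20 : ℝ) ^ (j + 1)) ^ α := by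
          rw [← hα, ← Real.rpow_mul_natCast nz, mul_comm, Real.rpow_natCast_mul nz]
      _ ≤ _ := Real.rpow_le_rpow pz hj1.le hp.le
  have h2 : θ ^ j ≤ 2 * (s / R) ^ α := by
    rw [pow_succ] at h1
    nlinarith [show 0 ≤ θ ^ j by positivity]
  have := mul_le_mul_of_nonneg_right h2 hD.le
  linarith

theorem big_V {I : ℝ≥0∞} (hI : I < ⊤) {c V : ℝ} (hc : 0 < c) (hV : 0 < V) : ∃ H, 0 < H ∧ I ≤ ofReal (c * H ^ 2 * V) := by
  refine ⟨1 + I.toReal / (c * V), by positivity, ?_⟩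
  rw [← ofReal_toReal hI.ne]
  refine ofReal_le_ofReal ?_
  set t := I.toReal
  have ht : 0 ≤ t := ENNReal.toReal_nonneg
  rw [ENNReal.toReal_ofReal ht]
  have h1 : 0 ≤ t / (c * V) := by positivity
  calc t = (c * V) * (t / (c * V)) := by field_simp
    _ ≤ (c * V) * (1 + t / (c * V)) ^ 2 := by gcongr; nlinarith
    _ = _ := by ring

/-- qualitative bound -/
theorem qb_b (g : Geo n d Ca Γ) (hE : Ell n d Γ A Cb)
    (hx : x ∈ Γ) (hR : 0 < R) (h : Sbs n d Γ A x R U q k) :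
    ∃ D, 0 < D ∧ ∀ᵐ y, y ∈ ball x (R / 4) → U y ≤ k + D := by
  obtain ⟨K, hK⟩ := Geo.fkb n d Ca g.hdn
  obtain ⟨ca, hc, h1⟩ := dg1 n K Cb hE.c
  obtain ⟨H, hH, hI⟩ := big_V (h.fin g (show R / 2 < R by linarith)) hc (show 0 < (R / 2) ^ (d + 1) by positivity)
  have := h1 d Ca Γ A x (R / 2) _ k U q g hE pz pz (hK Γ g x hx _ pz)
    (h.mono lz le_rfl) H hH hI
  refine ⟨H, hH, ?_⟩
  convert this using 4
  ring

theorem Good.sbi (h : Good n d Γ A (ball x R \ Γ) U q) (hd : R ≤ infDist x Γ) (k : ℝ) : Sbs n d Γ A x R U q k := by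
  refine ⟨h, ?_⟩
  have : Γ ∩ ball x R = ∅ := by
    ext z
    simp only [mem_inter_iff, mem_ball, mem_empty_iff_false, iff_false, not_and, not_lt]
    intro hz
    exact hd.trans ((infDist_le_dist_of_mem hz).trans_eq (dist_comm _ _))
  rw [sg, this, Measure.restrict_empty]
  simp

theorem step_i (g : Geo n d Ca Γ) (hE : Ell n d Γ A Cb) (hx : x ∉ Γ) (hR : 0 < R)
    (h : Good n d Γ A (ball x R \ Γ) U q) :
    ∃ ρ, 0 < ρ ∧ (∃ M, ∀ᵐ y, y ∈ ball x ρ → U y ≤ M) ∧ ∃ θ : ℝ, 0 < θ ∧ θ < 1 ∧ ∀ t, 0 < t → t ≤ ρ → ∀ k D : ℝ, 0 < D →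
    volume (ball x (t / 10)) ≤ 2 * volume (ball x (t / 10) ∩ {y | U y ≤ k}) →
    (∀ᵐ y, y ∈ ball x t → U y ≤ k + D) → ∀ᵐ y, y ∈ ball x (t / 20) → U y ≤ k + θ * D := by
  have hδ := g.pos hx
  set δ := infDist x Γ
  set wa := (5 * δ / 4) ^ (d + 1 - (n:ℝ)) with hw0
  have hw : 0 < wa := by positivity
  have hb : ∀ y ∈ ball x (δ / 4), 3 * δ / 4 ≤ infDist y Γ ∧ infDist y Γ ≤ 5 * δ / 4 := by
    intro y hy
    rw [mem_ball] at hy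
    have h1 : infDist y Γ ≤ δ + dist y x := infDist_le_infDist_add_dist
    have h2 : δ ≤ infDist y Γ + dist x y := infDist_le_infDist_add_dist
    rw [dist_comm] at h2
    constructor <;> linarith
  have hl : ∀ y ∈ ball x (δ / 4), wa ≤ weightW n d Γ y := fun y hy =>
    Real.rpow_le_rpow_of_nonpos (by linarith [(hb y hy).1]) (hb y hy).2 (by linarith [g.hdn])
  have hu : ∀ y ∈ ball x (δ / 4), weightW n d Γ y ≤ 2 ^ n * wa := fun y hy => by
    refine (g.w_le (ρ := 2⁻¹ * (5 * δ / 4)) pz (by linarith [(hb y hy).1])).trans ?_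
    rw [Real.mul_rpow nz pz]
    refine mul_le_mul_of_nonneg_right ?_ hw.le
    rw [Real.inv_rpow nz, ← Real.rpow_neg nz, ← Real.rpow_natCast]
    exact Real.rpow_le_rpow_of_exponent_le nz (by linarith [g.hd])
  set ρa := min R (δ / 4)
  have hρ0 : 0 < ρa := lt_min hR pz
  have h4 : ρa ≤ δ / 4 := min_le_right _ _
  have hS : ∀ t ≤ ρa, ∀ k, Sbs n d Γ A x t U q k := fun t ht k =>
    (h.mono (sdiff_subset_sdiff_left (ball_subset_ball (ht.trans (min_le_left _ _))))).sbi (by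
      show t ≤ δ
      linarith) k
  have hF : ∀ t, 0 < t → t ≤ ρa → FK n d Γ x t (t ^ n * wa) (KB n) := fun t t0 ht => g.fki t0 hw
    (fun y hy => hl y (ball_subset_ball (ht.trans h4) hy)) fun y hy => by
      linarith [(hb y (ball_subset_ball (ht.trans h4) hy)).1]
  have hM : ∀ t, 0 < t → t ≤ ρa → measW n d Γ (ball x t) ≤ ofReal (2 ^ n * wa) * volume (ball x t) := by
    intro t t0 ht
    rw [measW, withDensity_apply _ measurableSet_ball]
    calc _ ≤ ∫⁻ _ in ball x t, ofReal (2 ^ n * wa) := setLIntegral_mono measurable_const fun y hy =>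
          ofReal_le_ofReal (hu y (ball_subset_ball (ht.trans h4) hy))
      _ = _ := by rw [setLIntegral_const]
  refine ⟨ρa / 4, by positivity, ?_, ?_⟩
  · obtain ⟨ca, hc, h1⟩ := dg1 n (KB n) Cb hE.c
    obtain ⟨H, hH, hI⟩ := big_V ((hS ρa le_rfl 0).fin g (show ρa / 2 < ρa by linarith)) hc
      (show 0 < (ρa / 2) ^ n * wa by positivity)
    have := h1 d Ca Γ A x (ρa / 2) _ 0 U q g hE pz pz (hF _ pz lz)
      (hS _ lz 0) H hH hI
    refine ⟨0 + H, ?_⟩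
    convert this using 4
    ring
  · obtain ⟨l, l0, l1, hl2⟩ := dg2 n (KB n) (2 ^ (2 * n + 4)) (2 ^ n * omn n * 10 ^ n) Cb hE.c
    refine ⟨1 - l / 2, by linarith, by linarith, fun t t0 ht k D hD hh hU => ?_⟩
    have e : 10 * (t / 10) = t := by ring
    have hst : ball x (t / 10) ⊆ ball x (δ / 4) := ball_subset_ball lz
    have := hl2 d Ca Γ A x (t / 10) ((t / 10) ^ n * wa) k D U q g hE pz pz
      (hF _ pz lz) (hS _ lz k) ?_
      (poi_i (hS t lz k) pz hw (fun y hy => hl y (hst hy)) (fun y hy => hu y (hst hy)) hh) hD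
      (by rwa [e])
    · convert this using 5
      ring
    · rw [e]
      refine (hM t t0 lz).trans (le_of_eq ?_)
      rw [volb x t0, mul_left_comm, ← ofReal_mul pz]
      have : 2 ^ n * wa * t ^ n = (2 ^ n * 10 ^ n) * ((t / 10) ^ n * wa) := by
        rw [div_pow]; field_simp
      rw [this, ofReal_mul pz, ofReal_mul pz]
      push_cast
      rw [ofReal_pow nz, ofReal_pow nz]
      simp only [ofReal_ofNat]
      ring

theorem half (U : Euc n → ℝ) (x : Euc n) (t k : ℝ) :
    volume (ball x t) ≤ 2 * volume (ball x t ∩ {y | U y ≤ k}) ∨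
    volume (ball x t) ≤ 2 * volume (ball x t ∩ {y | -U y ≤ -k}) := by
  have h : volume (ball x t) ≤ volume (ball x t ∩ {y | U y ≤ k}) + volume (ball x t ∩ {y | -U y ≤ -k}) := by
    refine (measure_mono fun y hy => ?_).trans (measure_union_le _ _)
    rcases le_total (U y) k with h | h
    · exact Or.inl ⟨hy, h⟩
    · exact Or.inr ⟨hy, neg_le_neg h⟩
  rcases le_total (volume (ball x t ∩ {y | U y ≤ k})) (volume (ball x t ∩ {y | -U y ≤ -k})) with h' | h'
  · right; rw [two_mul]; exact h.trans (add_le_add_left h' _)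
  · left; rw [two_mul]; exact h.trans (add_le_add_right h' _)

theorem osc_i (g : Geo n d Ca Γ) (hE : Ell n d Γ A Cb) (hx : x ∉ Γ) (hR : 0 < R)
    (h : Good n d Γ A (ball x R \ Γ) U q) (ε : ℝ) (hε : 0 < ε) :
    ∃ ρ, 0 < ρ ∧ ∃ c, ∀ᵐ y, y ∈ ball x ρ → |U y - c| ≤ ε := by
  obtain ⟨ρb, r1, ⟨Mb, hM⟩, θb, a1, b1, h1⟩ := step_i g hE hx hR h
  obtain ⟨ρc, r2, ⟨Mc, hm⟩, θc, a2, b2, h2⟩ := step_i g hE hx hR h.neg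
  set ρ := min ρb ρc
  have hρ : 0 < ρ := lt_min r1 r2
  set θ := max θb θc
  have t1 : θ < 1 := max_lt b1 b2
  have t0 : 0 < θ := a1.trans_le (le_max_left _ _)
  set Da := |Mb| + |Mc| + 1
  have hDa : 0 < Da := by positivity
  set κ := (1 + θ) / 2 with hκ
  have it : ∀ j : ℕ, ∃ c, ∀ᵐ y, y ∈ ball x (ρ * (1 / 20) ^ j) → |U y - c| ≤ κ ^ j * Da := by
    intro j
    induction j with
    | zero =>
      refine ⟨0, ?_⟩
      filter_upwards [hM, hm] with y hy hy' hyb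
      rw [pow_zero, mul_one] at hyb
      have u1 := hy (ball_subset_ball (min_le_left _ _) hyb)
      have u2 := hy' (ball_subset_ball (min_le_right _ _) hyb)
      rw [sub_zero, abs_le]
      have := le_abs_self Mb
      have := le_abs_self Mc
      have := abs_nonneg Mb
      have := abs_nonneg Mc
      constructor <;> simp only [Da, pow_zero, one_mul] <;> linarith
    | succ j ih =>
      obtain ⟨c, hc⟩ := ih
      set t := ρ * (1 / 20) ^ j with ht
      have ht0 : 0 < t := by positivity
      have htρ : t ≤ ρ := mul_le_of_le_one_right hρ.le (pow_le_one₀ nz nz)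
      have e : ρ * (1 / 20) ^ (j + 1) = t / 20 := by rw [ht]; ring
      rw [e]
      set D := κ ^ j * Da
      have hD : 0 < D := by positivity
      have eD : κ ^ (j + 1) * Da = κ * D := by simp only [D]; ring
      rw [eD]
      have hsub : ball x (t / 20) ⊆ ball x t := ball_subset_ball lz
      rcases half U x (t / 10) c with hh | hh
      · have := h1 t ht0 (htρ.trans (min_le_left _ _)) c D hD hh (by
          filter_upwards [hc] with y hy hyb
          linarith [(abs_le.1 (hy hyb)).2])
        refine ⟨c - (1 - θ) / 2 * D, ?_⟩
        filter_upwards [hc, this] with y y1 y2 hyb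
        have z1 := (abs_le.1 (y1 (hsub hyb))).1
        have z2 := y2 hyb
        have z3 : θb * D ≤ θ * D := mul_le_mul_of_nonneg_right (le_max_left _ _) hD.le
        rw [abs_le, hκ]
        constructor <;> linarith
      · have := h2 t ht0 (htρ.trans (min_le_right _ _)) (-c) D hD hh (by
          filter_upwards [hc] with y hy hyb
          linarith [(abs_le.1 (hy hyb)).1])
        refine ⟨c + (1 - θ) / 2 * D, ?_⟩
        filter_upwards [hc, this] with y y1 y2 hyb
        have z1 := (abs_le.1 (y1 (hsub hyb))).2
        have z2 := y2 hyb
        have z3 : θc * D ≤ θ * D := mul_le_mul_of_nonneg_right (le_max_right _ _) hD.le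
        rw [abs_le, hκ]
        constructor <;> linarith
  obtain ⟨j, hj⟩ := exists_pow_lt_of_lt_one (show 0 < ε / Da by positivity) (show κ < 1 by linarith)
  obtain ⟨c, hc⟩ := it j
  refine ⟨ρ * (1 / 20) ^ j, by positivity, c, ?_⟩
  filter_upwards [hc] with y hy hyb
  refine (hy hyb).trans ?_
  rw [lt_div_iff₀ hDa] at hj
  exact hj.le

/-- boundary continuity -/
theorem osc_b (g : Geo n d Ca Γ) (hE : Ell n d Γ A Cb) (hx : x ∈ Γ) (hR : 0 < R)
    (h : Sbs n d Γ A x R U q k) (ε : ℝ) (hε : 0 < ε) :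
    ∃ ρ, 0 < ρ ∧ ∀ᵐ y, y ∈ ball x ρ → U y ≤ k + ε := by
  obtain ⟨D, hD, hU⟩ := qb_b g hE hx hR h
  obtain ⟨α, a0, a1, hα⟩ := dcy n d Ca Cb g.hdn hE.c
  have hl : Tendsto (fun s : ℝ => 2 * (s / (R / 4)) ^ α * D) (𝓝[>] 0) (𝓝 (2 * (0 / (R / 4)) ^ α * D)) := by
    refine Tendsto.mono_left ?_ nhdsWithin_le_nhds
    refine ((Tendsto.rpow_const ?_ (Or.inr a0.le)).const_mul _).mul_const _
    exact tendsto_id.div_const _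
  rw [zero_div, Real.zero_rpow a0.ne', mul_zero, zero_mul] at hl
  obtain ⟨s, hs, hs2, hs3⟩ := ((hl.eventually_lt_const hε).and (Ioo_mem_nhdsGT (show 0 < R / 4 by positivity))).exists
  refine ⟨s, hs2, ?_⟩
  filter_upwards [hα Γ A x (R / 4) k D U q g hE hx pz (h.mono lz le_rfl) hD hU s hs2 hs3.le]
    with y hy hyb
  linarith [hy hyb]
end

section
variable {n : ℕ} {d Ca Cb : ℝ} {Γ : Set (Euc n)} {A : Euc n → Euc n →L[ℝ] Euc n} {x : Euc n} {R k : ℝ}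
  {U : Euc n → ℝ} {q : Euc n → Euc n} {O : Set (Euc n)}

theorem ae_ex {P : Euc n → Prop} {y : Euc n} {ρ : ℝ} (hρ : 0 < ρ) (h : ∀ᵐ z, z ∈ ball y ρ → P z) :
    ∃ z ∈ ball y ρ, P z := by
  by_contra hc
  push Not at hc
  have : ball y ρ ⊆ {z | ¬ (z ∈ ball y ρ → P z)} := fun z hz => by
    simp only [mem_ofPred_eq, Classical.not_imp]
    exact ⟨hz, hc z hz⟩
  have h0 := measure_mono_null this (ae_iff.1 h)
  exact (measure_ball_pos volume y hρ).ne' h0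

def Cl (u : Euc n → ℝ) (y : Euc n) (ρ c ε : ℝ) : Prop := ∀ᵐ z, z ∈ ball y ρ → |u z - c| ≤ ε

theorem rep {u : Euc n → ℝ} (hO : IsOpen O) (hQ : ∀ y ∈ O, ∀ ε > 0, ∃ ρ, 0 < ρ ∧ ∃ c, Cl u y ρ c ε) :
    ∃ uc : Euc n → ℝ, ContinuousOn uc O ∧ (∀ᵐ y ∂(volume.restrict O), uc y = u y) ∧
      ∀ y ∈ O, ∀ c, (∀ ε > 0, ∃ ρ, 0 < ρ ∧ Cl u y ρ c ε) → uc y = c := by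
  set uc : Euc n → ℝ := fun y => sSup {m | ∃ ρ, 0 < ρ ∧ ∀ᵐ z, z ∈ ball y ρ → m ≤ u z} with huc
  have K : ∀ y ρ c ε, 0 < ρ → Cl u y ρ c ε → |uc y - c| ≤ ε := by
    intro y ρ c ε hρ h
    have hm : c - ε ∈ {m | ∃ ρ, 0 < ρ ∧ ∀ᵐ z, z ∈ ball y ρ → m ≤ u z} := by
      refine ⟨ρ, hρ, ?_⟩
      filter_upwards [h] with z hz hzb
      linarith [(abs_le.1 (hz hzb)).1]
    have hb : c + ε ∈ upperBounds {m | ∃ ρ, 0 < ρ ∧ ∀ᵐ z, z ∈ ball y ρ → m ≤ u z} := by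
      rintro m ⟨ρ', hρ', h'⟩
      obtain ⟨z, -, hz⟩ := ae_ex (P := fun z => m ≤ c + ε) (lt_min hρ hρ') (y := y) (by
        filter_upwards [h, h'] with z hz hz' hzb
        linarith [(abs_le.1 (hz (ball_subset_ball (min_le_left _ _) hzb))).2,
          hz' (ball_subset_ball (min_le_right _ _) hzb)])
      exact hz
    have h1 := le_csSup ⟨_, hb⟩ hm
    have h2 := csSup_le ⟨_, hm⟩ hb
    rw [abs_le]
    constructor <;> simp only [huc] <;> linarith
  have K2 : ∀ y ρ c ε, Cl u y ρ c ε → ∀ y' ∈ ball y ρ, |uc y' - c| ≤ ε := by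
    intro y ρ c ε h y' hy'
    refine K y' (ρ - dist y' y) c ε (by rw [mem_ball] at hy'; linarith) ?_
    filter_upwards [h] with z hz hzb
    refine hz ?_
    rw [mem_ball] at hzb ⊢
    linarith [dist_triangle z y' y]
  refine ⟨uc, ?_, ?_, ?_⟩
  · intro y hy
    refine ContinuousAt.continuousWithinAt ?_
    rw [Metric.continuousAt_iff]
    intro ε hε
    obtain ⟨ρ, hρ, c, hc⟩ := hQ y hy (ε / 3) pz
    refine ⟨ρ, hρ, fun {y'} hy' => ?_⟩
    have h1 := abs_le.1 (K2 y ρ c _ hc y' hy')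
    have h2 := abs_le.1 (K2 y ρ c _ hc y (mem_ball_self hρ))
    rw [Real.dist_eq, abs_lt]
    constructor <;> linarith [h1.1, h1.2, h2.1, h2.2]
  · have hj : ∀ j : ℕ, ∀ᵐ y ∂(volume.restrict O), |u y - uc y| ≤ 2 / ((j:ℝ) + 1) := by
      intro j
      rw [ae_restrict_iff' hO.measurableSet, ae_iff]
      refine measure_null_of_locally_null _ fun y hy => ?_
      have hyO : y ∈ O := by
        by_contra hc
        exact hy fun h => absurd h hc
      obtain ⟨ρ, hρ, c, hc⟩ := hQ y hyO (1 / ((j:ℝ) + 1)) pz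
      refine ⟨ball y ρ ∩ {a | ¬ (a ∈ O → |u a - uc a| ≤ 2 / ((j:ℝ) + 1))},
        inter_mem (mem_nhdsWithin_of_mem_nhds (ball_mem_nhds _ hρ)) self_mem_nhdsWithin, ?_⟩
      refine measure_mono_null ?_ (ae_iff.1 hc)
      rintro z ⟨hz, hz'⟩ hn
      refine hz' fun _ => ?_
      have h1 := abs_le.1 (hn hz)
      have h2 := abs_le.1 (K2 y ρ c _ hc z hz)
      have e : 2 / ((j:ℝ) + 1) = 1 / ((j:ℝ) + 1) + 1 / ((j:ℝ) + 1) := by ring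
      rw [abs_le, e]
      constructor <;> linarith [h1.1, h1.2, h2.1, h2.2]
    filter_upwards [ae_all_iff.2 hj] with y hy
    have hl : Tendsto (fun j : ℕ => 2 / ((j:ℝ) + 1)) atTop (𝓝 0) := by
      have := tendsto_one_div_add_atTop_nhds_zero_nat (𝕜 := ℝ) |>.const_mul 2
      simpa [div_eq_mul_inv] using this
    have := ge_of_tendsto' hl hy
    have := abs_nonpos_iff.1 this
    linarith
  · intro y hy c h
    have : |uc y - c| ≤ 0 := by
      refine le_of_forall_pos_le_add fun ε hε => ?_
      obtain ⟨ρ, hρ, hc⟩ := h ε hε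
      rw [zero_add]
      exact K y ρ c ε hρ hc
    linarith [abs_nonpos_iff.1 this]

theorem ptw {u uc : Euc n → ℝ} (hO : IsOpen O) (hc : ContinuousOn uc O) (he : ∀ᵐ y ∂(volume.restrict O), uc y = u y)
    {s b : ℝ} (hs : ball x s ⊆ O) (h : ∀ᵐ y, y ∈ ball x s → u y ≤ b) : ∀ y ∈ ball x s, uc y ≤ b := by
  intro y hy
  by_contra hcon
  push Not at hcon
  rw [ae_restrict_iff' hO.measurableSet] at he
  have h1 : ∀ᶠ z in 𝓝 y, b < uc z ∧ z ∈ ball x s :=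
    ((hc.continuousAt (hO.mem_nhds (hs hy))).eventually_const_lt hcon).and (isOpen_ball.mem_nhds hy)
  obtain ⟨ρ, hρ, hb⟩ := Metric.eventually_nhds_iff_ball.1 h1
  obtain ⟨z, -, hz⟩ := ae_ex (P := fun _ => False) hρ (y := y) (by
    filter_upwards [he, h] with z z1 z2 hzb
    have := hb z hzb
    have h3 := z1 (hs this.2)
    have h4 := z2 this.2
    linarith [this.1])
  exact hz

theorem tr_congr {u : Euc n → ℝ} {z : Euc n} {t r : ℝ} (h : HasTraceAt u z t) (hz : z ∈ ball x r)
    (hU : ∀ y ∈ ball x r, U y = u y) : HasTraceAt U z t := by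
  refine Tendsto.congr' ?_ h
  obtain ⟨ρ, hρ, hb⟩ := Metric.isOpen_iff.1 isOpen_ball z hz
  filter_upwards [Ioo_mem_nhdsGT hρ] with a ha
  rw [average_eq, average_eq]
  congr 1
  refine setIntegral_congr_fun measurableSet_ball fun y hy => ?_
  exact (hU y (hb (ball_subset_ball ha.2.le hy))).symm

theorem mkSbs (g : Geo n d Ca Γ) {u f : Euc n → ℝ} {y : Euc n} {r r' : ℝ} (hr : r' ≤ r) (h : Good n d Γ A (ball x r' \ Γ) U q)
    (hU : ∀ y ∈ ball x r', U y = u y) (hb : ball y R ⊆ ball x r')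
    (ht : ∀ᵐ z ∂(μH[d].restrict (Γ ∩ ball x r)), HasTraceAt u z (f z)) :
    (∀ k, (∀ z ∈ Γ ∩ ball y R, f z ≤ k) → Sbs n d Γ A y R U q k) ∧
    (∀ k, (∀ z ∈ Γ ∩ ball y R, k ≤ f z) → Sbs n d Γ A y R (fun y => -U y) (fun y => -q y) (-k)) := by
  have hm : MeasurableSet (Γ ∩ ball y R) := g.cl.measurableSet.inter measurableSet_ball
  have ht' : ∀ᵐ z ∂(sg d Γ y R), z ∈ Γ ∩ ball y R ∧ HasTraceAt U z (f z) := by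
    have h1 : ∀ᵐ z ∂(sg d Γ y R), HasTraceAt u z (f z) := ae_mono (Measure.restrict_mono
      (inter_subset_inter_right _ (hb.trans (ball_subset_ball hr))) le_rfl) ht
    have h2 : ∀ᵐ z ∂(sg d Γ y R), z ∈ Γ ∩ ball y R := ae_restrict_mem hm
    filter_upwards [h1, h2] with z z1 z2
    exact ⟨z2, tr_congr z1 (hb z2.2) hU⟩
  have hG := h.mono (sdiff_subset_sdiff_left hb : ball y R \ Γ ⊆ ball x r' \ Γ)
  refine ⟨fun k hk => ⟨hG, ?_⟩, fun k hk => ⟨hG.neg, ?_⟩⟩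
  · filter_upwards [ht'] with z hz
    exact ⟨_, hk z hz.1, hz.2⟩
  · filter_upwards [ht'] with z hz
    exact ⟨_, neg_le_neg (hk z hz.1), hz.2.neg⟩

theorem bnd_pt (g : Geo n d Ca Γ) (hE : Ell n d Γ A Cb) {u f : Euc n → ℝ} {v : Euc n → Euc n} {r : ℝ} (hx : x ∈ Γ)
    (hu : MemWrOn n d Γ (ball x r) u) (huv : IsDistribGradOn u v (ball x r \ Γ))
    (hs : SolOn Γ A v (ball x r \ Γ)) (hf : ContinuousOn f (Γ ∩ ball x r))
    (ht : ∀ᵐ z ∂(μH[d].restrict (Γ ∩ ball x r)), HasTraceAt u z (f z)) {y : Euc n} (hy : y ∈ ball x r) (ε : ℝ)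
    (hε : 0 < ε) : (y ∈ Γ → ∃ ρ, 0 < ρ ∧ Cl u y ρ (f y) ε) ∧ ∃ ρ, 0 < ρ ∧ ∃ c, Cl u y ρ c ε := by
  have hy' := mem_ball.1 hy
  set r' := (dist y x + r) / 2 with hr'
  have h0 := dist_nonneg (x := y) (y := x)
  obtain ⟨U, q, hG, hU⟩ := g.reduce (r' := r') hx lz lz hu huv hs
  set R := r' - dist y x
  have hR : 0 < R := by simp only [R]; linarith
  have hb : ball y R ⊆ ball x r' := ball_subset_ball' (by simp only [R]; linarith)
  have hΓ : y ∈ Γ → ∃ ρ, 0 < ρ ∧ Cl u y ρ (f y) ε := by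
    intro hyΓ
    obtain ⟨ρ, hρ, hc⟩ := Metric.continuousOn_iff.1 hf y ⟨hyΓ, hy⟩ (ε / 2) pz
    set Rb := min ρ R
    have hR1 : 0 < Rb := lt_min hρ hR
    have hbb : ball y Rb ⊆ ball x r' := (ball_subset_ball (min_le_right _ _)).trans hb
    have hfz : ∀ z ∈ Γ ∩ ball y Rb, |f z - f y| < ε / 2 := fun z hz => by
      rw [← Real.dist_eq]
      exact hc z ⟨hz.1, ball_subset_ball lz (hbb hz.2)⟩ (ball_subset_ball (min_le_left _ _) hz.2)
    obtain ⟨s1, s2⟩ := mkSbs g (show r' ≤ r by linarith) hG hU hbb ht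
    obtain ⟨ρb, p1, o1⟩ := osc_b g hE hyΓ hR1 (s1 (f y + ε / 2) fun z hz => by linarith [(abs_lt.1 (hfz z hz)).2])
      (ε / 2) pz
    obtain ⟨ρc, p2, o2⟩ := osc_b g hE hyΓ hR1 (s2 (f y - ε / 2) fun z hz => by linarith [(abs_lt.1 (hfz z hz)).1])
      (ε / 2) pz
    refine ⟨min Rb (min ρb ρc), by positivity, ?_⟩
    filter_upwards [o1, o2] with z z1 z2 hz
    have h1 := z1 (ball_subset_ball ((min_le_right _ _).trans (min_le_left _ _)) hz)
    have h2 := z2 (ball_subset_ball ((min_le_right _ _).trans (min_le_right _ _)) hz)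
    rw [← hU z (hbb (ball_subset_ball (min_le_left _ _) hz)), abs_le]
    constructor <;> linarith
  refine ⟨hΓ, ?_⟩
  by_cases hyΓ : y ∈ Γ
  · obtain ⟨ρ, h1, h2⟩ := hΓ hyΓ
    exact ⟨ρ, h1, _, h2⟩
  · obtain ⟨ρ, h1, c, h2⟩ := osc_i g hE hyΓ hR (hG.mono (sdiff_subset_sdiff_left hb)) ε hε
    refine ⟨min R ρ, by positivity, c, ?_⟩
    filter_upwards [h2] with z z1 hz
    rw [← hU z (hb (ball_subset_ball (min_le_left _ _) hz))]
    exact z1 (ball_subset_ball (min_le_right _ _) hz)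
end

section
variable {n : ℕ} {d Ca Cb : ℝ} {Γ : Set (Euc n)} {A : Euc n → Euc n →L[ℝ] Euc n} {x : Euc n} {R k : ℝ}
  {U : Euc n → ℝ} {q : Euc n → Euc n} {O : Set (Euc n)}

theorem ptw2 {u uc : Euc n → ℝ} (hO : IsOpen O) (hc : ContinuousOn uc O) (he : ∀ᵐ y ∂(volume.restrict O), uc y = u y)
    {s b : ℝ} (hs : ball x s ⊆ O) (h : ∀ᵐ y, y ∈ ball x s → -u y ≤ b) : ∀ y ∈ ball x s, -uc y ≤ b :=
  ptw (uc := fun y => -uc y) (u := fun y => -u y) hO hc.neg (by filter_upwards [he] with y hy; rw [hy]) hs h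

theorem claim1 (n : ℕ) (d Ca Cb : ℝ) (hdn : d < (n:ℝ) - 1) (hCb : 1 ≤ Cb) : ∃ α : ℝ, 0 < α ∧ α ≤ 1 ∧
    ∀ (Γ : Set (Euc n)) (A : Euc n → Euc n →L[ℝ] Euc n) (x : Euc n) (r : ℝ) (u f uc : Euc n → ℝ) (v : Euc n → Euc n),
    Geo n d Ca Γ → Ell n d Γ A Cb → x ∈ Γ → 0 < r → MemWrOn n d Γ (ball x r) u →
    IsDistribGradOn u v (ball x r \ Γ) → SolOn Γ A v (ball x r \ Γ) →
    (∀ᵐ z ∂(μH[d].restrict (Γ ∩ ball x r)), HasTraceAt u z (f z)) →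
    ContinuousOn uc (ball x r) → (∀ᵐ y ∂(volume.restrict (ball x r)), uc y = u y) → uc x = f x →
    ∀ s : ℝ, 0 < s → s < r →
            ∀ mb Mb : ℝ, (∀ᵐ y ∂(volume.restrict (ball x r \ Γ)), u y ∈ Icc mb Mb) →
            ∀ mc Mc : ℝ, (∀ z ∈ Γ ∩ ball x (Real.sqrt (s * r)), f z ∈ Icc mc Mc) →
            ∀ y ∈ ball x s, ∀ y' ∈ ball x s,
              mb ≤ Mb ∧ mc ≤ Mc ∧ uc y - uc y' ≤ 4 * (s / r) ^ (α / 2) * (Mb - mb) + (Mc - mc) := by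
  obtain ⟨α, a0, a1, hα⟩ := dcy n d Ca Cb hdn hCb
  refine ⟨α, a0, a1, fun Γ A x r u f uc v g hE hx hr hu huv hs ht hc he hux s s0 sr mb Mb h1 mc Mc h2 y hy y' hy' => ?_⟩
  set R := Real.sqrt (s * r) with hRd
  have hR : 0 < R := Real.sqrt_pos.2 pz
  have hRr : R < r := by rw [hRd, Real.sqrt_lt' hr]; nlinarith
  have hsR : s < R := by rw [hRd]; exact Real.lt_sqrt_of_sq_lt (by nlinarith)
  have hae : ∀ᵐ y, y ∈ ball x r → u y ∈ Icc mb Mb := by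
    rw [ae_restrict_iff' (measurableSet_ball.diff g.cl.measurableSet)] at h1
    have : ∀ᵐ y, y ∉ Γ := measure_eq_zero_iff_ae_notMem.1 g.null
    filter_upwards [h1, this] with y y1 y2 hy
    exact y1 ⟨hy, y2⟩
  have hxr := mem_ball_self (x := x) hr
  have b1 : uc x ≤ Mb := ptw isOpen_ball hc he le_rfl (hae.mono fun y hy hyb => (hy hyb).2) x hxr
  have b2 : -uc x ≤ -mb := ptw2 isOpen_ball hc he le_rfl (hae.mono fun y hy hyb => neg_le_neg (hy hyb).1) x hxr
  have b3 := h2 x ⟨hx, mem_ball_self hR⟩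
  rw [← hux] at b3
  have hM : mb ≤ Mb := by linarith
  refine ⟨hM, b3.1.trans b3.2, ?_⟩
  obtain ⟨U, q, hG, hU⟩ := g.reduce (r' := R) hx hR hRr hu huv hs
  obtain ⟨s1, s2⟩ := mkSbs g hRr.le hG hU le_rfl ht
  have e : (s / R) ^ α = (s / r) ^ (α / 2) := by
    have : s / R = Real.sqrt (s / r) := by
      rw [hRd, Real.sqrt_mul s0.le, Real.sqrt_div s0.le]
      have h3 := Real.mul_self_sqrt s0.le
      have h4 := Real.sqrt_pos.2 s0
      have h5 := Real.sqrt_pos.2 hr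
      field_simp
      nlinarith
    rw [this, Real.sqrt_eq_rpow, ← Real.rpow_mul pz]
    congr 1
    ring
  have hp0 : 0 ≤ (s / r) ^ (α / 2) := by positivity
  have hp1 : (s / r) ^ (α / 2) ≤ 1 := Real.rpow_le_one pz ((div_le_one hr).2 sr.le) pz
  refine le_of_forall_pos_le_add fun η hη => ?_
  set D := (Mb - mb) + η / 4
  have hD : 0 < D := by simp only [D]; linarith
  have hbr : ball x R ⊆ ball x r := ball_subset_ball hRr.le
  have hsb : ball x s ⊆ ball x R := ball_subset_ball hsR.le
  have o1 := hα Γ A x R Mc D U q g hE hx hR (s1 _ fun z hz => (h2 z hz).2) hD (by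
    filter_upwards [hae] with z hz hzb
    rw [hU z hzb]
    have := (hz (hbr hzb)).2
    simp only [D]
    linarith [b3.2]) s s0 hsR.le
  have o2 := hα Γ A x R (-mc) D _ _ g hE hx hR (s2 _ fun z hz => (h2 z hz).1) hD (by
    filter_upwards [hae] with z hz hzb
    rw [hU z hzb]
    have := (hz (hbr hzb)).1
    simp only [D]
    linarith [b3.1]) s s0 hsR.le
  rw [e] at o1 o2
  have c1 := ptw isOpen_ball hc he (hsb.trans hbr) (o1.mono fun z hz hzb => by
    rw [← hU z (hsb hzb)]; exact hz hzb) y hy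
  have c2 := ptw2 isOpen_ball hc he (hsb.trans hbr) (o2.mono fun z hz hzb => by
    rw [← hU z (hsb hzb)]; exact hz hzb) y' hy'
  have : 4 * (s / r) ^ (α / 2) * D ≤ 4 * (s / r) ^ (α / 2) * (Mb - mb) + η := by
    simp only [D]; nlinarith
  linarith

theorem claim2 (n : ℕ) (d Ca Cb : ℝ) (hd : 0 < d) (hdn : d < (n:ℝ) - 1) (hCb : 1 ≤ Cb) (α : ℝ) (a0 : 0 < α) (a1 : α ≤ 1)
    (hα : ∀ (Γ : Set (Euc n)) (A : Euc n → Euc n →L[ℝ] Euc n) (x : Euc n) (R k D : ℝ) (U : Euc n → ℝ) (q : Euc n → Euc n),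
    Geo n d Ca Γ → Ell n d Γ A Cb → x ∈ Γ → 0 < R → Sbs n d Γ A x R U q k → 0 < D →
    (∀ᵐ y, y ∈ ball x R → U y ≤ k + D) → ∀ s, 0 < s → s ≤ R →
    ∀ᵐ y, y ∈ ball x s → U y ≤ k + 2 * (s / R) ^ α * D) : ∃ Q : ℝ, 0 < Q ∧
    ∀ (Γ : Set (Euc n)) (A : Euc n → Euc n →L[ℝ] Euc n) (x : Euc n) (r : ℝ) (u uc : Euc n → ℝ) (v : Euc n → Euc n),
    Geo n d Ca Γ → Ell n d Γ A Cb → x ∈ Γ → 0 < r → MemWrOn n d Γ (ball x r) u →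
    IsDistribGradOn u v (ball x r \ Γ) → SolOn Γ A v (ball x r \ Γ) →
    (∀ᵐ z ∂(μH[d].restrict (Γ ∩ ball x r)), HasTraceAt u z 0) →
    ContinuousOn uc (ball x r) → (∀ᵐ y ∂(volume.restrict (ball x r)), uc y = u y) →
    ∀ s : ℝ, 0 < s → s < r / 2 →
            ∀ y ∈ ball x s, ∀ y' ∈ ball x s,
              ofReal (|uc y - uc y'|) ≤
                ofReal (Q * (s / r) ^ α) *
                  ((∫⁻ z in ball x r, ofReal (u z ^ 2) ∂(measW n d Γ))
                    / measW n d Γ (ball x r)) ^ ((1 : ℝ) / 2) := by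
  obtain ⟨K, hK⟩ := Geo.fkb n d Ca hdn
  obtain ⟨ca, hca, h1⟩ := dg1 n K Cb hCb
  obtain ⟨Cm, hCm⟩ := Geo.mball n d Ca hdn
  set Q := Real.sqrt (2 ^ (d + 1) * (Cm + 1) / ca) with hQd
  have hQ : 0 < Q := Real.sqrt_pos.2 pz
  have hQ2 : Q ^ 2 = 2 ^ (d + 1) * (Cm + 1) / ca := Real.sq_sqrt pz
  refine ⟨16 * Q, by positivity, fun Γ A x r u uc v g hE hx hr hu huv hs ht hc he s s0 sr y hy y' hy' => ?_⟩
  set m := measW n d Γ with hm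
  set I := ∫⁻ z in ball x r, ofReal (u z ^ 2) ∂m with hI
  have hmT : m (ball x r) ≠ ⊤ := ((hCm Γ g x hx r hr).trans_lt (ENNReal.mul_lt_top ENNReal.coe_lt_top ofReal_lt_top)).ne
  have hm0 : m (ball x r) ≠ 0 := fun h => (measure_ball_pos volume x hr).ne' (g.ac h)
  have hsr : 0 < s / r := by positivity
  by_cases hIT : I = ⊤
  · rw [hIT, ENNReal.top_div_of_ne_top hmT, ENNReal.top_rpow_of_pos nz, ENNReal.mul_top]
    · exact le_top
    · exact (ofReal_pos.2 pz).ne'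
  set J := I.toReal with hJ
  have hJ0 : 0 ≤ J := ENNReal.toReal_nonneg
  have hIJ : I = ofReal J := (ofReal_toReal hIT).symm
  set b := (m (ball x r)).toReal with hb
  have hb0 : 0 < b := ENNReal.toReal_pos hm0 hmT
  have hbm : m (ball x r) = ofReal b := (ofReal_toReal hmT).symm
  have hbC : b ≤ Cm * r ^ (d + 1) := by
    have := hCm Γ g x hx r hr
    rw [← hm, hbm, ← ofReal_coe_nnreal, ← ofReal_mul pz] at this
    exact (ofReal_le_ofReal_iff pz).1 this
  have hrhs : (I / m (ball x r)) ^ ((1:ℝ) / 2) = ofReal (Real.sqrt (J / b)) := by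
    rw [hIJ, hbm, ← ofReal_div_of_pos hb0, ofReal_rpow_of_nonneg pz nz,
      Real.sqrt_eq_rpow]
  rw [hrhs, ← ofReal_mul pz]
  refine ofReal_le_ofReal ?_
  set r' := (2 * s + r) / 2 with hr'
  have hr'0 : 0 < r' := by positivity
  have hr'r : r' < r := by linarith
  obtain ⟨U, q, hG, hU⟩ := g.reduce (r' := r') hx hr'0 hr'r hu huv hs
  obtain ⟨s1, s2⟩ := mkSbs (f := fun _ => 0) g hr'r.le hG hU le_rfl ht
  have s1 := s1 0 fun _ _ => le_rfl
  have s2 := s2 0 fun _ _ => le_rfl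
  rw [neg_zero] at s2
  have hV : r ^ (d + 1) ≤ 2 ^ (d + 1) * r' ^ (d + 1) := by
    rw [← Real.mul_rpow nz hr'0.le]
    exact Real.rpow_le_rpow hr.le lz lz
  set p := (s / r) ^ α with hp
  have hp0 : 0 < p := by positivity
  have hp1 : p ≤ 1 := Real.rpow_le_one pz ((div_le_one hr).2 lz) a0.le
  have hpp : (s / (r' / 2)) ^ α ≤ 4 * p := by
    calc (s / (r' / 2)) ^ α ≤ (4 * (s / r)) ^ α := by
          refine Real.rpow_le_rpow pz ?_ a0.le
          rw [div_le_iff₀ pz]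
          have : 4 * (s / r) * (r' / 2) = s * (2 * r' / r) := by field_simp; ring
          rw [this]
          refine le_mul_of_one_le_right s0.le ?_
          rw [one_le_div hr]
          linarith
      _ = 4 ^ α * p := Real.mul_rpow nz pz
      _ ≤ 4 * p := by
          refine mul_le_mul_of_nonneg_right ?_ hp0.le
          calc (4:ℝ) ^ α ≤ 4 ^ (1:ℝ) := Real.rpow_le_rpow_of_exponent_le nz a1
            _ = 4 := Real.rpow_one _
  have hball : ball x r' ⊆ ball x r := ball_subset_ball hr'r.le
  have hsb : ball x s ⊆ ball x r' := ball_subset_ball lz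
  refine le_of_forall_pos_le_add fun η hη => ?_
  set H := Q * Real.sqrt (J / b) + η / 16 with hH
  have hH0 : 0 < H := by positivity
  have hJH : J ≤ ca * H ^ 2 * r' ^ (d + 1) := by
    have hsq : Q ^ 2 * (J / b) ≤ H ^ 2 := by
      have h3 := Real.sq_sqrt (show 0 ≤ J / b by positivity)
      calc Q ^ 2 * (J / b) = (Q * Real.sqrt (J / b)) ^ 2 := by rw [mul_pow, h3]
        _ ≤ H ^ 2 := by rw [hH]; gcongr; linarith
    have hb2 : b ≤ (Cm + 1) * (2 ^ (d + 1) * r' ^ (d + 1)) :=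
      hbC.trans (mul_le_mul lz hV pz pz)
    calc J = J / b * b := by field_simp
      _ ≤ J / b * ((Cm + 1) * (2 ^ (d + 1) * r' ^ (d + 1))) := by gcongr
      _ = ca * (Q ^ 2 * (J / b)) * r' ^ (d + 1) := by rw [hQ2]; field_simp
      _ ≤ _ := by gcongr
  have key : ∀ (W : Euc n → ℝ) (q : Euc n → Euc n), (∀ z ∈ ball x r', |W z| = |u z|) → Sbs n d Γ A x r' W q 0 →
      ∀ᵐ z, z ∈ ball x s → W z ≤ 8 * p * H := by
    intro W q hW hS
    have o := h1 d Ca Γ A x r' (r' ^ (d + 1)) 0 W q g hE hr'0 pz (hK Γ g x hx r' hr'0) hS H hH0 (by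
      calc _ ≤ ∫⁻ z in ball x r', ofReal (u z ^ 2) ∂m := by
            refine setLIntegral_mono' measurableSet_ball fun z hz => ?_
            rw [← sq_abs (u z), ← hW z hz, ofReal_pow (abs_nonneg _), ← Real.enorm_eq_ofReal (abs_nonneg _)]
            refine en_mono (le_max_right _ _) ?_
            rw [sub_zero]
            exact max_le (le_abs_self _) (abs_nonneg _)
        _ ≤ I := lintegral_mono_set hball
        _ ≤ _ := by rw [hIJ]; exact ofReal_le_ofReal hJH)
    have o2 := hα Γ A x (r' / 2) 0 H W q g hE hx pz (hS.mono lz le_rfl) hH0 o s s0 lz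
    filter_upwards [o2] with z hz hzb
    refine (hz hzb).trans ?_
    nlinarith
  have k1 := key U q (fun z hz => by rw [hU z hz]) s1
  have k2 := key _ _ (fun z hz => by rw [hU z hz, abs_neg]) s2
  have c1 := ptw isOpen_ball hc he (hsb.trans hball) (k1.mono fun z hz hzb => by
    rw [← hU z (hsb hzb)]; exact hz hzb)
  have c2 := ptw2 isOpen_ball hc he (hsb.trans hball) (k2.mono fun z hz hzb => by
    rw [← hU z (hsb hzb)]; exact hz hzb)
  have : 16 * p * H ≤ 16 * Q * p * Real.sqrt (J / b) + η := by
    rw [hH]; nlinarith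
  rw [abs_le]
  have := c1 y hy
  have := c1 y' hy'
  have := c2 y hy
  have := c2 y' hy'
  constructor <;> linarith
end
end

theorem statement15 (n : ℕ) (hn : 2 ≤ n) (d : ℝ) (hd0 : 0 < d) (hdn : d < (n : ℝ) - 1)
    (C₀ C₁ : ℝ) (hC₀ : 1 ≤ C₀) (hC₁ : 1 ≤ C₁) :
    ∃ α : ℝ, 0 < α ∧ α ≤ 1 ∧ ∃ C : ℝ, 0 < C ∧
      ∀ Γ : Set (Euc n), Γ.Nonempty → IsClosed Γ → AhlforsRegular n d C₀ Γ →
      ∀ A : Euc n → Euc n →L[ℝ] Euc n, AEStronglyMeasurable A volume →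
        EllipticOn n d Γ A C₁ →
      ∀ x ∈ Γ, ∀ r : ℝ, 0 < r →
      ∀ u : Euc n → ℝ, ∀ v : Euc n → Euc n, ∀ g : Euc n → ℝ,
        MemWrOn n d Γ (ball x r) u →
        IsDistribGradOn u v (ball x r \ Γ) →
        SolOn Γ A v (ball x r \ Γ) →
        ContinuousOn g (Γ ∩ ball x r) →
        (∃ M : ℝ, ∀ z ∈ Γ ∩ ball x r, |g z| ≤ M) →
        (∀ᵐ z ∂(μH[d].restrict (Γ ∩ ball x r)), HasTraceAt u z (g z)) →
        ∃ uc : Euc n → ℝ, ContinuousOn uc (ball x r) ∧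
          (∀ᵐ y ∂(volume.restrict (ball x r)), uc y = u y) ∧
          (∀ s : ℝ, 0 < s → s < r →
            ∀ m₁ M₁ : ℝ, (∀ᵐ y ∂(volume.restrict (ball x r \ Γ)), u y ∈ Icc m₁ M₁) →
            ∀ m₂ M₂ : ℝ, (∀ z ∈ Γ ∩ ball x (Real.sqrt (s * r)), g z ∈ Icc m₂ M₂) →
            ∀ y ∈ ball x s, ∀ y' ∈ ball x s,
              uc y - uc y' ≤ C * (s / r) ^ α * (M₁ - m₁) + C * (M₂ - m₂)) ∧
          ((∀ᵐ z ∂(μH[d].restrict (Γ ∩ ball x r)), HasTraceAt u z 0) →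
            ∀ s : ℝ, 0 < s → s < r / 2 →
            ∀ y ∈ ball x s, ∀ y' ∈ ball x s,
              ENNReal.ofReal (|uc y - uc y'|) ≤
                ENNReal.ofReal (C * (s / r) ^ α) *
                  ((∫⁻ z in ball x r, ENNReal.ofReal (u z ^ 2) ∂(measW n d Γ))
                    / measW n d Γ (ball x r)) ^ ((1 : ℝ) / 2)) := by
  obtain ⟨α, a0, a1, hα⟩ := dcy n d C₀ C₁ hdn hC₁
  obtain ⟨Q, hQ, h2⟩ := claim2 n d C₀ C₁ hd0 hdn hC₁ α a0 a1 hα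
  obtain ⟨β, b0, b1, h1⟩ := claim1 n d C₀ C₁ hdn hC₁
  have hγ0 : 0 < min α (β / 2) := by positivity
  have hpow : ∀ t e : ℝ, 0 < t → t ≤ 1 → min α (β / 2) ≤ e → t ^ e ≤ t ^ min α (β / 2) := fun t e h1 h2 h3 =>
    Real.rpow_le_rpow_of_exponent_ge h1 h2 h3
  refine ⟨min α (β / 2), hγ0, (min_le_left _ _).trans a1, 4 + Q, by positivity, ?_⟩
  intro Γ ne cl ar A hA hEl x hx r hr u v f hu huv hs hf _ ht
  have g : Geo n d C₀ Γ := ⟨hn, hd0, hdn, hC₀, ne, cl, ar⟩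
  have hE : Ell n d Γ A C₁ := ⟨hA, hEl, hC₁⟩
  obtain ⟨uc, hc, he, hu1⟩ := rep (u := u) (isOpen_ball : IsOpen (ball x r)) fun y hy ε hε =>
    (bnd_pt g hE hx hu huv hs hf ht hy ε hε).2
  have hxr := mem_ball_self (x := x) hr
  have hux : uc x = f x := hu1 x hxr _ fun ε hε => (bnd_pt g hE hx hu huv hs hf ht hxr ε hε).1 hx
  refine ⟨uc, hc, he, ?_, ?_⟩
  · intro s s0 sr m₁ M₁ hm m₂ M₂ hM y hy y' hy'
    obtain ⟨c1, c2, c3⟩ := h1 Γ A x r u f uc v g hE hx hr hu huv hs ht hc he hux s s0 sr m₁ M₁ hm m₂ M₂ hM y hy y' hy'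
    refine c3.trans (add_le_add ?_ ?_)
    · refine mul_le_mul_of_nonneg_right ?_ (by linarith)
      exact mul_le_mul (by linarith) (hpow _ _ (by positivity) ((div_le_one hr).2 sr.le) (min_le_right _ _))
        (by positivity) (by positivity)
    · nlinarith
  · intro ht0 s s0 sr y hy y' hy'
    refine (h2 Γ A x r u uc v g hE hx hr hu huv hs ht0 hc he s s0 sr y hy y' hy').trans ?_
    refine mul_le_mul' (ENNReal.ofReal_le_ofReal ?_) le_rfl
    exact mul_le_mul (by linarith) (hpow _ _ (by positivity) ((div_le_one hr).2 (by linarith)) (min_le_left _ _))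
      (by positivity) (by positivity)
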